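/- arXiv:2508.17752 — 2 statements merged into one kernel-verified Lean document; each statement's English description precedes it below -/
import Mathlib

section
/- Let g = cga_ℓ(2,ℂ). Then dim H²(g,g) = 2 if ℓ ∈ {0, 1/2, 1}, and dim H²(g,g) = 1 for all ℓ ∈ (1/2)ℕ₀ with ℓ ≥ 3/2. -/
noncomputable section

/-- Kronecker delta. -/
def kron {d : ℕ} (i j : Fin d) : ℂ := if i = j then 1 else 0

/-- `IsCGA d N H D C M P` says that the Lie algebra `g`, together with the
distinguished elements `H, D, C`, `M i j` and `P n i` (with `P n i = 0` for `n > N`),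
is (a presentation of) the complex conformal Galilei algebra `cga_ℓ(d,ℂ)` with `2ℓ = N`. -/
structure IsCGA (d N : ℕ) {g : Type*} [LieRing g] [LieAlgebra ℂ g]
    (H D C : g) (M : Fin d → Fin d → g) (P : ℕ → Fin d → g) : Prop where
  skewM : ∀ i j, M j i = - M i j
  bMM : ∀ i j k r, ⁅M i j, M k r⁆ =
      (-(kron i k)) • M j r - (kron j r) • M i k + (kron i r) • M j k + (kron j k) • M i r
  bDH : ⁅D, H⁆ = (2 : ℂ) • H
  bCH : ⁅C, H⁆ = D
  bDC : ⁅D, C⁆ = (-2 : ℂ) • C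
  bHM : ∀ i j, ⁅H, M i j⁆ = 0
  bDM : ∀ i j, ⁅D, M i j⁆ = 0
  bCM : ∀ i j, ⁅C, M i j⁆ = 0
  bMP : ∀ i j k, ∀ n : ℕ, ⁅M i j, P n k⁆ = (-(kron i k)) • P n j + (kron j k) • P n i
  bHP : ∀ n ≤ N, ∀ i, ⁅H, P n i⁆ = (-(n : ℂ)) • P (n - 1) i
  bDP : ∀ n ≤ N, ∀ i, ⁅D, P n i⁆ = ((N : ℂ) - 2 * n) • P n i
  bCP : ∀ n ≤ N, ∀ i, ⁅C, P n i⁆ = ((N : ℂ) - n) • P (n + 1) i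
  bPP : ∀ m n : ℕ, ∀ i j, ⁅P m i, P n j⁆ = 0
  Pbound : ∀ n : ℕ, N < n → ∀ i, P n i = 0
  spans : Submodule.span ℂ
      (({H, D, C} : Set g) ∪ {x | ∃ i j, x = M i j} ∪ {x | ∃ n i, x = P n i}) = ⊤
  dim : Module.finrank ℂ g = d * (d - 1) / 2 + (N + 1) * d + 3

/-- The abelian ideal `V = span{P_{n,i}}`. -/
def VSpan {d : ℕ} {g : Type*} [LieRing g] [LieAlgebra ℂ g]
    (N : ℕ) (P : ℕ → Fin d → g) : Submodule ℂ g :=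
  Submodule.span ℂ {x | ∃ n ≤ N, ∃ i, x = P n i}

/-- Adjoint Chevalley–Eilenberg coboundary of a linear `1`-cochain. -/
def cob {g : Type*} [LieRing g] [LieAlgebra ℂ g] (ω : g →ₗ[ℂ] g) (a b : g) : g :=
  ⁅a, ω b⁆ - ⁅b, ω a⁆ - ω ⁅a, b⁆

/-- A `2`-cocycle of a Lie algebra with values in the adjoint module:
an alternating bilinear map satisfying the cocycle identity. -/
structure IsAdCocycle2 {g : Type*} [LieRing g] [LieAlgebra ℂ g] (φ : g → g → g) : Prop where
  addl : ∀ a b c, φ (a + b) c = φ a c + φ b c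
  smull : ∀ (t : ℂ) (a b), φ (t • a) b = t • φ a b
  skew : ∀ a b, φ b a = - φ a b
  cocycle : ∀ a b c,
    ⁅a, φ b c⁆ - ⁅b, φ a c⁆ + ⁅c, φ a b⁆
      - φ ⁅a, b⁆ c + φ ⁅a, c⁆ b - φ ⁅b, c⁆ a = 0

/-- `H²(g,g) = 0`: every adjoint `2`-cocycle is a coboundary. -/
def H2IsTrivial (g : Type*) [LieRing g] [LieAlgebra ℂ g] : Prop :=
  ∀ φ : g → g → g, IsAdCocycle2 φ → ∃ ω : g →ₗ[ℂ] g, ∀ a b, φ a b = cob ω a b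

/-- `H²(g,g) ≅ ℂ`: there is a cocycle which is not a coboundary and which spans
the cocycles modulo coboundaries. -/
def H2Dim1 (g : Type*) [LieRing g] [LieAlgebra ℂ g] : Prop :=
  ∃ ψ : g → g → g, IsAdCocycle2 ψ ∧
    (∀ ω : g →ₗ[ℂ] g, ¬ (∀ a b, ψ a b = cob ω a b)) ∧
    ∀ φ : g → g → g, IsAdCocycle2 φ → ∃ (c : ℂ) (ω : g →ₗ[ℂ] g),
      ∀ a b, φ a b = c • ψ a b + cob ω a b

/-- `dim H²(g,g) = 2`. -/
def H2Dim2 (g : Type*) [LieRing g] [LieAlgebra ℂ g] : Prop :=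
  ∃ ψ₁ ψ₂ : g → g → g, IsAdCocycle2 ψ₁ ∧ IsAdCocycle2 ψ₂ ∧
    (∀ c₁ c₂ : ℂ, (∃ ω : g →ₗ[ℂ] g, ∀ a b, c₁ • ψ₁ a b + c₂ • ψ₂ a b = cob ω a b) →
      c₁ = 0 ∧ c₂ = 0) ∧
    ∀ φ : g → g → g, IsAdCocycle2 φ → ∃ (c₁ c₂ : ℂ) (ω : g →ₗ[ℂ] g),
      ∀ a b, φ a b = c₁ • ψ₁ a b + c₂ • ψ₂ a b + cob ω a b

/-- A presentation of the complexified `cga_ℓ(2,ℂ)`, `2ℓ = N`, in which the rotation generator acts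
diagonally: `j` is `1` on the `p n`, `-1` on the `q n` and `0` on the `sl₂`-triple `h, d, c`. -/
structure DiagCGA (N : ℕ) {g : Type*} [LieRing g] [LieAlgebra ℂ g]
    (h d c j : g) (p q : ℕ → g) : Prop where
  dh : ⁅d, h⁆ = (2 : ℂ) • h
  ch : ⁅c, h⁆ = d
  dc : ⁅d, c⁆ = (-2 : ℂ) • c
  jh : ⁅j, h⁆ = 0
  jd : ⁅j, d⁆ = 0
  jc : ⁅j, c⁆ = 0
  jp : ∀ n, ⁅j, p n⁆ = p n
  jq : ∀ n, ⁅j, q n⁆ = -q n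
  hp : ∀ n ≤ N, ⁅h, p n⁆ = (-(n : ℂ)) • p (n - 1)
  hq : ∀ n ≤ N, ⁅h, q n⁆ = (-(n : ℂ)) • q (n - 1)
  dp : ∀ n ≤ N, ⁅d, p n⁆ = ((N : ℂ) - 2 * n) • p n
  dq : ∀ n ≤ N, ⁅d, q n⁆ = ((N : ℂ) - 2 * n) • q n
  cp : ∀ n ≤ N, ⁅c, p n⁆ = ((N : ℂ) - n) • p (n + 1)
  cq : ∀ n ≤ N, ⁅c, q n⁆ = ((N : ℂ) - n) • q (n + 1)
  pp : ∀ m n, ⁅p m, p n⁆ = 0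
  qq : ∀ m n, ⁅q m, q n⁆ = 0
  pq : ∀ m n, ⁅p m, q n⁆ = 0
  eq_top : ∀ S : Submodule ℂ g, h ∈ S → d ∈ S → c ∈ S → j ∈ S →
    (∀ n ≤ N, p n ∈ S) → (∀ n ≤ N, q n ∈ S) → S = ⊤
  finrank_eq : Module.finrank ℂ g = 2 * N + 6

section

variable {g : Type*} [LieRing g] [LieAlgebra ℂ g]

theorem IsCGA.diagCGA {N : ℕ} {H D C : g} {M : Fin 2 → Fin 2 → g} {P : ℕ → Fin 2 → g}
    (hg : IsCGA 2 N H D C M P) :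
    DiagCGA N H D C ((-Complex.I) • M 0 1) (fun n => P n 0 + Complex.I • P n 1)
      (fun n => P n 0 - Complex.I • P n 1) := by
  have hMP0 : ∀ n, ⁅M 0 1, P n 0⁆ = - P n 1 := fun n => by simp [hg.bMP, kron]
  have hMP1 : ∀ n, ⁅M 0 1, P n 1⁆ = P n 0 := fun n => by simp [hg.bMP, kron]
  have hskew : ∀ i, M i i = 0 := fun i => by
    have : (2 : ℂ) • M i i = 0 := by
      rw [two_smul]
      nth_rewrite 1 [hg.skewM i i]
      exact neg_add_cancel _
    simpa using this
  have skew : ∀ {a b x : g}, ⁅a, b⁆ = x → ⁅b, a⁆ = -x := fun h => by rw [← lie_skew, h]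
  refine
  { dh := hg.bDH
    ch := hg.bCH
    dc := hg.bDC
    jh := by simp [skew (hg.bHM 0 1)]
    jd := by simp [skew (hg.bDM 0 1)]
    jc := by simp [skew (hg.bCM 0 1)]
    jp := fun n => by
      simp only [smul_lie, lie_add, lie_smul, hMP0, hMP1, smul_smul, smul_neg]
      simp [add_comm]
    jq := fun n => by
      simp only [smul_lie, lie_sub, lie_smul, hMP0, hMP1, smul_smul, smul_neg]
      simp
    hp := fun n hn => by simp [hg.bHP n hn, smul_comm Complex.I]
    hq := fun n hn => by simp [hg.bHP n hn, smul_comm Complex.I, smul_sub]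
    dp := fun n hn => by simp [hg.bDP n hn, smul_comm Complex.I]
    dq := fun n hn => by simp [hg.bDP n hn, smul_comm Complex.I, smul_sub]
    cp := fun n hn => by simp [hg.bCP n hn, smul_comm Complex.I]
    cq := fun n hn => by simp [hg.bCP n hn, smul_comm Complex.I, smul_sub]
    pp := fun m n => by simp [hg.bPP]
    qq := fun m n => by simp [hg.bPP]
    pq := fun m n => by simp [hg.bPP]
    eq_top := ?_
    finrank_eq := by rw [hg.dim]; omega }
  intro S hH hD hC hj hp hq
  rw [eq_top_iff, ← hg.spans, Submodule.span_le]
  have hM01 : M 0 1 ∈ S := by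
    have := S.smul_mem Complex.I hj
    simpa [smul_smul] using this
  rintro x ((hx | ⟨i, k, rfl⟩) | ⟨n, i, rfl⟩)
  · rcases hx with rfl | rfl | rfl <;> assumption
  · fin_cases i <;> fin_cases k
    · simp [hskew]
    · exact hM01
    · simpa [hg.skewM 0 1] using hM01
    · simp [hskew]
  · by_cases hn : n ≤ N
    · fin_cases i
      · have := S.smul_mem (1 / 2 : ℂ) (S.add_mem (hp n hn) (hq n hn))
        rwa [show (1 / 2 : ℂ) • (P n 0 + Complex.I • P n 1 + (P n 0 - Complex.I • P n 1)) =
          P n 0 by module] at this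
      · have := S.smul_mem (-Complex.I / 2 : ℂ) (S.sub_mem (hp n hn) (hq n hn))
        have hI : ((-Complex.I / 2) * (2 * Complex.I) : ℂ) = 1 := by
          linear_combination (-1 : ℂ) * Complex.I_mul_I
        rwa [show (-Complex.I / 2) • (P n 0 + Complex.I • P n 1 - (P n 0 - Complex.I • P n 1)) =
          ((-Complex.I / 2) * (2 * Complex.I) : ℂ) • P n 1 by module, hI, one_smul] at this
    · simp [hg.Pbound n (by omega)]

namespace DiagCGA

variable {N : ℕ} {h d c j : g} {p q : ℕ → g}

/-- Exchanging the two abelian summands. -/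
theorem swap (G : DiagCGA N h d c j p q) : DiagCGA N h d c (-j) q p where
  dh := G.dh
  ch := G.ch
  dc := G.dc
  jh := by simp [G.jh]
  jd := by simp [G.jd]
  jc := by simp [G.jc]
  jp n := by simp [G.jq]
  jq n := by simp [G.jp]
  hp := G.hq
  hq := G.hp
  dp := G.dq
  dq := G.dp
  cp := G.cq
  cq := G.cp
  pp := G.qq
  qq := G.pp
  pq m n := by rw [← lie_skew, G.pq, neg_zero]
  eq_top S hh hd hc hj hp hq := G.eq_top S hh hd hc (by simpa using hj) hq hp
  finrank_eq := G.finrank_eq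

/-- Index type of the standard basis `h, d, c, j, p n, q n`. -/
abbrev Index (N : ℕ) := Fin 4 ⊕ (Fin (N + 1) ⊕ Fin (N + 1))

/-- The standard family indexed by `Index N`; the value type is arbitrary so that it can also
be used for weights and for prescribing linear maps. -/
def family (N : ℕ) {W : Type*} (h d c j : W) (p q : ℕ → W) : Index N → W :=
  Sum.elim ![h, d, c, j] (Sum.elim (fun n => p n) (fun n => q n))

/-- The standard basis `h, d, c, j, p n, q n`. -/
def basis (G : DiagCGA N h d c j p q) : Module.Basis (Index N) ℂ g :=
  basisOfTopLeSpanOfCardEqFinrank (family N h d c j p q)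
    (G.eq_top (Submodule.span ℂ (Set.range (family N h d c j p q)))
      (Submodule.subset_span ⟨.inl 0, rfl⟩) (Submodule.subset_span ⟨.inl 1, rfl⟩)
      (Submodule.subset_span ⟨.inl 2, rfl⟩) (Submodule.subset_span ⟨.inl 3, rfl⟩)
      (fun n hn => Submodule.subset_span ⟨.inr (.inl ⟨n, by omega⟩), rfl⟩)
      (fun n hn => Submodule.subset_span ⟨.inr (.inr ⟨n, by omega⟩), rfl⟩)).ge
    (by rw [G.finrank_eq]; simp; omega)

theorem basis_apply (G : DiagCGA N h d c j p q) (i : Index N) :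
    G.basis i = family N h d c j p q i := by
  rw [basis, coe_basisOfTopLeSpanOfCardEqFinrank]

theorem finiteDimensional (G : DiagCGA N h d c j p q) : FiniteDimensional ℂ g :=
  G.basis.finiteDimensional_of_finite

theorem linearMap_ext (G : DiagCGA N h d c j p q) {W : Type*} [AddCommGroup W] [Module ℂ W]
    {f f' : g →ₗ[ℂ] W} (hh : f h = f' h) (hd : f d = f' d) (hc : f c = f' c) (hj : f j = f' j)
    (hp : ∀ n ≤ N, f (p n) = f' (p n)) (hq : ∀ n ≤ N, f (q n) = f' (q n)) : f = f' :=
  LinearMap.eqLocus_eq_top.mp <| G.eq_top _ hh hd hc hj hp hq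

theorem exists_linearMap (G : DiagCGA N h d c j p q) {W : Type*} [AddCommGroup W] [Module ℂ W]
    (h' d' c' j' : W) (p' q' : ℕ → W) :
    ∃ f : g →ₗ[ℂ] W, f h = h' ∧ f d = d' ∧ f c = c' ∧ f j = j' ∧
      (∀ n ≤ N, f (p n) = p' n) ∧ (∀ n ≤ N, f (q n) = q' n) := by
  have key : ∀ i, G.basis.constr ℂ (family N h' d' c' j' p' q') (family N h d c j p q i) =
      family N h' d' c' j' p' q' i := fun i => by
    rw [← G.basis_apply, Module.Basis.constr_basis]
  exact ⟨G.basis.constr ℂ (family N h' d' c' j' p' q'), key (.inl 0), key (.inl 1), key (.inl 2),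
    key (.inl 3), fun n hn => key (.inr (.inl ⟨n, by omega⟩)),
    fun n hn => key (.inr (.inr ⟨n, by omega⟩))⟩

theorem hd (G : DiagCGA N h d c j p q) : ⁅h, d⁆ = (-2 : ℂ) • h := by
  rw [← lie_skew, G.dh]; module

theorem hc (G : DiagCGA N h d c j p q) : ⁅h, c⁆ = -d := by rw [← lie_skew, G.ch]

theorem cd (G : DiagCGA N h d c j p q) : ⁅c, d⁆ = (2 : ℂ) • c := by
  rw [← lie_skew, G.dc]; module

theorem isSl2Triple (G : DiagCGA N h d c j p q) : IsSl2Triple d h (-c) where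
  h_ne_zero := by
    simpa [basis_apply, family] using G.basis.ne_zero (.inl 1)
  lie_e_f := by rw [lie_neg, G.hc, neg_neg]
  lie_h_e_nsmul := by rw [G.dh]; module
  lie_h_f_nsmul := by rw [lie_neg, G.dc]; module

/-- The `d`-weights of the standard basis. -/
def dWeight (N : ℕ) : Index N → ℝ :=
  family N 2 0 (-2) 0 (fun n => (N : ℝ) - 2 * n) (fun n => (N : ℝ) - 2 * n)

/-- The `j`-weights of the standard basis. -/
def jWeight (N : ℕ) : Index N → ℝ := family N 0 0 0 0 (fun _ => 1) (fun _ => -1)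

theorem lie_d_basis (G : DiagCGA N h d c j p q) (i : Index N) :
    ⁅d, G.basis i⁆ = (dWeight N i : ℂ) • G.basis i := by
  rw [basis_apply, dWeight]
  rcases i with i | n | n
  · fin_cases i
    · simp [family, G.dh]
    · simp [family]
    · simp [family, G.dc]
    · simp [family, ← lie_skew d j, G.jd]
  · simp [family, G.dp n (by omega)]
  · simp [family, G.dq n (by omega)]

theorem lie_j_basis (G : DiagCGA N h d c j p q) (i : Index N) :
    ⁅j, G.basis i⁆ = (jWeight N i : ℂ) • G.basis i := by
  rw [basis_apply, jWeight]
  rcases i with i | n | n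
  · fin_cases i <;> simp [family, G.jh, G.jd, G.jc]
  · simp [family, G.jp]
  · simp [family, G.jq]

theorem coord_lie (G : DiagCGA N h d c j p q) {x : g} {w : Index N → ℂ}
    (hx : ∀ i, ⁅x, G.basis i⁆ = w i • G.basis i) (i : Index N) (v : g) :
    G.basis.coord i ⁅x, v⁆ = w i * G.basis.coord i v := by
  suffices G.basis.coord i ∘ₗ (LieAlgebra.ad ℂ g x : g →ₗ[ℂ] g) = w i • G.basis.coord i from
    LinearMap.congr_fun this v
  refine G.basis.ext fun k => ?_
  by_cases hki : k = i
  · simp [hx, hki]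
  · simp [hx, hki]

theorem eq_sum_weight (G : DiagCGA N h d c j p q) {v : g} {s t : ℝ}
    (hd : ⁅d, v⁆ = (s : ℂ) • v) (hj : ⁅j, v⁆ = (t : ℂ) • v) :
    v = ∑ i with dWeight N i = s ∧ jWeight N i = t, G.basis.coord i v • G.basis i := by
  have hzero : ∀ i, ¬ (dWeight N i = s ∧ jWeight N i = t) → G.basis.coord i v = 0 := by
    intro i hi
    have h1 := G.coord_lie G.lie_d_basis i v
    have h2 := G.coord_lie G.lie_j_basis i v
    rw [hd, map_smul, smul_eq_mul, ← sub_eq_zero, ← sub_mul] at h1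
    rw [hj, map_smul, smul_eq_mul, ← sub_eq_zero, ← sub_mul] at h2
    by_contra hv
    refine hi ⟨?_, ?_⟩
    · have := (mul_eq_zero.mp h1).resolve_right hv
      exact_mod_cast (sub_eq_zero.mp this).symm
    · have := (mul_eq_zero.mp h2).resolve_right hv
      exact_mod_cast (sub_eq_zero.mp this).symm
  rw [Finset.sum_filter_of_ne (fun i _ hi => by
    by_contra hc
    exact hi (by rw [hzero i hc, zero_smul]))]
  exact (G.basis.sum_repr v).symm

theorem eq_zero_of_weight (G : DiagCGA N h d c j p q) {v : g} {s t : ℝ}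
    (hd : ⁅d, v⁆ = (s : ℂ) • v) (hj : ⁅j, v⁆ = (t : ℂ) • v)
    (hst : ∀ i, ¬ (dWeight N i = s ∧ jWeight N i = t)) : v = 0 := by
  rw [G.eq_sum_weight hd hj]
  exact Finset.sum_eq_zero fun i hi => absurd (Finset.mem_filter.mp hi).2 (hst i)

theorem exists_eq_smul_of_weight (G : DiagCGA N h d c j p q) {v : g} {s t : ℝ} (i₀ : Index N)
    (hd : ⁅d, v⁆ = (s : ℂ) • v) (hj : ⁅j, v⁆ = (t : ℂ) • v)
    (hst : ∀ i, dWeight N i = s → jWeight N i = t → i = i₀) :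
    ∃ a : ℂ, v = a • family N h d c j p q i₀ := by
  refine ⟨if dWeight N i₀ = s ∧ jWeight N i₀ = t then G.basis.coord i₀ v else 0, ?_⟩
  rw [← G.basis_apply]
  conv_lhs => rw [G.eq_sum_weight hd hj, Finset.sum_filter]
  rw [Finset.sum_eq_single i₀]
  · split_ifs <;> simp
  · intro i _ hi
    rw [if_neg fun hc => hi (hst i hc.1 hc.2)]
  · simp

theorem exists_eq_add_of_weight_zero (G : DiagCGA N h d c j p q) {v : g}
    (hd : ⁅d, v⁆ = 0) (hj : ⁅j, v⁆ = 0) : ∃ a b : ℂ, v = a • d + b • j := by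
  refine ⟨G.basis.coord (.inl 1) v, G.basis.coord (.inl 3) v, ?_⟩
  have := G.eq_sum_weight (s := 0) (t := 0) (by simpa using hd) (by simpa using hj)
  conv_lhs => rw [this, Finset.sum_filter]
  simp [dWeight, jWeight, family, Fin.sum_univ_succ, basis_apply]

end DiagCGA

end

section

variable {V : Type*} [AddCommGroup V] [Module ℂ V] [FiniteDimensional ℂ V]

theorem Module.End.exists_eq_add_of_mapsTo (W : Submodule ℂ V) (f : Module.End ℂ V)
    (hf : ∀ v ∈ W, f v ∈ W) {v : V} (hv : v ∈ W) :
    ∃ n : ℕ, ∃ a ∈ W, ∃ b ∈ W, v = a + f b ∧ (f ^ n) a = 0 := by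
  let T : Module.End ℂ W := f.restrict hf
  obtain ⟨n, hn, hn1⟩ := ((LinearMap.eventually_isCompl_ker_pow_range_pow T).and
    (Filter.eventually_ge_atTop 1)).exists
  obtain ⟨a, ha, _, ⟨b, rfl⟩, hadd⟩ := Submodule.mem_sup.mp
    (hn.sup_eq_top ▸ Submodule.mem_top (x := (⟨v, hv⟩ : W)))
  obtain ⟨k, rfl⟩ := Nat.exists_eq_add_of_le' hn1
  refine ⟨k + 1, a, a.2, ((T ^ k) b).1, ((T ^ k) b).2, ?_, ?_⟩
  · have := congrArg Subtype.val hadd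
    rw [pow_succ', Module.End.mul_apply] at this
    exact this.symm
  · have := congrArg Subtype.val (LinearMap.mem_ker.mp ha)
    rw [Module.End.pow_restrict] at this
    exact this

theorem Module.End.exists_preimage_of_mapsTo (W : Submodule ℂ V) (f : Module.End ℂ V)
    (hf : ∀ v ∈ W, f v ∈ W) (hinj : ∀ v ∈ W, f v = 0 → v = 0) {w : V} (hw : w ∈ W) :
    ∃ v ∈ W, f v = w := by
  have hS : Function.Injective (f.restrict hf) := by
    rw [← LinearMap.ker_eq_bot, LinearMap.ker_eq_bot']
    exact fun x hx => Subtype.ext (hinj x x.2 (congrArg Subtype.val hx))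
  obtain ⟨x, hx⟩ := LinearMap.injective_iff_surjective.mp hS ⟨w, hw⟩
  exact ⟨x, x.2, congrArg Subtype.val hx⟩

end

section

variable {L V : Type*} [LieRing L] [LieAlgebra ℂ L]
    [AddCommGroup V] [Module ℂ V] [LieRingModule L V] [LieModule ℂ L V] {h e f : L}

theorem IsSl2Triple.lie_h_lie_f (t : IsSl2Triple h e f) {m : V} (hm : ⁅h, m⁆ = (2 : ℂ) • m) :
    ⁅h, ⁅f, m⁆⁆ = 0 := by
  rw [leibniz_lie, hm, t.lie_lie_smul_f ℂ, neg_lie, smul_lie, lie_smul]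
  abel

theorem IsSl2Triple.lie_h_lie_e_lie_f (t : IsSl2Triple h e f) {m : V}
    (hm : ⁅h, m⁆ = (2 : ℂ) • m) : ⁅h, ⁅e, ⁅f, m⁆⁆⁆ = (2 : ℂ) • ⁅e, ⁅f, m⁆⁆ := by
  rw [leibniz_lie, t.lie_h_lie_f hm, t.lie_h_e_smul ℂ, smul_lie, lie_zero, add_zero]

/-- In a finite-dimensional representation of `sl₂`, the operator `e f` is injective on vectors
of weight `2`. -/
theorem IsSl2Triple.eq_zero_of_lie_e_lie_f_eq_zero [FiniteDimensional ℂ V]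
    (t : IsSl2Triple h e f) {m : V} (hm : ⁅h, m⁆ = (2 : ℂ) • m)
    (hef : ⁅e, ⁅f, m⁆⁆ = 0) : m = 0 := by
  let u : ℕ → V := fun k => ((LieModule.toEnd ℂ L V e) ^ k) m
  have u_succ : ∀ k, u (k + 1) = ⁅e, u k⁆ := fun k => by
    simp only [u, pow_succ', Module.End.mul_apply, LieModule.toEnd_apply_apply]
  have lie_h : ∀ k, ⁅h, u k⁆ = (2 * (k + 1) : ℂ) • u k := by
    intro k
    induction k with
    | zero => simpa [u] using hm
    | succ k ih =>
      rw [u_succ, leibniz_lie, ih, t.lie_h_e_smul ℂ, smul_lie, lie_smul]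
      push_cast
      module
  have lie_f : ∀ k, ⁅f, u (k + 1)⁆ = (-((k + 1) * (k + 2)) : ℂ) • u k := by
    have hfe : ⁅f, e⁆ = -h := by rw [← lie_skew, t.lie_e_f]
    intro k
    induction k with
    | zero =>
      rw [u_succ, leibniz_lie, hfe, neg_lie, lie_h]
      simp only [u, pow_zero, Module.End.one_apply, hef]
      push_cast
      module
    | succ k ih =>
      rw [u_succ, leibniz_lie, hfe, ih, neg_lie, lie_h, lie_smul, ← u_succ]
      push_cast
      module
  by_contra h0
  have hne : ∀ k, u k ≠ 0 := by
    intro k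
    induction k with
    | zero => simpa [u] using h0
    | succ k ih =>
      intro hk
      have := lie_f k
      rw [hk, lie_zero] at this
      refine (smul_ne_zero ?_ ih) this.symm
      rw [neg_ne_zero]
      exact_mod_cast (Nat.mul_pos k.succ_pos (Nat.succ_pos (k + 1))).ne'
  refine Set.infinite_of_injective_forall_mem (f := fun k : ℕ => (2 * (k + 1) : ℂ))
    (s := {μ | (LieModule.toEnd ℂ L V h).HasEigenvalue μ}) ?_ ?_
    (Module.End.finite_hasEigenvalue _)
  · intro a b hab
    simpa using hab
  · intro k
    exact Module.End.hasEigenvalue_of_hasEigenvector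
      ⟨Module.End.mem_eigenspace_iff.mpr (lie_h k), hne k⟩

end

section

variable {g : Type*} [LieRing g] [LieAlgebra ℂ g]

theorem lie_bilin_apply (Φ : g →ₗ[ℂ] g →ₗ[ℂ] g) (x a b : g) :
    ⁅x, Φ⁆ a b = ⁅x, Φ a b⁆ - Φ a ⁅x, b⁆ - Φ ⁅x, a⁆ b := by
  simp [LieHom.lie_apply]

variable (g) in
/-- The space of adjoint `2`-cocycles. -/
def adCocycles : Submodule ℂ (g →ₗ[ℂ] g →ₗ[ℂ] g) where
  carrier := {Φ | IsAdCocycle2 fun a b => Φ a b}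
  add_mem' {Φ Ψ} hΦ hΨ :=
    { addl := fun a b c => by simp [add_add_add_comm]
      smull := fun t a b => by simp
      skew := fun a b => by
        simp only [LinearMap.add_apply, hΦ.skew a b, hΨ.skew a b]
        abel
      cocycle := fun a b c => by
        simp only [LinearMap.add_apply, lie_add]
        rw [← add_zero (0 : g)]
        nth_rewrite 1 [← hΦ.cocycle a b c]
        rw [← hΨ.cocycle a b c]
        abel }
  zero_mem' := ⟨by simp, by simp, by simp, by simp⟩
  smul_mem' s Φ hΦ :=
    { addl := fun a b c => by simp
      smull := fun t a b => by simp
      skew := fun a b => by simp [hΦ.skew a b]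
      cocycle := fun a b c => by
        simp only [LinearMap.smul_apply, lie_smul]
        rw [← smul_zero s, ← hΦ.cocycle a b c]
        module }

theorem IsAdCocycle2.exists_mem_adCocycles {φ : g → g → g} (hφ : IsAdCocycle2 φ) :
    ∃ Φ ∈ adCocycles g, ∀ a b, Φ a b = φ a b := by
  refine ⟨LinearMap.mk₂ ℂ φ hφ.addl hφ.smull (fun a b c => ?_) (fun t a b => ?_), ?_, ?_⟩
  · rw [hφ.skew, hφ.addl, hφ.skew a b, hφ.skew a c, ← neg_add, neg_neg]
  · rw [hφ.skew, hφ.smull, hφ.skew a b]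
    simp
  · exact hφ
  · exact fun a b => rfl

/-- The coboundary operator on linear `1`-cochains. -/
def adCoboundary : (g →ₗ[ℂ] g) →ₗ[ℂ] (g →ₗ[ℂ] g →ₗ[ℂ] g) :=
  LinearMap.mk₂ ℂ (fun ω a => LinearMap.mk₂ ℂ (cob ω) (by intros; simp [cob]; abel)
    (by intros; simp [cob, smul_sub]) (by intros; simp [cob]; abel)
    (by intros; simp [cob, smul_sub]) a)
    (by intros; ext; simp [cob]; abel) (by intros; ext; simp [cob, smul_sub])
    (by intros; ext; simp [cob]) (by intros; ext; simp [cob, smul_sub])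

theorem adCoboundary_apply (ω : g →ₗ[ℂ] g) (a b : g) : adCoboundary ω a b = cob ω a b := rfl

theorem adCoboundary_mem_adCocycles (ω : g →ₗ[ℂ] g) : adCoboundary ω ∈ adCocycles g where
  addl a b c := by simp
  smull t a b := by simp
  skew a b := by
    simp only [adCoboundary_apply, cob]
    rw [← lie_skew a b, map_neg]
    abel
  cocycle a b c := by
    simp only [adCoboundary_apply, cob, lie_sub]
    have hJ : ⁅⁅a, b⁆, c⁆ = ⁅⁅a, c⁆, b⁆ - ⁅⁅b, c⁆, a⁆ := by
      rw [lie_lie a b c, ← lie_skew ⁅b, c⁆ a, ← lie_skew ⁅a, c⁆ b]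
      abel
    rw [hJ, map_sub, lie_lie a b (ω c), lie_lie a c (ω b), lie_lie b c (ω a)]
    abel

theorem lie_eq_adCoboundary {Φ : g →ₗ[ℂ] g →ₗ[ℂ] g} (hΦ : Φ ∈ adCocycles g) (x : g) :
    ⁅x, Φ⁆ = adCoboundary (Φ x) := by
  ext a b
  have h1 := hΦ.cocycle x a b
  have h2 := hΦ.skew ⁅a, b⁆ x
  have h3 := hΦ.skew a ⁅x, b⁆
  rw [lie_bilin_apply, adCoboundary_apply, cob]
  rw [← sub_eq_zero, ← h1, h2, h3]
  abel

theorem lie_mem_adCocycles {Φ : g →ₗ[ℂ] g →ₗ[ℂ] g} (hΦ : Φ ∈ adCocycles g) (x : g) :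
    ⁅x, Φ⁆ ∈ adCocycles g :=
  lie_eq_adCoboundary hΦ x ▸ adCoboundary_mem_adCocycles _

/-- Invariance under the Levi factor `⟨h, d, c, j⟩`. -/
structure LeviInvariant (h d c j : g) (Φ : g →ₗ[ℂ] g →ₗ[ℂ] g) : Prop where
  lie_h : ⁅h, Φ⁆ = 0
  lie_d : ⁅d, Φ⁆ = 0
  lie_c : ⁅c, Φ⁆ = 0
  lie_j : ⁅j, Φ⁆ = 0

namespace DiagCGA

variable {N : ℕ} {h d c j : g} {p q : ℕ → g}

theorem coord_lie_bilin (G : DiagCGA N h d c j p q) {x : g} {w : Index N → ℂ}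
    (hx : ∀ i, ⁅x, G.basis i⁆ = w i • G.basis i) (Φ : g →ₗ[ℂ] g →ₗ[ℂ] g) (i k l : Index N) :
    G.basis.coord l (⁅x, Φ⁆ (G.basis i) (G.basis k)) =
      (w l - w i - w k) * G.basis.coord l (Φ (G.basis i) (G.basis k)) := by
  rw [lie_bilin_apply, map_sub, map_sub, G.coord_lie hx, hx, hx]
  simp only [map_smul, LinearMap.smul_apply, smul_eq_mul]
  ring

theorem coord_pow_lie_bilin (G : DiagCGA N h d c j p q) {x : g} {w : Index N → ℂ}
    (hx : ∀ i, ⁅x, G.basis i⁆ = w i • G.basis i) (Φ : g →ₗ[ℂ] g →ₗ[ℂ] g) (i k l : Index N)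
    (n : ℕ) :
    G.basis.coord l (((LieModule.toEnd ℂ g (g →ₗ[ℂ] g →ₗ[ℂ] g) x ^ n) Φ) (G.basis i)
      (G.basis k)) = (w l - w i - w k) ^ n * G.basis.coord l (Φ (G.basis i) (G.basis k)) := by
  induction n with
  | zero => simp
  | succ n ih =>
    rw [pow_succ', Module.End.mul_apply, LieModule.toEnd_apply_apply, G.coord_lie_bilin hx, ih]
    ring

theorem lie_eq_zero_of_pow (G : DiagCGA N h d c j p q) {Φ : g →ₗ[ℂ] g →ₗ[ℂ] g} {n : ℕ}
    (hΦ : (LieModule.toEnd ℂ g (g →ₗ[ℂ] g →ₗ[ℂ] g) (d + Complex.I • j) ^ n) Φ = 0) :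
    ⁅d, Φ⁆ = 0 ∧ ⁅j, Φ⁆ = 0 := by
  have key : ∀ i k l, G.basis.coord l (Φ (G.basis i) (G.basis k)) = 0 ∨
      (dWeight N l - dWeight N i - dWeight N k = 0 ∧
        jWeight N l - jWeight N i - jWeight N k = 0) := by
    intro i k l
    have := G.coord_pow_lie_bilin (x := d + Complex.I • j)
      (w := fun i => (dWeight N i : ℂ) + Complex.I * jWeight N i)
      (fun i => by rw [add_lie, smul_lie, G.lie_d_basis, G.lie_j_basis]; module) Φ i k l n
    rw [hΦ] at this
    simp only [LinearMap.zero_apply, map_zero] at this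
    rcases mul_eq_zero.mp this.symm with h0 | h0
    · right
      have h1 := eq_zero_of_pow_eq_zero h0
      constructor
      · simpa using congrArg Complex.re h1
      · simpa using congrArg Complex.im h1
    · exact .inl h0
  constructor
  · refine G.basis.ext fun i => G.basis.ext fun k => G.basis.ext_elem fun l => ?_
    have := G.coord_lie_bilin G.lie_d_basis Φ i k l
    rcases key i k l with h0 | h0
    · rw [h0, mul_zero] at this
      simpa using this
    · rw [← Complex.ofReal_sub, ← Complex.ofReal_sub, h0.1, Complex.ofReal_zero, zero_mul] at this
      simpa using this
  · refine G.basis.ext fun i => G.basis.ext fun k => G.basis.ext_elem fun l => ?_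
    have := G.coord_lie_bilin G.lie_j_basis Φ i k l
    rcases key i k l with h0 | h0
    · rw [h0, mul_zero] at this
      simpa using this
    · rw [← Complex.ofReal_sub, ← Complex.ofReal_sub, h0.2, Complex.ofReal_zero, zero_mul] at this
      simpa using this

/-- Modulo coboundaries, every cocycle has weight zero. -/
theorem exists_weight_zero (G : DiagCGA N h d c j p q) {Φ : g →ₗ[ℂ] g →ₗ[ℂ] g}
    (hΦ : Φ ∈ adCocycles g) :
    ∃ Ψ ∈ adCocycles g, (∃ ω, Φ = Ψ + adCoboundary ω) ∧ ⁅d, Ψ⁆ = 0 ∧ ⁅j, Ψ⁆ = 0 := by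
  have := G.finiteDimensional
  obtain ⟨n, Ψ, hΨ, X, hX, hadd, hpow⟩ := Module.End.exists_eq_add_of_mapsTo (adCocycles g)
    (LieModule.toEnd ℂ g (g →ₗ[ℂ] g →ₗ[ℂ] g) (d + Complex.I • j))
    (fun X hX => lie_mem_adCocycles hX _) hΦ
  exact ⟨Ψ, hΨ, ⟨X (d + Complex.I • j), by rw [← lie_eq_adCoboundary hX]; exact hadd⟩,
    G.lie_eq_zero_of_pow hpow⟩

theorem exists_leviInvariant (G : DiagCGA N h d c j p q) {Φ : g →ₗ[ℂ] g →ₗ[ℂ] g}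
    (hΦ : Φ ∈ adCocycles g) :
    ∃ Ψ ∈ adCocycles g, (∃ ω, Φ = Ψ + adCoboundary ω) ∧ LeviInvariant h d c j Ψ := by
  have := G.finiteDimensional
  obtain ⟨Ψ, hΨ, ⟨ω, rfl⟩, hd, hj⟩ := G.exists_weight_zero hΦ
  have t := G.isSl2Triple
  let W : Submodule ℂ (g →ₗ[ℂ] g →ₗ[ℂ] g) := adCocycles g ⊓
    (LieModule.toEnd ℂ g (g →ₗ[ℂ] g →ₗ[ℂ] g) d).eigenspace 2 ⊓
      LinearMap.ker (LieModule.toEnd ℂ g (g →ₗ[ℂ] g →ₗ[ℂ] g) j)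
  have mem_W : ∀ X, X ∈ W ↔ (X ∈ adCocycles g ∧ ⁅d, X⁆ = (2 : ℂ) • X) ∧ ⁅j, X⁆ = 0 := fun X => by
    simp only [W, Submodule.mem_inf, Module.End.mem_eigenspace_iff, LinearMap.mem_ker,
      LieModule.toEnd_apply_apply]
  have hef : ∀ X ∈ W, (LieModule.toEnd ℂ g (g →ₗ[ℂ] g →ₗ[ℂ] g) h *
      LieModule.toEnd ℂ g (g →ₗ[ℂ] g →ₗ[ℂ] g) (-c)) X ∈ W := by
    intro X hX
    rw [mem_W] at hX ⊢
    simp only [Module.End.mul_apply, LieModule.toEnd_apply_apply]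
    refine ⟨⟨lie_mem_adCocycles (lie_mem_adCocycles hX.1.1 _) _, ?_⟩, ?_⟩
    · exact t.lie_h_lie_e_lie_f hX.1.2
    · rw [leibniz_lie j h, leibniz_lie j (-c), hX.2, G.jh, lie_neg, G.jc]
      simp
  have hhΨ : -⁅h, Ψ⁆ ∈ W := by
    rw [mem_W]
    refine ⟨⟨neg_mem (lie_mem_adCocycles hΨ h), ?_⟩, ?_⟩
    · rw [lie_neg, leibniz_lie, hd, G.dh, smul_lie, lie_zero]
      simp
    · rw [lie_neg, leibniz_lie, hj, G.jh]
      simp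
  obtain ⟨X, hXmem, hX⟩ := Module.End.exists_preimage_of_mapsTo W _ hef
    (fun X hX h0 => t.eq_zero_of_lie_e_lie_f_eq_zero ((mem_W _).mp hX).1.2 h0) hhΨ
  have hX' : ⁅h, ⁅-c, X⁆⁆ = -⁅h, Ψ⁆ := hX
  have hXW := (mem_W _).mp hXmem
  let Ψ' := Ψ + ⁅-c, X⁆
  have hh' : ⁅h, Ψ'⁆ = 0 := by simp only [Ψ', lie_add, hX', add_neg_cancel]
  have hd' : ⁅d, Ψ'⁆ = 0 := by
    simp only [Ψ', lie_add, hd, t.lie_h_lie_f hXW.1.2, add_zero]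
  have hj' : ⁅j, Ψ'⁆ = 0 := by
    simp only [Ψ', lie_add, hj, leibniz_lie j (-c), hXW.2, lie_neg, G.jc]
    simp
  refine ⟨Ψ', add_mem hΨ (lie_mem_adCocycles hXW.1.1 _), ⟨ω - X (-c), ?_⟩, ?_⟩
  · rw [map_sub, ← lie_eq_adCoboundary hXW.1.1]
    simp only [Ψ']
    abel
  refine ⟨hh', hd', ?_, hj'⟩
  by_contra hc
  have prim : t.HasPrimitiveVectorWith ⁅c, Ψ'⁆ (-2 : ℂ) :=
    { ne_zero := hc
      lie_h := by rw [leibniz_lie, hd', G.dc, lie_zero, smul_lie, add_zero]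
      lie_e := by rw [leibniz_lie, hh', G.hc, lie_zero, neg_lie, hd', neg_zero, add_zero] }
  obtain ⟨n, hn⟩ := prim.exists_nat
  have : ((n + 2 : ℕ) : ℂ) = 0 := by push_cast; rw [← hn]; ring
  exact absurd (Nat.cast_eq_zero.mp this) (by omega)

/-- To prove a linear statement for all elements, it suffices to check the generators. -/
theorem induction (G : DiagCGA N h d c j p q) {motive : g → Prop}
    (add : ∀ x y, motive x → motive y → motive (x + y))
    (smul : ∀ (t : ℂ) x, motive x → motive (t • x))
    (hh : motive h) (hd : motive d) (hc : motive c) (hj : motive j)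
    (hp : ∀ n ≤ N, motive (p n)) (hq : ∀ n ≤ N, motive (q n)) (x : g) : motive x := by
  let S : Submodule ℂ g :=
    { carrier := {x | motive x}
      add_mem' := fun {x y} hx hy => add x y hx hy
      zero_mem' := by simpa using smul 0 h hh
      smul_mem' := fun t x hx => smul t x hx }
  exact (G.eq_top S hh hd hc hj hp hq).ge (Submodule.mem_top (x := x))

theorem d_ne_zero (G : DiagCGA N h d c j p q) : d ≠ 0 := G.isSl2Triple.h_ne_zero

theorem p_ne_zero (G : DiagCGA N h d c j p q) {n : ℕ} (hn : n ≤ N) : p n ≠ 0 := by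
  simpa [basis_apply, family] using G.basis.ne_zero (.inr (.inl ⟨n, by omega⟩))

theorem hj (G : DiagCGA N h d c j p q) : ⁅h, j⁆ = 0 := by rw [← lie_skew, G.jh, neg_zero]

theorem dj (G : DiagCGA N h d c j p q) : ⁅d, j⁆ = 0 := by rw [← lie_skew, G.jd, neg_zero]

theorem cj (G : DiagCGA N h d c j p q) : ⁅c, j⁆ = 0 := by rw [← lie_skew, G.jc, neg_zero]

theorem pj (G : DiagCGA N h d c j p q) (n : ℕ) : ⁅p n, j⁆ = -p n := by rw [← lie_skew, G.jp]

theorem pd (G : DiagCGA N h d c j p q) {n : ℕ} (hn : n ≤ N) :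
    ⁅p n, d⁆ = (2 * n - N : ℂ) • p n := by
  rw [← lie_skew, G.dp n hn]; module

theorem ph (G : DiagCGA N h d c j p q) {n : ℕ} (hn : n ≤ N) :
    ⁅p n, h⁆ = (n : ℂ) • p (n - 1) := by
  rw [← lie_skew, G.hp n hn]; module

theorem pc (G : DiagCGA N h d c j p q) {n : ℕ} (hn : n ≤ N) :
    ⁅p n, c⁆ = (n - N : ℂ) • p (n + 1) := by
  rw [← lie_skew, G.cp n hn]; module

end DiagCGA

theorem lie_apply_of_lie_eq_zero {Φ : g →ₗ[ℂ] g →ₗ[ℂ] g} {x : g} (hx : ⁅x, Φ⁆ = 0) (a b : g) :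
    ⁅x, Φ a b⁆ = Φ ⁅x, a⁆ b + Φ a ⁅x, b⁆ := by
  have := lie_bilin_apply Φ x a b
  rw [hx, LinearMap.zero_apply, LinearMap.zero_apply] at this
  rw [eq_comm, sub_sub, sub_eq_zero] at this
  rw [this, add_comm]

theorem apply_self_of_mem_adCocycles {Φ : g →ₗ[ℂ] g →ₗ[ℂ] g} (hΦ : Φ ∈ adCocycles g) (a : g) :
    Φ a a = 0 := by
  have h1 : Φ a a = -Φ a a := hΦ.skew a a
  have : (2 : ℂ) • Φ a a = 0 := by
    rw [two_smul]
    nth_rewrite 1 [h1]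
    exact neg_add_cancel _
  simpa using this

namespace LeviInvariant

variable {N : ℕ} {h d c j : g} {p q : ℕ → g} {Φ : g →ₗ[ℂ] g →ₗ[ℂ] g}

theorem swap (hI : LeviInvariant h d c j Φ) : LeviInvariant h d c (-j) Φ :=
  ⟨hI.lie_h, hI.lie_d, hI.lie_c, by rw [neg_lie, hI.lie_j, neg_zero]⟩

theorem sl2_apply (G : DiagCGA N h d c j p q) (hΦ : Φ ∈ adCocycles g)
    (hI : LeviInvariant h d c j Φ) :
    ∃ a : ℂ, Φ c h = a • d ∧ Φ d h = (2 * a) • h ∧ Φ d c = (-2 * a) • c := by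
  have hself := apply_self_of_mem_adCocycles hΦ
  obtain ⟨a, b, hab⟩ := G.exists_eq_add_of_weight_zero (v := Φ c h)
    (by rw [lie_apply_of_lie_eq_zero hI.lie_d, G.dc, G.dh]; simp)
    (by rw [lie_apply_of_lie_eq_zero hI.lie_j, G.jc, G.jh]; simp)
  have h1 : Φ d h = (2 * a) • h := by
    have := lie_apply_of_lie_eq_zero hI.lie_h c h
    rw [hab, G.hc, lie_self, map_zero, add_zero, lie_add, lie_smul, lie_smul, G.hd, G.hj, map_neg,
      LinearMap.neg_apply, ← neg_eq_iff_eq_neg] at this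
    rw [← this]
    module
  have h2 : Φ c d = (2 * a) • c := by
    have := lie_apply_of_lie_eq_zero hI.lie_c c h
    rw [hab, G.ch, lie_self, map_zero, LinearMap.zero_apply, zero_add, lie_add, lie_smul,
      lie_smul, G.cd, G.cj] at this
    rw [← this]
    module
  have h3 : (2 : ℂ) • Φ c h = (2 : ℂ) • a • d := by
    have := lie_apply_of_lie_eq_zero hI.lie_c d h
    rw [h1, lie_smul, G.ch, G.cd, hself, add_zero, map_smul, LinearMap.smul_apply] at this
    rw [← this, smul_smul]
  refine ⟨a, smul_right_injective g (two_ne_zero (α := ℂ)) h3, h1, ?_⟩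
  rw [hΦ.skew c d, h2]
  module

theorem j_sl2_apply (G : DiagCGA N h d c j p q) (hΦ : Φ ∈ adCocycles g)
    (hI : LeviInvariant h d c j Φ) : Φ j h = 0 ∧ Φ j d = 0 ∧ Φ j c = 0 := by
  have hself := apply_self_of_mem_adCocycles hΦ
  obtain ⟨a, ha, -, -⟩ := hI.sl2_apply G hΦ
  obtain ⟨m, hm⟩ := G.exists_eq_smul_of_weight (v := Φ j h) (s := 2) (t := 0) (.inl 0)
    (by rw [lie_apply_of_lie_eq_zero hI.lie_d, G.dj, G.dh]; simp)
    (by rw [lie_apply_of_lie_eq_zero hI.lie_j, G.jh]; simp)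
    (by
      rintro (i | n | n) h1 h2
      · fin_cases i <;> simp_all [DiagCGA.dWeight, DiagCGA.family]
        norm_num at h1
      · simp [DiagCGA.jWeight, DiagCGA.family] at h2
      · simp [DiagCGA.jWeight, DiagCGA.family] at h2)
  have hm : Φ j h = m • h := hm
  have h1 : Φ j d = m • d := by
    have := lie_apply_of_lie_eq_zero hI.lie_c j h
    rw [hm, G.cj, G.ch, lie_smul, G.ch, map_zero, LinearMap.zero_apply, zero_add] at this
    exact this.symm
  have h2 : Φ j c = m • c := by
    have := lie_apply_of_lie_eq_zero hI.lie_c j d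
    rw [h1, G.cj, G.cd, lie_smul, G.cd, map_zero, LinearMap.zero_apply, zero_add, map_smul,
      smul_comm] at this
    exact (smul_right_injective g (two_ne_zero (α := ℂ)) this).symm
  have h3 : m • d = 0 := by
    have : ⁅j, Φ h c⁆ - ⁅h, Φ j c⁆ + ⁅c, Φ j h⁆ - Φ ⁅j, h⁆ c + Φ ⁅j, c⁆ h - Φ ⁅h, c⁆ j = 0 :=
      hΦ.cocycle j h c
    have e1 : Φ h c = -Φ c h := hΦ.skew c h
    have e2 : Φ d j = -Φ j d := hΦ.skew j d
    rw [e1, ha, h2, hm, G.jh, G.jc, G.hc, map_neg, LinearMap.neg_apply, e2, h1, lie_smul,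
      lie_smul, lie_neg, lie_smul, G.jd, G.ch, G.hc] at this
    rw [← this]
    simp
  have hm0 : m = 0 := (smul_eq_zero.mp h3).resolve_right G.d_ne_zero
  simp [hm, h1, h2, hm0]

theorem j_p_apply (G : DiagCGA N h d c j p q) (hI : LeviInvariant h d c j Φ) :
    ∃ e : ℂ, ∀ n ≤ N, Φ j (p n) = e • p n := by
  obtain ⟨e, he⟩ := G.exists_eq_smul_of_weight (v := Φ j (p 0)) (s := N) (t := 1) (.inr (.inl 0))
    (by rw [lie_apply_of_lie_eq_zero hI.lie_d, G.dj, G.dp 0 N.zero_le]; simp)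
    (by rw [lie_apply_of_lie_eq_zero hI.lie_j, G.jp]; simp)
    (by
      rintro (i | n | n) h1 h2
      · fin_cases i <;> simp [DiagCGA.jWeight, DiagCGA.family] at h2
      · simp [DiagCGA.dWeight, DiagCGA.family] at h1
        rw [h1]
      · norm_num [DiagCGA.jWeight, DiagCGA.family] at h2)
  refine ⟨e, fun n hn => ?_⟩
  induction n with
  | zero => exact he
  | succ n ih =>
    have := lie_apply_of_lie_eq_zero hI.lie_c j (p n)
    rw [ih (by omega), G.cj, lie_smul, G.cp n (by omega), map_zero, LinearMap.zero_apply,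
      zero_add, map_smul, smul_comm] at this
    refine (smul_right_injective g (sub_ne_zero.mpr ?_) this).symm
    exact_mod_cast (show N ≠ n by omega)

theorem sl2_p_apply_of_zero (G : DiagCGA N h d c j p q) (hI : LeviInvariant h d c j Φ) {a : ℂ}
    (hh : Φ h (p 0) = a • ⁅h, p 0⁆) (hd : Φ d (p 0) = a • ⁅d, p 0⁆)
    (hc : Φ c (p 0) = a • ⁅c, p 0⁆) {n : ℕ} (hn : n ≤ N) :
    Φ h (p n) = a • ⁅h, p n⁆ ∧ Φ d (p n) = a • ⁅d, p n⁆ ∧ Φ c (p n) = a • ⁅c, p n⁆ := by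
  induction n with
  | zero => exact ⟨hh, hd, hc⟩
  | succ n ih =>
    obtain ⟨ihh, ihd, ihc⟩ := ih (by omega)
    have hne : (N : ℂ) - n ≠ 0 := sub_ne_zero.mpr (by exact_mod_cast (show N ≠ n by omega))
    have key : ∀ x, Φ x (p n) = a • ⁅x, p n⁆ → Φ ⁅c, x⁆ (p n) = a • ⁅⁅c, x⁆, p n⁆ →
        Φ x (p (n + 1)) = a • ⁅x, p (n + 1)⁆ := by
      intro x h1 h2
      have := lie_apply_of_lie_eq_zero hI.lie_c x (p n)
      rw [h1, h2, lie_smul, leibniz_lie c x (p n), smul_add, add_right_inj, G.cp n (by omega),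
        map_smul, lie_smul, smul_comm] at this
      exact (smul_right_injective g hne this).symm
    refine ⟨key h ihh (by rw [G.ch]; exact ihd), key d ihd ?_, key c ihc (by simp)⟩
    rw [G.cd, map_smul, LinearMap.smul_apply, ihc, smul_lie, smul_comm]

theorem sl2_p_apply (G : DiagCGA N h d c j p q) (hΦ : Φ ∈ adCocycles g)
    (hI : LeviInvariant h d c j Φ) {a : ℂ} (ha : Φ c h = a • d) {n : ℕ} (hn : n ≤ N) :
    Φ h (p n) = a • ⁅h, p n⁆ ∧ Φ d (p n) = a • ⁅d, p n⁆ ∧ Φ c (p n) = a • ⁅c, p n⁆ := by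
  have hp0 : ⁅h, p 0⁆ = 0 := by simp [G.hp 0 N.zero_le]
  have dp0 : ⁅d, p 0⁆ = (N : ℂ) • p 0 := by simp [G.dp 0 N.zero_le]
  have cp0 : ⁅c, p 0⁆ = (N : ℂ) • p 1 := by simp [G.cp 0 N.zero_le]
  have hΦh : Φ h (p 0) = 0 := by
    refine G.eq_zero_of_weight (s := N + 2) (t := 1)
      (by rw [lie_apply_of_lie_eq_zero hI.lie_d, G.dh, dp0]; simp; module)
      (by rw [lie_apply_of_lie_eq_zero hI.lie_j, G.jh, G.jp]; simp) ?_
    rintro (i | n | n) ⟨h1, h2⟩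
    · fin_cases i <;> simp [DiagCGA.jWeight, DiagCGA.family] at h2
    · simp [DiagCGA.dWeight, DiagCGA.family] at h1
      have : (0 : ℝ) ≤ (n : ℕ) := Nat.cast_nonneg _
      linarith
    · norm_num [DiagCGA.jWeight, DiagCGA.family] at h2
  obtain ⟨e, he⟩ := G.exists_eq_smul_of_weight (v := Φ d (p 0)) (s := N) (t := 1) (.inr (.inl 0))
    (by rw [lie_apply_of_lie_eq_zero hI.lie_d, dp0]; simp)
    (by rw [lie_apply_of_lie_eq_zero hI.lie_j, G.jp, G.jd]; simp)
    (by
      rintro (i | n | n) h1 h2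
      · fin_cases i <;> simp [DiagCGA.jWeight, DiagCGA.family] at h2
      · simp [DiagCGA.dWeight, DiagCGA.family] at h1
        rw [h1]
      · norm_num [DiagCGA.jWeight, DiagCGA.family] at h2)
  have he : Φ d (p 0) = e • p 0 := he
  have hdw : ⁅d, Φ c (p 0)⁆ = ((N - 2 : ℝ) : ℂ) • Φ c (p 0) := by
    rw [lie_apply_of_lie_eq_zero hI.lie_d, G.dc, dp0]
    simp only [map_smul, LinearMap.smul_apply]
    push_cast
    module
  have hjw : ⁅j, Φ c (p 0)⁆ = ((1 : ℝ) : ℂ) • Φ c (p 0) := by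
    rw [lie_apply_of_lie_eq_zero hI.lie_j, G.jc, G.jp]
    simp
  have hhc : ⁅h, Φ c (p 0)⁆ = -(e • p 0) := by
    rw [lie_apply_of_lie_eq_zero hI.lie_h, G.hc, hp0, map_zero, add_zero, map_neg,
      LinearMap.neg_apply, he]
  rcases Nat.eq_zero_or_pos N with hN | hN
  · have hΦc : Φ c (p 0) = 0 := by
      refine G.eq_zero_of_weight hdw hjw ?_
      rintro (i | n | n) ⟨h1, h2⟩
      · fin_cases i <;> simp [DiagCGA.jWeight, DiagCGA.family] at h2
      · simp [DiagCGA.dWeight, DiagCGA.family] at h1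
        have : (n : ℕ) = 1 := by exact_mod_cast h1
        omega
      · norm_num [DiagCGA.jWeight, DiagCGA.family] at h2
    rw [hΦc, lie_zero, eq_comm, neg_eq_zero] at hhc
    refine hI.sl2_p_apply_of_zero G ?_ ?_ ?_ hn
    · rw [hΦh, hp0, smul_zero]
    · rw [he, hhc, dp0, hN]; simp
    · rw [hΦc, cp0, hN]; simp
  · have hN' : (N : ℂ) ≠ 0 := by exact_mod_cast hN.ne'
    have hp1 : ⁅h, p 1⁆ = -p 0 := by simp [G.hp 1 hN]
    obtain ⟨k, hk⟩ := G.exists_eq_smul_of_weight (.inr (.inl ⟨1, by omega⟩)) hdw hjw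
      (by
        rintro (i | n | n) h1 h2
        · fin_cases i <;> simp [DiagCGA.jWeight, DiagCGA.family] at h2
        · simp [DiagCGA.dWeight, DiagCGA.family] at h1
          have : (n : ℕ) = 1 := by exact_mod_cast h1
          congr 2
          exact Fin.ext this
        · norm_num [DiagCGA.jWeight, DiagCGA.family] at h2)
    have hk : Φ c (p 0) = k • p 1 := hk
    have hke : k = e := by
      rw [hk, lie_smul, hp1, smul_neg, neg_inj] at hhc
      exact smul_left_injective ℂ (G.p_ne_zero N.zero_le) hhc
    have hsl := fun n hn => hI.sl2_p_apply_of_zero G (a := e / N) (n := n)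
      (by rw [hΦh, hp0, smul_zero])
      (by rw [he, dp0, smul_smul, div_mul_cancel₀ _ hN'])
      (by rw [hk, cp0, smul_smul, div_mul_cancel₀ _ hN', hke]) hn
    suffices a = e / N from this ▸ hsl n hn
    have := hΦ.cocycle c h (p 0)
    have e1 : Φ (p 1) h = -Φ h (p 1) := hΦ.skew h (p 1)
    simp only [hΦh, hk, ha, G.ch, hp0, cp0, map_smul, LinearMap.smul_apply, map_zero, e1, he,
      (hsl 1 hN).1, hp1, lie_smul, LinearMap.zero_apply, lie_zero, hke, G.pd N.zero_le] at this
    have h2 : (e - a * N) • p 0 = 0 := by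
      rw [← this]
      match_scalars
      field_simp
      simp
      ring
    rw [eq_div_iff hN']
    exact (sub_eq_zero.mp ((smul_eq_zero.mp h2).resolve_right (G.p_ne_zero N.zero_le))).symm

theorem p_p_apply (G : DiagCGA N h d c j p q) (hI : LeviInvariant h d c j Φ) {m n : ℕ}
    (hm : m ≤ N) (hn : n ≤ N) : Φ (p m) (p n) = 0 := by
  refine G.eq_zero_of_weight (s := (N - 2 * m) + (N - 2 * n)) (t := 2)
    (by
      rw [lie_apply_of_lie_eq_zero hI.lie_d, G.dp m hm, G.dp n hn]
      simp only [map_smul, LinearMap.smul_apply]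
      push_cast
      module)
    (by
      rw [lie_apply_of_lie_eq_zero hI.lie_j, G.jp, G.jp]
      push_cast
      module) ?_
  rintro (i | n | n) ⟨h1, h2⟩
  · fin_cases i <;> simp [DiagCGA.jWeight, DiagCGA.family] at h2
  · norm_num [DiagCGA.jWeight, DiagCGA.family] at h2
  · norm_num [DiagCGA.jWeight, DiagCGA.family] at h2

theorem p_zero_q_apply (G : DiagCGA N h d c j p q) (hI : LeviInvariant h d c j Φ) :
    ∃ a b : ℂ, Φ (p 0) (q N) = a • d + b • j := by
  refine G.exists_eq_add_of_weight_zero ?_ ?_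
  · rw [lie_apply_of_lie_eq_zero hI.lie_d, G.dp 0 N.zero_le, G.dq N le_rfl]
    simp only [map_smul, LinearMap.smul_apply]
    push_cast
    module
  · rw [lie_apply_of_lie_eq_zero hI.lie_j, G.jp, G.jq]
    simp

theorem p_q_apply_eq_zero (G : DiagCGA N h d c j p q) (hI : LeviInvariant h d c j Φ)
    (h0 : Φ (p 0) (q N) = 0) {m n : ℕ} (hm : m ≤ N) (hn : n ≤ N) : Φ (p m) (q n) = 0 := by
  have hrow : ∀ n ≤ N, Φ (p 0) (q n) = 0 := by
    intro n hn
    induction hn using Nat.decreasingInduction with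
    | of_succ n hn ih =>
      have := lie_apply_of_lie_eq_zero hI.lie_h (p 0) (q (n + 1))
      rw [ih, G.hp 0 N.zero_le, G.hq (n + 1) hn] at this
      simp only [lie_zero, Nat.cast_zero, neg_zero, zero_smul, map_zero, LinearMap.zero_apply,
        zero_add, map_smul, Nat.add_sub_cancel] at this
      refine (smul_eq_zero.mp this.symm).resolve_left (neg_ne_zero.mpr ?_)
      exact_mod_cast n.succ_ne_zero
    | self => exact h0
  induction m generalizing n with
  | zero => exact hrow n hn
  | succ m ih =>
    have := lie_apply_of_lie_eq_zero hI.lie_c (p m) (q n)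
    have hz : ((N : ℂ) - n) • Φ (p m) (q (n + 1)) = 0 := by
      rcases hn.eq_or_lt with rfl | hlt
      · simp
      · rw [ih (by omega) hlt, smul_zero]
    rw [ih (by omega) hn, G.cp m (by omega), G.cq n hn, map_smul, map_smul, hz, lie_zero, add_zero,
      LinearMap.smul_apply] at this
    refine (smul_eq_zero.mp this.symm).resolve_left (sub_ne_zero.mpr ?_)
    exact_mod_cast (show N ≠ m by omega)

theorem cocycle_p_zero_p_q (G : DiagCGA N h d c j p q) (hΦ : Φ ∈ adCocycles g)
    (hI : LeviInvariant h d c j Φ) {n : ℕ} (hn : n ≤ N) :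
    ⁅p 0, Φ (p n) (q N)⁆ = ⁅p n, Φ (p 0) (q N)⁆ := by
  have := hΦ.cocycle (p 0) (p n) (q N)
  simp only [G.pp, G.pq, hI.p_p_apply G N.zero_le hn, map_zero, LinearMap.zero_apply, lie_zero,
    add_zero, sub_zero] at this
  exact sub_eq_zero.mp this

theorem p_q_apply_eq_zero_of_two_le (G : DiagCGA N h d c j p q) (hI : LeviInvariant h d c j Φ)
    {n : ℕ} (hn : n ≤ N) (hn2 : 2 ≤ n) : Φ (p n) (q N) = 0 := by
  refine G.eq_zero_of_weight (s := -2 * n) (t := 0)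
    (by
      rw [lie_apply_of_lie_eq_zero hI.lie_d, G.dp n hn, G.dq N le_rfl]
      simp only [map_smul, LinearMap.smul_apply]
      push_cast
      module)
    (by
      rw [lie_apply_of_lie_eq_zero hI.lie_j, G.jp, G.jq]
      simp) ?_
  have : (2 : ℝ) ≤ n := by exact_mod_cast hn2
  rintro (i | n | n) ⟨h1, h2⟩
  · fin_cases i <;> simp [DiagCGA.dWeight, DiagCGA.family] at h1 <;> linarith
  · norm_num [DiagCGA.jWeight, DiagCGA.family] at h2
  · norm_num [DiagCGA.jWeight, DiagCGA.family] at h2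

theorem coeff_eq_zero_of_two_le (G : DiagCGA N h d c j p q) (hΦ : Φ ∈ adCocycles g)
    (hI : LeviInvariant h d c j Φ) {a b : ℂ} (hab : Φ (p 0) (q N) = a • d + b • j)
    {n : ℕ} (hn : n ≤ N) (hn2 : 2 ≤ n) : a * (2 * n - N) - b = 0 := by
  have := hI.cocycle_p_zero_p_q G hΦ hn
  rw [hI.p_q_apply_eq_zero_of_two_le G hn hn2, hab, lie_add, lie_smul, lie_smul, G.pd hn, G.pj,
    lie_zero] at this
  refine (smul_eq_zero.mp (?_ : _ • p n = 0)).resolve_right (G.p_ne_zero hn)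
  rw [this]
  module

theorem p_zero_q_apply_eq_zero (G : DiagCGA N h d c j p q) (hΦ : Φ ∈ adCocycles g)
    (hI : LeviInvariant h d c j Φ) (hN : 3 ≤ N) : Φ (p 0) (q N) = 0 := by
  obtain ⟨a, b, hab⟩ := hI.p_zero_q_apply G
  have h2 := hI.coeff_eq_zero_of_two_le G hΦ hab (n := 2) (by omega) le_rfl
  have h3 := hI.coeff_eq_zero_of_two_le G hΦ hab (n := 3) hN (by omega)
  push_cast at h2 h3
  have ha : a = 0 := by linear_combination (h3 - h2) / 2
  have hb : b = 0 := by rw [ha] at h2; linear_combination -h2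
  rw [hab, ha, hb, zero_smul, zero_smul, add_zero]


end LeviInvariant

namespace DiagCGA

variable {N : ℕ} {h d c j : g} {p q : ℕ → g}

theorem qj (G : DiagCGA N h d c j p q) (n : ℕ) : ⁅q n, j⁆ = q n := by
  rw [← lie_skew, G.jq, neg_neg]

theorem qp (G : DiagCGA N h d c j p q) (m n : ℕ) : ⁅q m, p n⁆ = 0 := by
  rw [← lie_skew, G.pq, neg_zero]

theorem jj_apply (G : DiagCGA N h d c j p q) (a b : g) : ⁅⁅j, a⁆, ⁅j, b⁆⁆ = 0 := by
  refine G.induction (motive := fun a => ⁅⁅j, a⁆, ⁅j, b⁆⁆ = 0) ?_ ?_ (by simp [G.jh])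
    (by simp [G.jd]) (by simp [G.jc]) (by simp) (fun m _ => ?_) (fun m _ => ?_) a
  · intro x y hx hy
    rw [lie_add, add_lie, hx, hy, add_zero]
  · intro t x hx
    rw [lie_smul, smul_lie, hx, smul_zero]
  all_goals
    refine G.induction (motive := fun b => ⁅⁅j, _⁆, ⁅j, b⁆⁆ = 0) ?_ ?_ (by simp [G.jh])
      (by simp [G.jd]) (by simp [G.jc]) (by simp) (fun n _ => ?_) (fun n _ => ?_) b
    · intro x y hx hy
      rw [lie_add, lie_add, hx, hy, add_zero]
    · intro t x hx
      rw [lie_smul, lie_smul, hx, smul_zero]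
    all_goals simp [G.jp, G.jq, G.pp, G.pq, G.qp, G.qq]

/-- The character of the Lie algebra dual to the rotation generator `j`. -/
theorem exists_character (G : DiagCGA N h d c j p q) :
    ∃ χ : g →ₗ[ℂ] ℂ, (∀ a b : g, χ ⁅a, b⁆ = 0) ∧ χ j = 1 ∧ χ h = 0 ∧ χ d = 0 ∧ χ c = 0 ∧
      (∀ n, χ (p n) = 0) ∧ (∀ n, χ (q n) = 0) := by
  obtain ⟨χ, hh, hd, hc, hj, hp, hq⟩ := G.exists_linearMap (W := ℂ) 0 0 0 1 0 0
  have hχj : ∀ v, χ ⁅j, v⁆ = 0 := by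
    have : χ ∘ₗ (LieAlgebra.ad ℂ g j : g →ₗ[ℂ] g) = 0 := by
      refine G.linearMap_ext ?_ ?_ ?_ ?_ (fun n hn => ?_) (fun n hn => ?_)
      · simp [G.jh]
      · simp [G.jd]
      · simp [G.jc]
      · simp
      · simp [G.jp, hp n hn]
      · simp [G.jq, hq n hn]
    exact fun v => LinearMap.congr_fun this v
  have hp' : ∀ n, χ (p n) = 0 := fun n => by rw [← G.jp]; exact hχj _
  have hq' : ∀ n, χ (q n) = 0 := fun n => by rw [← neg_neg (q n), ← G.jq, map_neg, hχj, neg_zero]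
  refine ⟨χ, fun a b => ?_, hj, hh, hd, hc, hp', hq'⟩
  have key : ∀ {x : g}, χ ⁅x, h⁆ = 0 → χ ⁅x, d⁆ = 0 → χ ⁅x, c⁆ = 0 → χ ⁅x, j⁆ = 0 →
      (∀ n ≤ N, χ ⁅x, p n⁆ = 0) → (∀ n ≤ N, χ ⁅x, q n⁆ = 0) → χ ⁅x, b⁆ = 0 := by
    intro x h1 h2 h3 h4 h5 h6
    have : χ ∘ₗ (LieAlgebra.ad ℂ g x : g →ₗ[ℂ] g) = 0 := G.linearMap_ext h1 h2 h3 h4 h5 h6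
    exact LinearMap.congr_fun this b
  refine G.induction (motive := fun a => χ ⁅a, b⁆ = 0) (fun x y hx hy => ?_) (fun t x hx => ?_)
    ?_ ?_ ?_ (hχj b) (fun m hm => ?_) (fun m hm => ?_) a
  · rw [add_lie, map_add, hx, hy, add_zero]
  · rw [smul_lie, map_smul, hx, smul_zero]
  · apply key <;> simp +contextual [G.hd, G.hc, G.hj, G.hp, G.hq, hh, hd, hp', hq']
  · apply key <;> simp +contextual [G.dh, G.dc, G.dj, G.dp, G.dq, hh, hc, hp', hq']
  · apply key <;> simp +contextual [G.ch, G.cd, G.cj, G.cp, G.cq, hd, hc, hp', hq']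
  · apply key <;> simp +contextual [G.ph hm, G.pd hm, G.pc hm, G.pj, G.pp, G.pq, hp']
  · apply key <;>
      simp +contextual [G.swap.ph hm, G.swap.pd hm, G.swap.pc hm, G.qj, G.qp, G.qq, hq']

end DiagCGA

/-- The cochain `a ∧ b ↦ χ a • ⁅j, ⁅j, b⁆⁆ - χ b • ⁅j, ⁅j, a⁆⁆`. -/
def rotationCochain (χ : g →ₗ[ℂ] ℂ) (j : g) : g →ₗ[ℂ] g →ₗ[ℂ] g :=
  LinearMap.mk₂ ℂ (fun a b => χ a • ⁅j, ⁅j, b⁆⁆ - χ b • ⁅j, ⁅j, a⁆⁆)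
    (fun a b c => by simp only [map_add, lie_add]; module)
    (fun t a b => by simp only [map_smul, lie_smul, smul_eq_mul]; module)
    (fun a b c => by simp only [map_add, lie_add]; module)
    (fun t a b => by simp only [map_smul, lie_smul, smul_eq_mul]; module)

theorem rotationCochain_apply (χ : g →ₗ[ℂ] ℂ) (j a b : g) :
    rotationCochain χ j a b = χ a • ⁅j, ⁅j, b⁆⁆ - χ b • ⁅j, ⁅j, a⁆⁆ := rfl

theorem rotationCochain_mem_adCocycles {χ : g →ₗ[ℂ] ℂ} {j : g} (hχ : ∀ a b : g, χ ⁅a, b⁆ = 0)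
    (hj : ∀ a b : g, ⁅⁅j, a⁆, ⁅j, b⁆⁆ = 0) : rotationCochain χ j ∈ adCocycles g where
  addl a b c := by simp
  smull t a b := by simp
  skew a b := by simp only [rotationCochain_apply, neg_sub]
  cocycle a b c := by
    have hδ : ∀ a b : g, ⁅j, ⁅j, ⁅a, b⁆⁆⁆ = ⁅a, ⁅j, ⁅j, b⁆⁆⁆ - ⁅b, ⁅j, ⁅j, a⁆⁆⁆ := fun a b => by
      rw [leibniz_lie j a b, lie_add, leibniz_lie j ⁅j, a⁆ b, leibniz_lie j a ⁅j, b⁆, hj a b,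
        ← lie_skew b]
      abel
    simp only [rotationCochain_apply, hχ, lie_sub, lie_smul, hδ]
    module

namespace DiagCGA

variable {N : ℕ} {h d c j : g} {p q : ℕ → g}

/-- A skew-symmetric bilinear map is determined by its values on pairs of distinct generators. -/
theorem eq_zero_of_mem_adCocycles (G : DiagCGA N h d c j p q) {Φ : g →ₗ[ℂ] g →ₗ[ℂ] g}
    (hΦ : Φ ∈ adCocycles g) (hch : Φ c h = 0) (hdh : Φ d h = 0) (hdc : Φ d c = 0)
    (hjh : Φ j h = 0) (hjd : Φ j d = 0) (hjc : Φ j c = 0)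
    (hhp : ∀ n ≤ N, Φ h (p n) = 0) (hdp : ∀ n ≤ N, Φ d (p n) = 0)
    (hcp : ∀ n ≤ N, Φ c (p n) = 0) (hjp : ∀ n ≤ N, Φ j (p n) = 0)
    (hhq : ∀ n ≤ N, Φ h (q n) = 0) (hdq : ∀ n ≤ N, Φ d (q n) = 0)
    (hcq : ∀ n ≤ N, Φ c (q n) = 0) (hjq : ∀ n ≤ N, Φ j (q n) = 0)
    (hpp : ∀ m ≤ N, ∀ n ≤ N, Φ (p m) (p n) = 0) (hqq : ∀ m ≤ N, ∀ n ≤ N, Φ (q m) (q n) = 0)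
    (hpq : ∀ m ≤ N, ∀ n ≤ N, Φ (p m) (q n) = 0) : Φ = 0 := by
  have hself := apply_self_of_mem_adCocycles hΦ
  have skew : ∀ {a b}, Φ a b = 0 → Φ b a = 0 := fun {a b} hab => by
    rw [show Φ b a = -Φ a b from hΦ.skew a b, hab, neg_zero]
  refine G.linearMap_ext ?_ ?_ ?_ ?_ (fun m hm => ?_) (fun m hm => ?_)
  · exact G.linearMap_ext (hself h) (skew hdh) (skew hch) (skew hjh) hhp hhq
  · exact G.linearMap_ext hdh (hself d) hdc (skew hjd) hdp hdq
  · exact G.linearMap_ext hch (skew hdc) (hself c) (skew hjc) hcp hcq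
  · exact G.linearMap_ext hjh hjd hjc (hself j) hjp hjq
  · exact G.linearMap_ext (skew (hhp m hm)) (skew (hdp m hm)) (skew (hcp m hm)) (skew (hjp m hm))
      (hpp m hm) (hpq m hm)
  · exact G.linearMap_ext (skew (hhq m hm)) (skew (hdq m hm)) (skew (hcq m hm)) (skew (hjq m hm))
      (fun n hn => skew (hpq n hn m hm)) (hqq m hm)

end DiagCGA

namespace LeviInvariant

variable {N : ℕ} {h d c j : g} {p q : ℕ → g} {Φ : g →ₗ[ℂ] g →ₗ[ℂ] g}

theorem exists_eq_smul_add_adCoboundary (G : DiagCGA N h d c j p q) (hΦ : Φ ∈ adCocycles g)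
    (hI : LeviInvariant h d c j Φ) (h0 : Φ (p 0) (q N) = 0) {χ : g →ₗ[ℂ] ℂ}
    (hχ : ∀ a b : g, χ ⁅a, b⁆ = 0) (hχj : χ j = 1) (hχh : χ h = 0) (hχd : χ d = 0) (hχc : χ c = 0)
    (hχp : ∀ n, χ (p n) = 0) (hχq : ∀ n, χ (q n) = 0) :
    ∃ (s : ℂ) (ω : g →ₗ[ℂ] g), Φ = s • rotationCochain χ j + adCoboundary ω := by
  obtain ⟨a, hch, hdh, hdc⟩ := hI.sl2_apply G hΦ
  obtain ⟨hjh, hjd, hjc⟩ := hI.j_sl2_apply G hΦ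
  obtain ⟨e, he⟩ := hI.j_p_apply G
  obtain ⟨e', he'⟩ := hI.swap.j_p_apply G.swap
  have hjq : ∀ n ≤ N, Φ j (q n) = (-e') • q n := fun n hn => by
    rw [neg_smul, ← he' n hn, map_neg, LinearMap.neg_apply, neg_neg]
  have hp := fun n hn => hI.sl2_p_apply G hΦ hch (n := n) hn
  have hq := fun n hn => hI.swap.sl2_p_apply G.swap hΦ hch (n := n) hn
  let ω : g →ₗ[ℂ] g := a • (LinearMap.id - (LieAlgebra.ad ℂ g j : g →ₗ[ℂ] g) ∘ₗ
    (LieAlgebra.ad ℂ g j : g →ₗ[ℂ] g)) + ((e + e') / 2 - a) • χ.smulRight j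
  have hω : ∀ v, ω v = a • (v - ⁅j, ⁅j, v⁆⁆) + ((e + e') / 2 - a) • χ v • j := fun v => by
    simp [ω]
  have ωh : ω h = a • h := by simp [hω, G.jh, hχh]
  have ωd : ω d = a • d := by simp [hω, G.jd, hχd]
  have ωc : ω c = a • c := by simp [hω, G.jc, hχc]
  have ωj : ω j = ((e + e') / 2) • j := by simp [hω, hχj]; module
  have ωp : ∀ n, ω (p n) = 0 := fun n => by simp [hω, G.jp, hχp]
  have ωq : ∀ n, ω (q n) = 0 := fun n => by simp [hω, G.jq, hχq]
  have hmem : Φ - (((e - e') / 2) • rotationCochain χ j + adCoboundary ω) ∈ adCocycles g :=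
    sub_mem hΦ (add_mem (Submodule.smul_mem _ _ (rotationCochain_mem_adCocycles hχ G.jj_apply))
      (adCoboundary_mem_adCocycles ω))
  refine ⟨(e - e') / 2, ω, sub_eq_zero.mp (G.eq_zero_of_mem_adCocycles hmem ?_ ?_ ?_ ?_ ?_ ?_
    ?_ ?_ ?_ ?_ ?_ ?_ ?_ ?_ ?_ ?_ ?_)⟩
  all_goals intros
  all_goals simp only [LinearMap.sub_apply, LinearMap.add_apply, LinearMap.smul_apply,
    rotationCochain_apply, adCoboundary_apply, cob, hχj, hχh, hχd, hχc, hχp, hχq, ωh, ωd, ωc, ωj,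
    ωp, ωq]
  · rw [hch]; simp [G.ch, G.hc, ωd]
  · rw [hdh]; simp [G.hd, G.dh, ωh]; module
  · rw [hdc]; simp [G.cd, G.dc, ωc]; module
  · rw [hjh]; simp [G.jh, G.hj]
  · rw [hjd]; simp [G.jd, G.dj]
  · rw [hjc]; simp [G.jc, G.cj]
  · rename_i n hn
    rw [(hp n hn).1, ← lie_skew (p n)]; simp [G.hp n hn, ωp]
  · rename_i n hn
    rw [(hp n hn).2.1, ← lie_skew (p n)]; simp [G.dp n hn, ωp]
  · rename_i n hn
    rw [(hp n hn).2.2, ← lie_skew (p n)]; simp [G.cp n hn, ωp]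
  · rename_i n hn
    rw [he n hn]; simp [G.jp, G.pj, ωp]; module
  · rename_i n hn
    rw [(hq n hn).1, ← lie_skew (q n)]; simp [G.hq n hn, ωq]
  · rename_i n hn
    rw [(hq n hn).2.1, ← lie_skew (q n)]; simp [G.dq n hn, ωq]
  · rename_i n hn
    rw [(hq n hn).2.2, ← lie_skew (q n)]; simp [G.cq n hn, ωq]
  · rename_i n hn
    rw [hjq n hn]; simp [G.jq, G.qj, ωq]; module
  · rename_i m hm n hn
    rw [hI.p_p_apply G hm hn]; simp [G.pp]
  · rename_i m hm n hn
    rw [hI.swap.p_p_apply G.swap hm hn]; simp [G.qq]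
  · rename_i m hm n hn
    rw [hI.p_q_apply_eq_zero G h0 hm hn]; simp [G.pq]

/-- For `N ≤ 2` the remaining component of an invariant cocycle lies on a line. -/
theorem exists_p_zero_q_apply_eq_smul (G : DiagCGA N h d c j p q) (hΦ : Φ ∈ adCocycles g)
    (hI : LeviInvariant h d c j Φ) (hN : N ≤ 2) :
    ∃ t : ℂ, Φ (p 0) (q N) = t • ((N : ℂ) • d + (N + 2 : ℂ) • j) := by
  obtain ⟨a, b, hab⟩ := hI.p_zero_q_apply G
  have hcne : c ≠ 0 := by simpa using G.isSl2Triple.f_ne_zero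
  interval_cases N
  · have := lie_apply_of_lie_eq_zero hI.lie_c (p 0) (q 0)
    rw [hab, G.cp 0 le_rfl, G.cq 0 le_rfl] at this
    simp [G.cd, G.cj, hcne] at this
    exact ⟨b / 2, by rw [hab, this]; push_cast; module⟩
  · have h1 := lie_apply_of_lie_eq_zero hI.lie_c (p 0) (q 1)
    rw [hab, G.cp 0 zero_le_one, G.cq 1 le_rfl] at h1
    simp [G.cd, G.cj] at h1
    have h2 := hI.cocycle_p_zero_p_q G hΦ (n := 1) le_rfl
    rw [hab, ← h1, lie_smul, lie_smul, lie_add, lie_smul, lie_smul, G.pd le_rfl, G.pj,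
      G.pc zero_le_one] at h2
    have h3 : (b - 3 * a) • p 1 = 0 := by
      rw [← sub_eq_zero.mpr h2]
      push_cast
      module
    have h4 := sub_eq_zero.mp ((smul_eq_zero.mp h3).resolve_right (G.p_ne_zero le_rfl))
    exact ⟨a, by rw [hab, h4]; push_cast; module⟩
  · have h2 := hI.coeff_eq_zero_of_two_le G hΦ hab (n := 2) le_rfl le_rfl
    push_cast at h2
    have hb : b = 2 * a := by linear_combination -h2
    exact ⟨a / 2, by rw [hab, hb]; push_cast; module⟩

end LeviInvariant

namespace DiagCGA

variable {N : ℕ} {h d c j : g} {p q : ℕ → g}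

theorem eq_zero_of_adCoboundary_apply (G : DiagCGA N h d c j p q) {ω : g →ₗ[ℂ] g} {s : ℂ}
    (hp : adCoboundary ω j (p 0) = s • p 0) (hq : adCoboundary ω j (q N) = s • q N) : s = 0 := by
  obtain ⟨f, fh, fd, fc, fj, fp, fq⟩ :=
    G.exists_linearMap (W := ℂ) 0 0 0 0 (fun n => if n = 0 then 1 else 0) 0
  obtain ⟨f', fh', fd', fc', fj', fp', fq'⟩ :=
    G.exists_linearMap (W := ℂ) 0 0 0 0 0 (fun n => if n = N then 1 else 0)
  have h1 : ∀ v, f ⁅j, v⁆ = f v := by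
    have : f ∘ₗ (LieAlgebra.ad ℂ g j : g →ₗ[ℂ] g) = f := by
      apply G.linearMap_ext <;>
        simp +contextual [G.jh, G.jd, G.jc, G.jp, G.jq, fh, fd, fc, fj, fq]
    exact LinearMap.congr_fun this
  have h2 : ∀ v, f' ⁅j, v⁆ = -f' v := by
    have : f' ∘ₗ (LieAlgebra.ad ℂ g j : g →ₗ[ℂ] g) = -f' := by
      apply G.linearMap_ext <;>
        simp +contextual [G.jh, G.jd, G.jc, G.jp, G.jq, fh', fd', fc', fj', fp']
    exact LinearMap.congr_fun this
  have h3 : ∀ v, f' ⁅q N, v⁆ = -f ⁅p 0, v⁆ := by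
    have : f' ∘ₗ (LieAlgebra.ad ℂ g (q N) : g →ₗ[ℂ] g) =
        -(f ∘ₗ (LieAlgebra.ad ℂ g (p 0) : g →ₗ[ℂ] g)) := by
      apply G.linearMap_ext
      · rcases N.eq_zero_or_pos with rfl | hN
        · simp [G.ph, G.swap.ph]
        · simp [G.ph, G.swap.ph le_rfl, fq' (N - 1) (by omega)]
          omega
      · simp [G.pd, G.swap.pd le_rfl, fp, fq']
        ring
      · rcases N.eq_zero_or_pos with rfl | hN
        · simp [G.pc, G.swap.pc]
        · simp [G.pc, G.swap.pc le_rfl, fp 1 hN]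
      · simp [G.pj, G.qj, fp, fq']
      · simp [G.pp, G.qp]
      · simp [G.pq, G.qq]
    exact LinearMap.congr_fun this
  have hp' := congrArg f hp
  have hq' := congrArg f' hq
  simp only [adCoboundary_apply, cob, G.jp, G.jq, map_sub, map_neg, map_smul, h1, h2, h3,
    fp 0 N.zero_le, fq' N le_rfl, if_true, smul_eq_mul] at hp' hq'
  linear_combination (-hp' - hq') / 2

end DiagCGA

theorem mem_adCocycles_of_skew {Φ : g →ₗ[ℂ] g →ₗ[ℂ] g} (hskew : ∀ a b, Φ b a = -Φ a b)
    (hcocycle : ∀ a b c, ⁅a, Φ b c⁆ - ⁅b, Φ a c⁆ + ⁅c, Φ a b⁆ - Φ ⁅a, b⁆ c + Φ ⁅a, c⁆ b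
      - Φ ⁅b, c⁆ a = 0) : Φ ∈ adCocycles g :=
  ⟨fun a b c => by simp, fun t a b => by simp, hskew, hcocycle⟩

theorem sub_smul_succ_congr {N : ℕ} {W : Type*} [AddCommGroup W] [Module ℂ W] {u v : ℕ → W}
    (huv : ∀ n ≤ N, u n = v n) {n : ℕ} (hn : n ≤ N) :
    ((N : ℂ) - n) • u (n + 1) = ((N : ℂ) - n) • v (n + 1) := by
  rcases hn.eq_or_lt with rfl | hlt
  · simp
  · rw [huv _ hlt]

theorem lie_sub_smul_eq_zero {V : Type*} [AddCommGroup V] [Module ℂ V] [LieRingModule g V]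
    [LieModule ℂ g V] {x : g} {u v : V} (hu : ⁅x, u⁆ = 0) (hv : ⁅x, v⁆ = 0) (t : ℂ) :
    ⁅x, u - t • v⁆ = 0 := by
  rw [lie_sub, lie_smul, hu, hv, smul_zero, sub_zero]

theorem LeviInvariant.sub_smul {h d c j : g} {Φ Ψ : g →ₗ[ℂ] g →ₗ[ℂ] g}
    (hΦ : LeviInvariant h d c j Φ) (hΨ : LeviInvariant h d c j Ψ) (t : ℂ) :
    LeviInvariant h d c j (Φ - t • Ψ) :=
  ⟨lie_sub_smul_eq_zero hΦ.lie_h hΨ.lie_h t, lie_sub_smul_eq_zero hΦ.lie_d hΨ.lie_d t,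
    lie_sub_smul_eq_zero hΦ.lie_c hΨ.lie_c t, lie_sub_smul_eq_zero hΦ.lie_j hΨ.lie_j t⟩

namespace DiagCGA

variable {N : ℕ} {h d c j : g} {p q : ℕ → g}

theorem lie_eq_zero_of_skew (G : DiagCGA N h d c j p q) {Φ : g →ₗ[ℂ] g →ₗ[ℂ] g} {x : g}
    (hskew : ∀ a b, Φ b a = -Φ a b) (hh : Φ h = 0) (hd : Φ d = 0) (hc : Φ c = 0) (hj : Φ j = 0)
    (hxh : Φ ⁅x, h⁆ = 0) (hxd : Φ ⁅x, d⁆ = 0) (hxc : Φ ⁅x, c⁆ = 0) (hxj : Φ ⁅x, j⁆ = 0)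
    (hpp : ∀ m ≤ N, ∀ n ≤ N, Φ (p m) (p n) = 0) (hqq : ∀ m ≤ N, ∀ n ≤ N, Φ (q m) (q n) = 0)
    (hxpp : ∀ m ≤ N, ∀ n ≤ N, Φ (p m) ⁅x, p n⁆ = 0)
    (hxqq : ∀ m ≤ N, ∀ n ≤ N, Φ (q m) ⁅x, q n⁆ = 0)
    (hxpq : ∀ m ≤ N, ∀ n ≤ N, ⁅x, Φ (p m) (q n)⁆ = Φ ⁅x, p m⁆ (q n) + Φ (p m) ⁅x, q n⁆) :
    ⁅x, Φ⁆ = 0 := by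
  have hlevi : ∀ s, Φ s = 0 → Φ ⁅x, s⁆ = 0 → ⁅x, Φ⁆ s = 0 := fun s h1 h2 =>
    LinearMap.ext fun b => by simp [h1, h2]
  have hlevi' : ∀ s y, Φ s = 0 → Φ ⁅x, s⁆ = 0 → ⁅x, Φ⁆ y s = 0 := fun s y h1 h2 => by
    simp [hskew _ y, hskew s, h1, h2]
  refine G.linearMap_ext (hlevi h hh hxh) (hlevi d hd hxd) (hlevi c hc hxc) (hlevi j hj hxj)
    (fun m hm => ?_) (fun m hm => ?_)
  all_goals
    refine G.linearMap_ext (hlevi' h _ hh hxh) (hlevi' d _ hd hxd) (hlevi' c _ hc hxc)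
      (hlevi' j _ hj hxj) (fun n hn => ?_) (fun n hn => ?_)
    all_goals rw [lie_bilin_apply, LinearMap.zero_apply, LinearMap.zero_apply]
  · rw [hpp m hm n hn, hxpp m hm n hn, hskew (p n), hxpp n hn m hm]
    simp
  · rw [hxpq m hm n hn]
    abel
  · rw [hskew (p n), hskew ⁅x, p n⁆, hskew (p n), lie_neg, hxpq n hn m hm]
    abel
  · rw [hqq m hm n hn, hxqq m hm n hn, hskew (q n), hxqq n hn m hm]
    simp

theorem mem_adCocycles_of_leviInvariant (G : DiagCGA N h d c j p q) {Φ : g →ₗ[ℂ] g →ₗ[ℂ] g}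
    (hI : LeviInvariant h d c j Φ) (hskew : ∀ a b, Φ b a = -Φ a b)
    (hh : Φ h = 0) (hd : Φ d = 0) (hc : Φ c = 0) (hj : Φ j = 0)
    (hpp : ∀ m ≤ N, ∀ n ≤ N, Φ (p m) (p n) = 0) (hqq : ∀ m ≤ N, ∀ n ≤ N, Φ (q m) (q n) = 0)
    (hppq : ∀ m ≤ N, ∀ n ≤ N, ∀ k ≤ N, ⁅p m, Φ (p n) (q k)⁆ = ⁅p n, Φ (p m) (q k)⁆)
    (hpqq : ∀ m ≤ N, ∀ n ≤ N, ∀ k ≤ N, ⁅q n, Φ (p m) (q k)⁆ = ⁅q k, Φ (p m) (q n)⁆) :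
    Φ ∈ adCocycles g := by
  refine mem_adCocycles_of_skew hskew ?_
  let J : g → g → g → g := fun a b c =>
    ⁅a, Φ b c⁆ - ⁅b, Φ a c⁆ + ⁅c, Φ a b⁆ - Φ ⁅a, b⁆ c + Φ ⁅a, c⁆ b - Φ ⁅b, c⁆ a
  have swap₁₂ : ∀ a b c, J b a c = -J a b c := fun a b c => by
    simp only [J]
    rw [hskew a b, ← lie_skew a b]
    simp only [lie_neg, map_neg, LinearMap.neg_apply]
    abel
  have swap₂₃ : ∀ a b c, J a c b = -J a b c := fun a b c => by
    simp only [J]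
    rw [hskew b c, ← lie_skew b c]
    simp only [lie_neg, map_neg, LinearMap.neg_apply]
    abel
  have add₁ : ∀ a a' b c, J (a + a') b c = J a b c + J a' b c := fun a a' b c => by
    simp only [J, map_add, add_lie, lie_add, LinearMap.add_apply]
    abel
  have smul₁ : ∀ (t : ℂ) a b c, J (t • a) b c = t • J a b c := fun t a b c => by
    simp only [J, map_smul, smul_lie, lie_smul, LinearMap.smul_apply]
    module
  have levi : ∀ {s}, ⁅s, Φ⁆ = 0 → Φ s = 0 → ∀ b c, J s b c = 0 := fun {s} h1 h2 b c => by
    simp only [J]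
    rw [lie_apply_of_lie_eq_zero h1, h2, hskew b ⁅s, c⁆, hskew s ⁅b, c⁆, h2]
    simp
  have levi₂ : ∀ {s}, ⁅s, Φ⁆ = 0 → Φ s = 0 → ∀ a c, J a s c = 0 := fun {s} h1 h2 a c => by
    rw [swap₁₂, levi h1 h2, neg_zero]
  have levi₃ : ∀ {s}, ⁅s, Φ⁆ = 0 → Φ s = 0 → ∀ a b, J a b s = 0 := fun {s} h1 h2 a c => by
    rw [swap₂₃, levi₂ h1 h2, neg_zero]
  have ppp : ∀ m ≤ N, ∀ n ≤ N, ∀ k ≤ N, J (p m) (p n) (p k) = 0 := fun m hm n hn k hk => by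
    simp [J, hpp m hm n hn, hpp m hm k hk, hpp n hn k hk, G.pp]
  have qqq : ∀ m ≤ N, ∀ n ≤ N, ∀ k ≤ N, J (q m) (q n) (q k) = 0 := fun m hm n hn k hk => by
    simp [J, hqq m hm n hn, hqq m hm k hk, hqq n hn k hk, G.qq]
  have ppq : ∀ m ≤ N, ∀ n ≤ N, ∀ k ≤ N, J (p m) (p n) (q k) = 0 := fun m hm n hn k hk => by
    simp [J, hpp m hm n hn, hppq m hm n hn k hk, G.pp, G.pq]
  have pqq : ∀ m ≤ N, ∀ n ≤ N, ∀ k ≤ N, J (p m) (q n) (q k) = 0 := fun m hm n hn k hk => by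
    simp only [J, hqq n hn k hk, hpqq m hm n hn k hk, G.qq, G.pq, lie_zero, map_zero,
      LinearMap.zero_apply]
    abel
  have pqp : ∀ m ≤ N, ∀ n ≤ N, ∀ k ≤ N, J (p m) (q n) (p k) = 0 := fun m hm n hn k hk => by
    rw [swap₂₃, ppq m hm k hk n hn, neg_zero]
  have qpq : ∀ m ≤ N, ∀ n ≤ N, ∀ k ≤ N, J (q m) (p n) (q k) = 0 := fun m hm n hn k hk => by
    rw [swap₁₂, pqq n hn m hm k hk, neg_zero]
  have third : ∀ a b, (∀ k ≤ N, J a b (p k) = 0) → (∀ k ≤ N, J a b (q k) = 0) →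
      ∀ c, J a b c = 0 := fun a b h1 h2 =>
    G.induction (fun x y hx hy => by
        rw [swap₂₃, swap₁₂, neg_neg] at hx hy ⊢
        rw [add₁, hx, hy, add_zero])
      (fun t x hx => by
        rw [swap₂₃, swap₁₂, neg_neg] at hx ⊢
        rw [smul₁, hx, smul_zero])
      (levi₃ hI.lie_h hh _ _) (levi₃ hI.lie_d hd _ _) (levi₃ hI.lie_c hc _ _)
      (levi₃ hI.lie_j hj _ _) h1 h2
  have second : ∀ a, (∀ n ≤ N, ∀ c, J a (p n) c = 0) → (∀ n ≤ N, ∀ c, J a (q n) c = 0) →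
      ∀ b c, J a b c = 0 := fun a h1 h2 =>
    G.induction (fun x y hx hy c => by
        rw [swap₁₂, add₁, swap₁₂ a x, swap₁₂ a y, hx, hy]
        simp)
      (fun t x hx c => by
        rw [swap₁₂, smul₁, swap₁₂ a x, hx]
        simp)
      (levi₂ hI.lie_h hh _) (levi₂ hI.lie_d hd _) (levi₂ hI.lie_c hc _)
      (levi₂ hI.lie_j hj _) h1 h2
  refine G.induction (motive := fun a => ∀ b c, J a b c = 0)
    (fun x y hx hy b c => by rw [add₁, hx, hy, add_zero])
    (fun t x hx b c => by rw [smul₁, hx, smul_zero])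
    (levi hI.lie_h hh) (levi hI.lie_d hd) (levi hI.lie_c hc) (levi hI.lie_j hj)
    (fun m hm => second _ (fun n hn => third _ _ (ppp m hm n hn) (ppq m hm n hn))
      (fun n hn => third _ _ (pqp m hm n hn) (pqq m hm n hn)))
    (fun m hm => second _
      (fun n hn => third _ _ (fun k hk => ?_) (qpq m hm n hn))
      (fun n hn => third _ _ (fun k hk => ?_) (qqq m hm n hn)))
  · rw [swap₁₂, pqp n hn m hm k hk, neg_zero]
  · rw [swap₂₃, qpq m hm k hk n hn, neg_zero]

/-- An invariant cocycle supported on the pairs `p m, q n` can be prescribed by its values. -/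
theorem exists_leviInvariant_of_values (G : DiagCGA N h d c j p q) {T : ℕ → ℕ → g}
    (hTh : ∀ m ≤ N, ∀ n ≤ N,
      ⁅h, T m n⁆ = (-(m : ℂ)) • T (m - 1) n + (-(n : ℂ)) • T m (n - 1))
    (hTd : ∀ m ≤ N, ∀ n ≤ N, ⁅d, T m n⁆ = ((N : ℂ) - 2 * m + (N - 2 * n)) • T m n)
    (hTc : ∀ m ≤ N, ∀ n ≤ N,
      ⁅c, T m n⁆ = ((N : ℂ) - m) • T (m + 1) n + ((N : ℂ) - n) • T m (n + 1))
    (hTj : ∀ m ≤ N, ∀ n ≤ N, ⁅j, T m n⁆ = 0)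
    (hppq : ∀ m ≤ N, ∀ n ≤ N, ∀ k ≤ N, ⁅p m, T n k⁆ = ⁅p n, T m k⁆)
    (hpqq : ∀ m ≤ N, ∀ n ≤ N, ∀ k ≤ N, ⁅q n, T m k⁆ = ⁅q k, T m n⁆) :
    ∃ Φ ∈ adCocycles g, LeviInvariant h d c j Φ ∧ Φ j = 0 ∧
      ∀ m ≤ N, ∀ n ≤ N, Φ (p m) (q n) = T m n := by
  choose F Fh Fd Fc Fj Fp Fq using fun m => G.exists_linearMap (W := g) 0 0 0 0 0 (T m)
  choose F' Fh' Fd' Fc' Fj' Fp' Fq' using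
    fun n => G.exists_linearMap (W := g) 0 0 0 0 (fun m => -T m n) 0
  obtain ⟨Φ, hh, hd, hc, hj, hp, hq⟩ := G.exists_linearMap (W := g →ₗ[ℂ] g) 0 0 0 0 F F'
  have hpq : ∀ m ≤ N, ∀ n ≤ N, Φ (p m) (q n) = T m n := fun m hm n hn => by
    rw [hp m hm, Fq m n hn]
  have hpp : ∀ m ≤ N, ∀ n ≤ N, Φ (p m) (p n) = 0 := fun m hm n hn => by
    rw [hp m hm, Fp m n hn, Pi.zero_apply]
  have hqq : ∀ m ≤ N, ∀ n ≤ N, Φ (q m) (q n) = 0 := fun m hm n hn => by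
    rw [hq m hm, Fq' m n hn, Pi.zero_apply]
  have hqp : ∀ m ≤ N, ∀ n ≤ N, Φ (q n) (p m) = -T m n := fun m hm n hn => by
    rw [hq n hn, Fp' n m hm]
  have hskew : ∀ a b, Φ b a = -Φ a b := by
    have : Φ.flip = -Φ := by
      apply G.linearMap_ext
      · apply G.linearMap_ext <;> simp +contextual [hh, hd, hc, hj, hp, hq, Fh, Fh']
      · apply G.linearMap_ext <;> simp +contextual [hh, hd, hc, hj, hp, hq, Fd, Fd']
      · apply G.linearMap_ext <;> simp +contextual [hh, hd, hc, hj, hp, hq, Fc, Fc']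
      · apply G.linearMap_ext <;> simp +contextual [hh, hd, hc, hj, hp, hq, Fj, Fj']
      · intro m hm
        apply G.linearMap_ext <;>
          simp +contextual [hm, hh, hd, hc, hj, hp m hm, Fh, Fd, Fc, Fj, hpp, hqp, Fq, Fp]
      · intro n hn
        apply G.linearMap_ext <;>
          simp +contextual [hn, hh, hd, hc, hj, hq n hn, Fh', Fd', Fc', Fj', hqq, hpq, Fq', Fp']
    exact fun a b => LinearMap.congr_fun₂ this a b
  have hI : LeviInvariant h d c j Φ := by
    constructor
    · apply G.lie_eq_zero_of_skew hskew hh hd hc hj _ _ _ _ hpp hqq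
      · intro m hm n hn
        rw [G.hp n hn, map_smul, hpp m hm _ (by omega), smul_zero]
      · intro m hm n hn
        rw [G.hq n hn, map_smul, hqq m hm _ (by omega), smul_zero]
      · intro m hm n hn
        rw [G.hp m hm, G.hq n hn, map_smul, map_smul, LinearMap.smul_apply, hpq m hm n hn,
          hpq _ (by omega) n hn, hpq m hm _ (by omega), hTh m hm n hn]
      all_goals simp [G.hd, G.hc, G.hj, hh, hd]
    · apply G.lie_eq_zero_of_skew hskew hh hd hc hj _ _ _ _ hpp hqq
      · intro m hm n hn
        rw [G.dp n hn, map_smul, hpp m hm n hn, smul_zero]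
      · intro m hm n hn
        rw [G.dq n hn, map_smul, hqq m hm n hn, smul_zero]
      · intro m hm n hn
        rw [G.dp m hm, G.dq n hn, map_smul, map_smul, LinearMap.smul_apply, hpq m hm n hn,
          hTd m hm n hn, add_smul]
      all_goals simp [G.dh, G.dc, G.dj, hh, hc]
    · apply G.lie_eq_zero_of_skew hskew hh hd hc hj _ _ _ _ hpp hqq
      · intro m hm n hn
        rw [G.cp n hn, map_smul, sub_smul_succ_congr (hpp m hm) hn, smul_zero]
      · intro m hm n hn
        rw [G.cq n hn, map_smul, sub_smul_succ_congr (hqq m hm) hn, smul_zero]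
      · intro m hm n hn
        rw [G.cp m hm, G.cq n hn, map_smul, map_smul, LinearMap.smul_apply, hpq m hm n hn,
          sub_smul_succ_congr (fun m hm => hpq m hm n hn) hm, sub_smul_succ_congr (hpq m hm) hn,
          hTc m hm n hn]
      all_goals simp [G.ch, G.cd, G.cj, hd, hc]
    · apply G.lie_eq_zero_of_skew hskew hh hd hc hj _ _ _ _ hpp hqq
      · intro m hm n hn
        rw [G.jp, hpp m hm n hn]
      · intro m hm n hn
        rw [G.jq, map_neg, hqq m hm n hn, neg_zero]
      · intro m hm n hn
        rw [G.jp, G.jq, map_neg, add_neg_cancel, hpq m hm n hn, hTj m hm n hn]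
      all_goals simp [G.jh, G.jd, G.jc]
  refine ⟨Φ, G.mem_adCocycles_of_leviInvariant hI hskew hh hd hc hj hpp hqq ?_ ?_, hI, hj, hpq⟩
  · intro m hm n hn k hk
    rw [hpq n hn k hk, hpq m hm k hk, hppq m hm n hn k hk]
  · intro m hm n hn k hk
    rw [hpq m hm k hk, hpq m hm n hn, hpqq m hm n hn k hk]

theorem exists_extra_cocycle (G : DiagCGA N h d c j p q) (hN : N ≤ 2) :
    ∃ Φ ∈ adCocycles g, LeviInvariant h d c j Φ ∧ Φ j = 0 ∧
      Φ (p 0) (q N) = (N : ℂ) • d + (N + 2 : ℂ) • j := by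
  suffices ∃ T : ℕ → ℕ → g, (∀ m ≤ N, ∀ n ≤ N,
      ⁅h, T m n⁆ = (-(m : ℂ)) • T (m - 1) n + (-(n : ℂ)) • T m (n - 1)) ∧
      (∀ m ≤ N, ∀ n ≤ N, ⁅d, T m n⁆ = ((N : ℂ) - 2 * m + (N - 2 * n)) • T m n) ∧
      (∀ m ≤ N, ∀ n ≤ N,
        ⁅c, T m n⁆ = ((N : ℂ) - m) • T (m + 1) n + ((N : ℂ) - n) • T m (n + 1)) ∧
      (∀ m ≤ N, ∀ n ≤ N, ⁅j, T m n⁆ = 0) ∧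
      (∀ m ≤ N, ∀ n ≤ N, ∀ k ≤ N, ⁅p m, T n k⁆ = ⁅p n, T m k⁆) ∧
      (∀ m ≤ N, ∀ n ≤ N, ∀ k ≤ N, ⁅q n, T m k⁆ = ⁅q k, T m n⁆) ∧
      T 0 N = (N : ℂ) • d + (N + 2 : ℂ) • j by
    obtain ⟨T, hTh, hTd, hTc, hTj, hppq, hpqq, hT⟩ := this
    obtain ⟨Φ, hΦ, hI, hj, hpq⟩ := G.exists_leviInvariant_of_values hTh hTd hTc hTj hppq hpqq
    exact ⟨Φ, hΦ, hI, hj, by rw [hpq 0 N.zero_le N le_rfl, hT]⟩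
  interval_cases N
  · refine ⟨fun _ _ => (2 : ℂ) • j, ?_, ?_, ?_, ?_, ?_, ?_, ?_⟩ <;>
      simp [G.hj, G.dj, G.cj, G.pj, G.qj]
  · obtain ⟨T, h00, h01, h10, h11⟩ : ∃ T : ℕ → ℕ → g, T 0 0 = (2 : ℂ) • h ∧
        T 0 1 = d + (3 : ℂ) • j ∧ T 1 0 = d - (3 : ℂ) • j ∧ T 1 1 = (2 : ℂ) • c :=
      ⟨fun | 0, 0 => (2 : ℂ) • h | 0, _ => d + (3 : ℂ) • j | _, 0 => d - (3 : ℂ) • j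
           | _, _ => (2 : ℂ) • c, rfl, rfl, rfl, rfl⟩
    refine ⟨T, ?_, ?_, ?_, ?_, ?_, ?_, ?_⟩
    any_goals intro m hm n hn
    any_goals intro k hk
    any_goals interval_cases k
    any_goals interval_cases m
    any_goals interval_cases n
    all_goals
      simp [h00, h01, h10, h11, G.hd, G.hc, G.hj, G.dh, G.dc, G.dj, G.ch, G.cd, G.cj, G.jh, G.jd,
        G.jc, G.ph, G.pd, G.pc, G.pj, G.swap.ph, G.swap.pd, G.swap.pc, G.qj]
    all_goals module
  · obtain ⟨T, h00, h01, h02, h10, h11, h12, h20, h21, h22⟩ : ∃ T : ℕ → ℕ → g, T 0 0 = 0 ∧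
        T 0 1 = (2 : ℂ) • h ∧ T 0 2 = (2 : ℂ) • d + (4 : ℂ) • j ∧ T 1 0 = (-2 : ℂ) • h ∧
        T 1 1 = (-2 : ℂ) • j ∧ T 1 2 = (2 : ℂ) • c ∧ T 2 0 = (-2 : ℂ) • d + (4 : ℂ) • j ∧
        T 2 1 = (-2 : ℂ) • c ∧ T 2 2 = 0 :=
      ⟨fun | 0, 0 => 0 | 0, 1 => (2 : ℂ) • h | 0, _ => (2 : ℂ) • d + (4 : ℂ) • j
           | 1, 0 => (-2 : ℂ) • h | 1, 1 => (-2 : ℂ) • j | 1, _ => (2 : ℂ) • c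
           | _, 0 => (-2 : ℂ) • d + (4 : ℂ) • j | _, 1 => (-2 : ℂ) • c | _, _ => 0,
        rfl, rfl, rfl, rfl, rfl, rfl, rfl, rfl, rfl⟩
    refine ⟨T, ?_, ?_, ?_, ?_, ?_, ?_, ?_⟩
    any_goals intro m hm n hn
    any_goals intro k hk
    any_goals interval_cases k
    any_goals interval_cases m
    any_goals interval_cases n
    all_goals
      simp [h00, h01, h02, h10, h11, h12, h20, h21, h22, G.hd, G.hc, G.hj, G.dh, G.dc, G.dj, G.ch,
        G.cd, G.cj, G.jh, G.jd, G.jc, G.ph, G.pd, G.pc, G.pj, G.swap.ph, G.swap.pd, G.swap.pc,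
        G.qj]
    all_goals module

theorem h2Dim1 (G : DiagCGA N h d c j p q) (hN : 3 ≤ N) : H2Dim1 g := by
  obtain ⟨χ, hχ, hχj, hχh, hχd, hχc, hχp, hχq⟩ := G.exists_character
  refine ⟨fun a b => rotationCochain χ j a b, rotationCochain_mem_adCocycles hχ G.jj_apply,
    fun ω hω => ?_, fun φ hφ => ?_⟩
  · refine one_ne_zero (α := ℂ) (G.eq_zero_of_adCoboundary_apply (ω := ω) ?_ ?_)
    · rw [adCoboundary_apply, ← hω]
      simp [rotationCochain_apply, hχj, hχp, G.jp]
    · rw [adCoboundary_apply, ← hω]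
      simp [rotationCochain_apply, hχj, hχq, G.jq]
  · obtain ⟨Φ, hΦ, hΦφ⟩ := hφ.exists_mem_adCocycles
    obtain ⟨Ψ, hΨ, ⟨ω, rfl⟩, hI⟩ := G.exists_leviInvariant hΦ
    obtain ⟨s, ω', rfl⟩ := hI.exists_eq_smul_add_adCoboundary G hΨ
      (hI.p_zero_q_apply_eq_zero G hΨ hN) hχ hχj hχh hχd hχc hχp hχq
    refine ⟨s, ω' + ω, fun a b => ?_⟩
    rw [← hΦφ, ← adCoboundary_apply, map_add]
    simp only [LinearMap.add_apply, LinearMap.smul_apply]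
    abel

theorem h2Dim2 (G : DiagCGA N h d c j p q) (hN : N ≤ 2) : H2Dim2 g := by
  obtain ⟨χ, hχ, hχj, hχh, hχd, hχc, hχp, hχq⟩ := G.exists_character
  obtain ⟨Ξ, hΞ, hΞI, hΞj, hΞpq⟩ := G.exists_extra_cocycle hN
  refine ⟨fun a b => rotationCochain χ j a b, fun a b => Ξ a b,
    rotationCochain_mem_adCocycles hχ G.jj_apply, hΞ, ?_, fun φ hφ => ?_⟩
  · rintro s t ⟨ω, hω⟩
    refine ⟨G.eq_zero_of_adCoboundary_apply (ω := ω) ?_ ?_, ?_⟩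
    · rw [adCoboundary_apply, ← hω]
      simp [rotationCochain_apply, hχj, hχp, G.jp, hΞj]
    · rw [adCoboundary_apply, ← hω]
      simp [rotationCochain_apply, hχj, hχq, G.jq, hΞj]
    · have := congrArg χ (hω (p 0) (q N))
      have hN2 : (N + 2 : ℂ) ≠ 0 := by exact_mod_cast (Nat.succ_ne_zero (N + 1))
      simpa [rotationCochain_apply, cob, hχ, hχj, hχp, hχq, hχd, hΞpq, G.pq, hN2] using this
  · obtain ⟨Φ, hΦ, hΦφ⟩ := hφ.exists_mem_adCocycles
    obtain ⟨Ψ, hΨ, ⟨ω, rfl⟩, hI⟩ := G.exists_leviInvariant hΦ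
    obtain ⟨t, ht⟩ := hI.exists_p_zero_q_apply_eq_smul G hΨ hN
    obtain ⟨s, ω', hs⟩ := (hI.sub_smul hΞI t).exists_eq_smul_add_adCoboundary G
      (sub_mem hΨ (Submodule.smul_mem _ t hΞ)) (by simp [ht, hΞpq]) hχ hχj hχh hχd hχc hχp hχq
    refine ⟨s, t, ω' + ω, fun a b => ?_⟩
    rw [sub_eq_iff_eq_add] at hs
    rw [← hΦφ, ← adCoboundary_apply, map_add, hs]
    simp only [LinearMap.add_apply, LinearMap.smul_apply]
    abel

end DiagCGA

end

/-- For `g = cga_ℓ(2,ℂ)` (`N = 2ℓ`): `dim H²(g,g) = 2` if `ℓ ∈ {0, 1/2, 1}`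
(i.e. `N ≤ 2`), and `dim H²(g,g) = 1` otherwise (`N ≥ 3`). -/
theorem stmt15 (N : ℕ) {g : Type*} [LieRing g] [LieAlgebra ℂ g]
    (H D C : g) (M : Fin 2 → Fin 2 → g) (P : ℕ → Fin 2 → g)
    (hg : IsCGA 2 N H D C M P) :
    (N ≤ 2 → H2Dim2 g) ∧ (3 ≤ N → H2Dim1 g) := by
  exact ⟨hg.diagCGA.h2Dim2, hg.diagCGA.h2Dim1⟩
end
end

section
/- Let g = ĉga_ℓ(d,ℂ) be the mass central extension of the conformal Galilei algebra with d ≥ 3 and ℓ ∈ 1/2 + ℕ₀. Then H²(g,g) = 0. -/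
noncomputable section

/-- Structure constants of the mass central extension: `b_m = (-1)^{m+ℓ+1/2}(2ℓ-m)! m!`
with `2ℓ = N` odd, so `ℓ + 1/2 = (N+1)/2`. -/
def bcoef (N m : ℕ) : ℂ :=
  (-1 : ℂ) ^ (m + (N + 1) / 2) * (N - m).factorial * m.factorial

/-- `IsCGAHat d N H D C M P Mc`: presentation of the mass central extension
`ĉga_ℓ(d,ℂ)` with `2ℓ = N`, central element `Mc`. -/
structure IsCGAHat (d N : ℕ) {g : Type*} [LieRing g] [LieAlgebra ℂ g]
    (H D C : g) (M : Fin d → Fin d → g) (P : ℕ → Fin d → g) (Mc : g) : Prop where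
  skewM : ∀ i j, M j i = - M i j
  bMM : ∀ i j k r, ⁅M i j, M k r⁆ =
      (-(kron i k)) • M j r - (kron j r) • M i k + (kron i r) • M j k + (kron j k) • M i r
  bDH : ⁅D, H⁆ = (2 : ℂ) • H
  bCH : ⁅C, H⁆ = D
  bDC : ⁅D, C⁆ = (-2 : ℂ) • C
  bHM : ∀ i j, ⁅H, M i j⁆ = 0
  bDM : ∀ i j, ⁅D, M i j⁆ = 0
  bCM : ∀ i j, ⁅C, M i j⁆ = 0
  bMP : ∀ i j k, ∀ n : ℕ, ⁅M i j, P n k⁆ = (-(kron i k)) • P n j + (kron j k) • P n i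
  bHP : ∀ n ≤ N, ∀ i, ⁅H, P n i⁆ = (-(n : ℂ)) • P (n - 1) i
  bDP : ∀ n ≤ N, ∀ i, ⁅D, P n i⁆ = ((N : ℂ) - 2 * n) • P n i
  bCP : ∀ n ≤ N, ∀ i, ⁅C, P n i⁆ = ((N : ℂ) - n) • P (n + 1) i
  bPP : ∀ m n : ℕ, ∀ i j, ⁅P m i, P n j⁆ =
      (kron i j * (if m + n = N then bcoef N m else 0)) • Mc
  central : ∀ x : g, ⁅x, Mc⁆ = 0
  Pbound : ∀ n : ℕ, N < n → ∀ i, P n i = 0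
  spans : Submodule.span ℂ
      (({H, D, C, Mc} : Set g) ∪ {x | ∃ i j, x = M i j} ∪ {x | ∃ n i, x = P n i}) = ⊤
  dim : Module.finrank ℂ g = d * (d - 1) / 2 + (N + 1) * d + 4

section Reduction

open ComplexConjugate

variable {g : Type*} [LieRing g] [LieAlgebra ℂ g]

/-- The action of `s` on a `2`-cochain with values in the adjoint module. -/
def lieDer (s : g) (φ : g → g → g) (a b : g) : g :=
  ⁅s, φ a b⁆ - φ ⁅s, a⁆ b - φ a ⁅s, b⁆

namespace IsAdCocycle2

variable {φ ψ : g → g → g}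

/-- A cocycle as a bilinear map. -/
def bilin (h : IsAdCocycle2 φ) : g →ₗ[ℂ] g →ₗ[ℂ] g :=
  LinearMap.mk₂ ℂ φ h.addl h.smull
    (fun a b c => by rw [h.skew (b + c), h.addl, h.skew b a, h.skew c a]; abel)
    (fun t a b => by rw [h.skew (t • b), h.smull, h.skew b a]; simp)

@[simp] lemma bilin_apply (h : IsAdCocycle2 φ) (a b : g) : h.bilin a b = φ a b := rfl

lemma self_eq_zero (h : IsAdCocycle2 φ) (a : g) : φ a a = 0 := by
  have h2 : (2 : ℂ) • φ a a = 0 := by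
    rw [two_smul]
    nth_rewrite 1 [h.skew a a]
    exact neg_add_cancel _
  exact (smul_eq_zero.1 h2).resolve_left two_ne_zero

lemma cob_isAdCocycle2 (ω : g →ₗ[ℂ] g) : IsAdCocycle2 (cob ω) where
  addl a b c := by simp [cob]; abel
  smull t a b := by simp [cob, smul_sub]
  skew a b := by
    simp only [cob]
    rw [← lie_skew b a, map_neg]; abel
  cocycle a b c := by
    simp only [cob, lie_sub]
    simp only [leibniz_lie a b (ω c), leibniz_lie a c (ω b), leibniz_lie b c (ω a)]
    have h1 : ω ⁅a, ⁅b, c⁆⁆ = ω ⁅⁅a, b⁆, c⁆ + ω ⁅b, ⁅a, c⁆⁆ := by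
      rw [← map_add, ← leibniz_lie]
    have h2 : ω ⁅⁅a, c⁆, b⁆ = - ω ⁅b, ⁅a, c⁆⁆ := by rw [← map_neg, lie_skew]
    have h3 : ω ⁅⁅b, c⁆, a⁆ = - ω ⁅a, ⁅b, c⁆⁆ := by rw [← map_neg, lie_skew]
    rw [h2, h3, h1]
    abel

lemma sub (h : IsAdCocycle2 φ) (h' : IsAdCocycle2 ψ) :
    IsAdCocycle2 (fun a b => φ a b - ψ a b) where
  addl a b c := by simp only [h.addl, h'.addl]; abel
  smull t a b := by simp only [h.smull, h'.smull, smul_sub]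
  skew a b := by rw [h.skew a b, h'.skew a b]; abel
  cocycle a b c := by
    have := congrArg₂ (· - ·) (h.cocycle a b c) (h'.cocycle a b c)
    simp only [sub_zero] at this
    rw [← this]
    simp only [lie_sub]
    abel

/-- Cartan's homotopy formula for a cocycle. -/
lemma lieDer_eq_cob (h : IsAdCocycle2 φ) (s a b : g) :
    lieDer s φ a b = cob (h.bilin s) a b := by
  have := h.cocycle s a b
  simp only [lieDer, cob, bilin_apply]
  rw [h.skew a ⁅s, b⁆, h.skew s ⁅a, b⁆] at this
  rw [← sub_eq_zero, ← this]
  abel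

end IsAdCocycle2

variable {ι : Type*} [Fintype ι]

/-- Rescaled structure constants of a `2`-cochain. -/
def cochainCoord (e : Module.Basis ι ℂ g) (w : ι → ℝ) (φ : g → g → g) :
    EuclideanSpace ℂ (ι × ι × ι) :=
  WithLp.toLp 2 fun p =>
    (Real.sqrt (w p.2.2 / (w p.1 * w p.2.1)) : ℂ) * e.repr (φ (e p.1) (e p.2.1)) p.2.2

/-- The coordinate vectors of coboundaries, as a linear map. -/
def cobCoord (e : Module.Basis ι ℂ g) (w : ι → ℝ) :
    (g →ₗ[ℂ] g) →ₗ[ℂ] EuclideanSpace ℂ (ι × ι × ι) where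
  toFun ω := cochainCoord e w (cob ω)
  map_add' ω ω' := by
    ext p
    simp [cochainCoord, cob]
    ring
  map_smul' t ω := by
    ext p
    simp [cochainCoord, cob]
    ring

lemma inner_cochainCoord (e : Module.Basis ι ℂ g) (w : ι → ℝ) (hw : ∀ i, 0 < w i)
    (φ ψ : g → g → g) :
    inner ℂ (cochainCoord e w φ) (cochainCoord e w ψ) = ∑ i, ∑ j, ∑ k,
      ((w k / (w i * w j) : ℝ) : ℂ) * (conj (e.repr (φ (e i) (e j)) k)
        * e.repr (ψ (e i) (e j)) k) := by
  simp only [cochainCoord, PiLp.inner_apply, Fintype.sum_prod_type]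
  refine Finset.sum_congr rfl fun i _ => Finset.sum_congr rfl fun j _ =>
    Finset.sum_congr rfl fun k _ => ?_
  have h : 0 ≤ w k / (w i * w j) := (div_pos (hw k) (mul_pos (hw i) (hw j))).le
  have h2 : ((w k / (w i * w j) : ℝ) : ℂ) = (Real.sqrt (w k / (w i * w j)) : ℂ)
      * (Real.sqrt (w k / (w i * w j)) : ℂ) := by
    rw [← Complex.ofReal_mul, Real.mul_self_sqrt h]
  rw [h2]
  simp [-Complex.ofReal_div]
  ring

lemma cochain_repr_lieDer (e : Module.Basis ι ℂ g) (s : g) (φ : g →ₗ[ℂ] g →ₗ[ℂ] g) (i j k : ι) :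
    e.repr (lieDer s (fun a b => φ a b) (e i) (e j)) k =
      ∑ l, (e.repr ⁅s, e l⁆ k * e.repr (φ (e i) (e j)) l
        - e.repr ⁅s, e i⁆ l * e.repr (φ (e l) (e j)) k
        - e.repr ⁅s, e j⁆ l * e.repr (φ (e i) (e l)) k) := by
  have h1 : ⁅s, φ (e i) (e j)⁆ = ∑ l, e.repr (φ (e i) (e j)) l • ⁅s, e l⁆ := by
    conv_lhs => rw [← e.sum_repr (φ (e i) (e j))]
    rw [lie_sum]
    simp
  have h2 : φ ⁅s, e i⁆ (e j) = ∑ l, e.repr ⁅s, e i⁆ l • φ (e l) (e j) := by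
    conv_lhs => rw [← e.sum_repr ⁅s, e i⁆, map_sum, LinearMap.sum_apply]
    simp only [map_smul, LinearMap.smul_apply]
  have h3 : φ (e i) ⁅s, e j⁆ = ∑ l, e.repr ⁅s, e j⁆ l • φ (e i) (e l) := by
    conv_lhs => rw [← e.sum_repr ⁅s, e j⁆, map_sum]
    simp only [map_smul]
  simp only [lieDer, h1, h2, h3, map_sub, map_sum, map_smul, Finsupp.coe_sub, Pi.sub_apply,
    Finsupp.coe_finsetSum, Finset.sum_apply, Finsupp.coe_smul, Pi.smul_apply, smul_eq_mul,
    Finset.sum_sub_distrib]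
  congr 2
  exact Finset.sum_congr rfl fun _ _ => mul_comm _ _

lemma inner_lieDer (e : Module.Basis ι ℂ g) (w : ι → ℝ) (hw : ∀ i, 0 < w i)
    {s s' : g} (hs : ∀ i j, (w j : ℂ) * conj (e.repr ⁅s, e i⁆ j) = w i * e.repr ⁅s', e j⁆ i)
    (φ ψ : g →ₗ[ℂ] g →ₗ[ℂ] g) :
    inner ℂ (cochainCoord e w (lieDer s fun a b => φ a b)) (cochainCoord e w fun a b => ψ a b) =
    inner ℂ (cochainCoord e w fun a b => φ a b) (cochainCoord e w (lieDer s' fun a b => ψ a b)) := by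
  have hw' : ∀ i, (w i : ℂ) ≠ 0 := fun i => by exact_mod_cast (hw i).ne'
  rw [inner_cochainCoord e w hw, inner_cochainCoord e w hw]
  simp only [cochain_repr_lieDer, map_sum, map_sub, map_mul, Finset.sum_mul, Finset.mul_sum,
    sub_mul, mul_sub, Finset.sum_sub_distrib]
  congr 1
  · congr 1
    · refine Finset.sum_congr rfl fun i _ => Finset.sum_congr rfl fun j _ => ?_
      rw [Finset.sum_comm]
      refine Finset.sum_congr rfl fun l _ => Finset.sum_congr rfl fun k _ => ?_
      have := hs l k
      push_cast
      have h : conj (e.repr ⁅s, e l⁆ k) = w l * e.repr ⁅s', e k⁆ l / w k := by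
        rw [eq_div_iff (hw' k), ← this]; ring
      rw [h]
      field_simp [hw' i, hw' j, hw' k, hw' l]
    · have h4 : ∀ F : ι → ι → ι → ι → ℂ, ∑ i, ∑ j, ∑ k, ∑ l, F i j k l
          = ∑ l, ∑ j, ∑ k, ∑ i, F i j k l := fun F => by
        rw [Finset.sum_comm]
        conv_rhs => rw [Finset.sum_comm]
        refine Finset.sum_congr rfl fun j _ => ?_
        rw [Finset.sum_comm]
        conv_rhs => rw [Finset.sum_comm]
        refine Finset.sum_congr rfl fun k _ => ?_
        rw [Finset.sum_comm]
      rw [h4]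
      refine Finset.sum_congr rfl fun l _ => Finset.sum_congr rfl fun j _ =>
        Finset.sum_congr rfl fun k _ => Finset.sum_congr rfl fun i _ => ?_
      have h : conj (e.repr ⁅s, e i⁆ l) = w i * e.repr ⁅s', e l⁆ i / w l := by
        rw [eq_div_iff (hw' l), ← hs i l]; ring
      rw [h]
      push_cast
      field_simp [hw' i, hw' j, hw' k, hw' l]
  · refine Finset.sum_congr rfl fun i _ => ?_
    have h4 : ∀ F : ι → ι → ι → ℂ, ∑ j, ∑ k, ∑ l, F j k l
          = ∑ l, ∑ k, ∑ j, F j k l := fun F => by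
      rw [Finset.sum_comm]
      conv_rhs => rw [Finset.sum_comm]
      refine Finset.sum_congr rfl fun k _ => ?_
      rw [Finset.sum_comm]
    rw [h4]
    refine Finset.sum_congr rfl fun l _ => ?_
    refine Finset.sum_congr rfl fun k _ => Finset.sum_congr rfl fun j _ => ?_
    have h : conj (e.repr ⁅s, e j⁆ l) = w j * e.repr ⁅s', e l⁆ j / w l := by
      rw [eq_div_iff (hw' l), ← hs j l]; ring
    rw [h]
    push_cast
    field_simp [hw' i, hw' j, hw' k, hw' l]

/-- If `ad s` has an adjoint of the form `ad s'` for the hermitian form with orthogonal basis `e`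
and square norms `w`, then every cocycle is cohomologous to an `s`-invariant one. -/
lemma IsAdCocycle2.exists_lieDer_sub_cob_eq_zero {φ : g → g → g} (hφ : IsAdCocycle2 φ)
    (e : Module.Basis ι ℂ g) (w : ι → ℝ) (hw : ∀ i, 0 < w i) :
    ∃ ω : g →ₗ[ℂ] g, ∀ s s' : g,
      (∀ i j, (w j : ℂ) * conj (e.repr ⁅s, e i⁆ j) = w i * e.repr ⁅s', e j⁆ i) →
      ∀ a b, lieDer s (fun a b => φ a b - cob ω a b) a b = 0 := by
  obtain ⟨y, ⟨ω, rfl⟩, z, hz, hyz⟩ :=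
    (LinearMap.range (cobCoord e w)).exists_add_mem_mem_orthogonal (cochainCoord e w φ)
  refine ⟨ω, fun s s' hs => ?_⟩
  have hc := hφ.sub (cob_isAdCocycle2 ω)
  set χ := fun a b => φ a b - cob ω a b with hχ
  have hz' : z = cochainCoord e w χ := by
    rw [← sub_eq_iff_eq_add'] at hyz
    rw [← hyz]
    ext p
    simp [cochainCoord, cobCoord, hχ]
    ring
  have h1 : lieDer s χ = cob (hc.bilin s) := by
    funext a b; exact hc.lieDer_eq_cob s a b
  have hcc : IsAdCocycle2 (lieDer s χ) := h1 ▸ cob_isAdCocycle2 _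
  have h2 : lieDer s' (lieDer s χ) = cob (hcc.bilin s') := by
    funext a b; exact hcc.lieDer_eq_cob s' a b
  have h0 : inner ℂ (cochainCoord e w (lieDer s χ)) (cochainCoord e w (lieDer s χ)) = 0 := by
    have := inner_lieDer e w hw hs hc.bilin hcc.bilin
    simp only [bilin_apply] at this
    rw [this]
    rw [← hz']
    have h3 : cochainCoord e w (lieDer s' (lieDer s χ)) ∈ LinearMap.range (cobCoord e w) := by
      rw [h2]; exact ⟨_, rfl⟩
    exact (Submodule.mem_orthogonal' _ _).1 hz _ h3
  rw [inner_self_eq_zero] at h0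
  have h5 : hcc.bilin = 0 := by
    refine e.ext fun i => e.ext fun j => e.ext_elem fun k => ?_
    have := congrArg (fun v : EuclideanSpace ℂ (ι × ι × ι) => v (i, j, k)) h0
    simp only [cochainCoord, PiLp.zero_apply, mul_eq_zero, Complex.ofReal_eq_zero] at this
    rcases this with h | h
    · exact absurd h (Real.sqrt_pos.2 (div_pos (hw k) (mul_pos (hw i) (hw j)))).ne'
    · simpa using h
  intro a b
  have := LinearMap.congr_fun₂ h5 a b
  simpa using this

end Reduction


section Coordinates

variable {d N : ℕ} {g : Type*} [LieRing g] [LieAlgebra ℂ g]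
  {H D C : g} {M : Fin d → Fin d → g} {P : ℕ → Fin d → g} {Mc : g}

lemma kron_comm (i j : Fin d) : kron i j = kron j i := by
  simp only [kron, eq_comm]

@[simp] lemma kron_self (i : Fin d) : kron i i = 1 := by simp [kron]

lemma kron_of_ne {i j : Fin d} (h : i ≠ j) : kron i j = 0 := by simp [kron, h]

lemma conj_kron (i j : Fin d) : (starRingEnd ℂ) (kron i j) = kron i j := by
  simp only [kron]; split_ifs <;> simp

/-- The index type of the standard basis of the centrally extended algebra. -/
abbrev CGAIndex (d N : ℕ) : Type :=
  Fin 4 ⊕ {p : Fin d × Fin d // p.1 < p.2} ⊕ (Fin (N + 1) × Fin d)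

lemma card_lt_pairs (d : ℕ) :
    Fintype.card {p : Fin d × Fin d // p.1 < p.2} = d * (d - 1) / 2 := by
  have e : {p : Fin d × Fin d // p.1 < p.2} ≃ (j : Fin d) × Fin j.1 :=
    { toFun := fun p => ⟨p.1.2, ⟨p.1.1, p.2⟩⟩
      invFun := fun q => ⟨(⟨q.2.1, q.2.2.trans q.1.2⟩, q.1), q.2.2⟩
      left_inv := fun _ => rfl
      right_inv := fun _ => rfl }
  rw [Fintype.card_congr e, Fintype.card_sigma]
  simp only [Fintype.card_fin]
  rw [Fin.sum_univ_eq_sum_range (fun i => i) d, Finset.sum_range_id]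

lemma card_CGAIndex (d N : ℕ) :
    Fintype.card (CGAIndex d N) = d * (d - 1) / 2 + (N + 1) * d + 4 := by
  simp only [CGAIndex, Fintype.card_sum, Fintype.card_fin, card_lt_pairs, Fintype.card_prod]
  omega

namespace IsCGAHat

lemma M_self (hg : IsCGAHat d N H D C M P Mc) (i : Fin d) : M i i = 0 := by
  have h2 : (2 : ℂ) • M i i = 0 := by
    rw [two_smul]
    nth_rewrite 1 [hg.skewM i i]
    exact neg_add_cancel _
  exact (smul_eq_zero.1 h2).resolve_left two_ne_zero

lemma induct (hg : IsCGAHat d N H D C M P Mc) {p : g → Prop}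
    (add : ∀ x y, p x → p y → p (x + y)) (smul : ∀ (t : ℂ) x, p x → p (t • x))
    (hH : p H) (hD : p D) (hC : p C) (hMc : p Mc) (hM : ∀ i j, p (M i j))
    (hP : ∀ n ≤ N, ∀ i, p (P n i)) (x : g) : p x := by
  have h0 : p 0 := by simpa using smul 0 H hH
  have hx : x ∈ Submodule.span ℂ
      (({H, D, C, Mc} : Set g) ∪ {x | ∃ i j, x = M i j} ∪ {x | ∃ n i, x = P n i}) := by
    rw [hg.spans]; trivial
  induction hx using Submodule.span_induction with
  | mem x h =>
    rcases h with (h | ⟨i, j, rfl⟩) | ⟨n, i, rfl⟩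
    · rcases h with rfl | rfl | rfl | rfl <;> assumption
    · exact hM i j
    · by_cases hn : n ≤ N
      · exact hP n hn i
      · rw [hg.Pbound n (not_le.1 hn) i]; exact h0
  | zero => exact h0
  | add x y _ _ hx hy => exact add x y hx hy
  | smul t x _ hx => exact smul t x hx

/-- The standard generating family. -/
def family (_ : IsCGAHat d N H D C M P Mc) : CGAIndex d N → g :=
  Sum.elim ![H, D, C, Mc] (Sum.elim (fun p => M p.1.1 p.1.2) (fun q => P q.1 q.2))

lemma span_family (hg : IsCGAHat d N H D C M P Mc) :
    ⊤ ≤ Submodule.span ℂ (Set.range hg.family) := by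
  intro x _
  have key : ∀ i, hg.family i ∈ Submodule.span ℂ (Set.range hg.family) :=
    fun i => Submodule.subset_span ⟨i, rfl⟩
  refine hg.induct (p := fun x => x ∈ Submodule.span ℂ (Set.range hg.family))
    (fun _ _ => Submodule.add_mem _) (fun t _ => Submodule.smul_mem _ t)
    (key (.inl 0)) (key (.inl 1)) (key (.inl 2)) (key (.inl 3)) (fun i j => ?_)
    (fun n hn i => key (.inr (.inr (⟨n, by omega⟩, i)))) x
  rcases lt_trichotomy i j with h | rfl | h
  · exact key (.inr (.inl ⟨(i, j), h⟩))
  · rw [hg.M_self]; exact Submodule.zero_mem _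
  · rw [hg.skewM j i]; exact Submodule.neg_mem _ (key (.inr (.inl ⟨(j, i), h⟩)))

/-- The standard basis. -/
def basis (hg : IsCGAHat d N H D C M P Mc) : Module.Basis (CGAIndex d N) ℂ g :=
  basisOfTopLeSpanOfCardEqFinrank hg.family hg.span_family (by rw [card_CGAIndex, hg.dim])

lemma basis_apply (hg : IsCGAHat d N H D C M P Mc) (i : CGAIndex d N) :
    hg.basis i = hg.family i := by
  simp [basis]

lemma exists_linearMap (hg : IsCGAHat d N H D C M P Mc) {W : Type*} [AddCommGroup W] [Module ℂ W]
    (h h' h'' z : W) (m : Fin d → Fin d → W) (p : ℕ → Fin d → W) (hm : ∀ i j, m j i = - m i j)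
    (hp : ∀ n, N < n → ∀ i, p n i = 0) :
    ∃ F : g →ₗ[ℂ] W, F H = h ∧ F D = h' ∧ F C = h'' ∧ F Mc = z ∧ (∀ i j, F (M i j) = m i j) ∧
      ∀ n i, F (P n i) = p n i := by
  set F := hg.basis.constr ℂ (Sum.elim ![h, h', h'', z]
    (Sum.elim (fun p => m p.1.1 p.1.2) (fun q => p q.1 q.2))) with hF
  have key : ∀ i, F (hg.family i) = (Sum.elim ![h, h', h'', z]
    (Sum.elim (fun p => m p.1.1 p.1.2) (fun q => p q.1 q.2)) : CGAIndex d N → W) i := fun i => by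
    rw [← hg.basis_apply, hF, Module.Basis.constr_basis]
  refine ⟨F, key (.inl 0), key (.inl 1), key (.inl 2), key (.inl 3), fun i j => ?_, fun n i => ?_⟩
  · rcases lt_trichotomy i j with h | rfl | h
    · exact key (.inr (.inl ⟨(i, j), h⟩))
    · have h2 : (2 : ℂ) • m i i = 0 := by
        rw [two_smul]
        nth_rewrite 1 [hm i i]
        exact neg_add_cancel _
      rw [hg.M_self, map_zero, (smul_eq_zero.1 h2).resolve_left two_ne_zero]
    · rw [hg.skewM j i, map_neg, hm j i]
      exact congrArg _ (key (.inr (.inl ⟨(j, i), h⟩)))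
  · by_cases hn : n ≤ N
    · exact key (.inr (.inr (⟨n, by omega⟩, i)))
    · rw [hg.Pbound n (not_le.1 hn), hp n (not_le.1 hn), map_zero]

end IsCGAHat

/-- Coordinate functions on the centrally extended algebra: the coefficients of `H`, `D`, `C` and
of the central element, the `so(d)`-part as a skew matrix, and the coefficients of the `P n i`. -/
structure CGACoords (d N : ℕ) {g : Type*} [LieRing g] [LieAlgebra ℂ g]
    (H D C : g) (M : Fin d → Fin d → g) (P : ℕ → Fin d → g) (Mc : g) where
  cH : g →ₗ[ℂ] ℂ
  cD : g →ₗ[ℂ] ℂ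
  cC : g →ₗ[ℂ] ℂ
  cZ : g →ₗ[ℂ] ℂ
  so : g →ₗ[ℂ] (Fin d → Fin d → ℂ)
  rad : g →ₗ[ℂ] (ℕ → Fin d → ℂ)
  onH : cH H = 1 ∧ cD H = 0 ∧ cC H = 0 ∧ cZ H = 0 ∧ so H = 0 ∧ rad H = 0
  onD : cH D = 0 ∧ cD D = 1 ∧ cC D = 0 ∧ cZ D = 0 ∧ so D = 0 ∧ rad D = 0
  onC : cH C = 0 ∧ cD C = 0 ∧ cC C = 1 ∧ cZ C = 0 ∧ so C = 0 ∧ rad C = 0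
  onZ : cH Mc = 0 ∧ cD Mc = 0 ∧ cC Mc = 0 ∧ cZ Mc = 1 ∧ so Mc = 0 ∧ rad Mc = 0
  onM : ∀ i j, cH (M i j) = 0 ∧ cD (M i j) = 0 ∧ cC (M i j) = 0 ∧ cZ (M i j) = 0 ∧
    (so (M i j) = fun a b => kron i a * kron j b - kron j a * kron i b) ∧ rad (M i j) = 0
  onP : ∀ n i, cH (P n i) = 0 ∧ cD (P n i) = 0 ∧ cC (P n i) = 0 ∧ cZ (P n i) = 0 ∧
    so (P n i) = 0 ∧ rad (P n i) = fun m a => if n ≤ N ∧ m = n then kron i a else 0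

lemma IsCGAHat.nonempty_coords (hg : IsCGAHat d N H D C M P Mc) :
    Nonempty (CGACoords d N H D C M P Mc) := by
  obtain ⟨cH, h1⟩ := hg.exists_linearMap (1 : ℂ) 0 0 0 0 0 (by simp) (by simp)
  obtain ⟨cD, h2⟩ := hg.exists_linearMap (0 : ℂ) 1 0 0 0 0 (by simp) (by simp)
  obtain ⟨cC, h3⟩ := hg.exists_linearMap (0 : ℂ) 0 1 0 0 0 (by simp) (by simp)
  obtain ⟨cZ, h4⟩ := hg.exists_linearMap (0 : ℂ) 0 0 1 0 0 (by simp) (by simp)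
  obtain ⟨so, h5⟩ := hg.exists_linearMap (0 : Fin d → Fin d → ℂ) 0 0 0
    (fun i j a b => kron i a * kron j b - kron j a * kron i b) 0
    (fun i j => by funext a b; simp) (by simp)
  obtain ⟨rad, h6⟩ := hg.exists_linearMap (0 : ℕ → Fin d → ℂ) 0 0 0 0
    (fun n i m a => if n ≤ N ∧ m = n then kron i a else 0) (by simp)
    (fun n hn i => by funext m a; simp [not_le.2 hn])
  obtain ⟨a1, b1, c1, d1, e1, f1⟩ := h1
  obtain ⟨a2, b2, c2, d2, e2, f2⟩ := h2
  obtain ⟨a3, b3, c3, d3, e3, f3⟩ := h3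
  obtain ⟨a4, b4, c4, d4, e4, f4⟩ := h4
  obtain ⟨a5, b5, c5, d5, e5, f5⟩ := h5
  obtain ⟨a6, b6, c6, d6, e6, f6⟩ := h6
  exact ⟨⟨cH, cD, cC, cZ, so, rad, ⟨a1, a2, a3, a4, a5, a6⟩, ⟨b1, b2, b3, b4, b5, b6⟩,
    ⟨c1, c2, c3, c4, c5, c6⟩, ⟨d1, d2, d3, d4, d5, d6⟩,
    fun i j => ⟨e1 i j, e2 i j, e3 i j, e4 i j, e5 i j, e6 i j⟩,
    fun i j => ⟨f1 i j, f2 i j, f3 i j, f4 i j, f5 i j, f6 i j⟩⟩⟩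

namespace CGACoords

lemma so_skew (κ : CGACoords d N H D C M P Mc) (hg : IsCGAHat d N H D C M P Mc) (x : g)
    (a b : Fin d) : κ.so x b a = - κ.so x a b := by
  revert x
  refine hg.induct (fun x y hx hy => ?_) (fun t x hx => ?_) ?_ ?_ ?_ ?_ (fun i j => ?_)
    (fun n _ i => ?_)
  · simp only [map_add, Pi.add_apply, hx, hy]; ring
  · simp only [map_smul, Pi.smul_apply, hx, smul_neg]
  all_goals simp [κ.onH, κ.onD, κ.onC, κ.onZ, κ.onM, κ.onP]
  ring

lemma expand (κ : CGACoords d N H D C M P Mc) (hg : IsCGAHat d N H D C M P Mc) (x : g) :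
    x = κ.cH x • H + κ.cD x • D + κ.cC x • C + κ.cZ x • Mc
      + (1 / 2 : ℂ) • ∑ i, ∑ j, κ.so x i j • M i j
      + ∑ n ∈ Finset.range (N + 1), ∑ i, κ.rad x n i • P n i := by
  revert x
  refine hg.induct (fun x y hx hy => ?_) (fun t x hx => ?_) ?_ ?_ ?_ ?_ (fun i j => ?_)
    (fun n hn i => ?_)
  · conv_lhs => rw [hx, hy]
    simp only [map_add, Pi.add_apply, add_smul, Finset.sum_add_distrib, smul_add]
    abel
  · conv_lhs => rw [hx]
    simp only [map_smul, Pi.smul_apply, smul_eq_mul, mul_smul, Finset.smul_sum, smul_add,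
      smul_comm t (1 / 2 : ℂ)]
  all_goals simp [κ.onH, κ.onD, κ.onC, κ.onZ, κ.onM, κ.onP]
  · simp only [sub_smul, Finset.sum_sub_distrib, kron, mul_ite, mul_one, mul_zero, ite_smul,
      one_smul, zero_smul]
    simp only [← ite_and]
    simp [ite_and, hg.skewM i j]
    rw [← two_smul ℂ, smul_smul]; norm_num
  · simp only [hn, true_and]
    simp [kron, Finset.sum_ite_eq, Nat.lt_succ_of_le hn]

lemma ext_zero (κ : CGACoords d N H D C M P Mc) (hg : IsCGAHat d N H D C M P Mc) {x : g}
    (h1 : κ.cH x = 0) (h2 : κ.cD x = 0) (h3 : κ.cC x = 0) (h4 : κ.cZ x = 0)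
    (h5 : ∀ i j, κ.so x i j = 0) (h6 : ∀ n i, κ.rad x n i = 0) : x = 0 := by
  rw [κ.expand hg x]
  simp [h1, h2, h3, h4, h5, h6]

lemma lie_H (κ : CGACoords d N H D C M P Mc) (hg : IsCGAHat d N H D C M P Mc) (x : g) :
    κ.cH ⁅H, x⁆ = -2 * κ.cD x ∧ κ.cD ⁅H, x⁆ = - κ.cC x ∧ κ.cC ⁅H, x⁆ = 0 ∧ κ.cZ ⁅H, x⁆ = 0 ∧
    κ.so ⁅H, x⁆ = 0 ∧ ∀ n i, κ.rad ⁅H, x⁆ n i = -(n + 1 : ℂ) * κ.rad x (n + 1) i := by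
  have hHD : ⁅H, D⁆ = (-2 : ℂ) • H := by rw [← lie_skew, hg.bDH, neg_smul]
  have hHC : ⁅H, C⁆ = - D := by rw [← lie_skew, hg.bCH]
  revert x
  refine hg.induct (fun x y hx hy => ?_) (fun t x hx => ?_) ?_ ?_ ?_ ?_ (fun i j => ?_)
    (fun n hn i => ?_)
  · simp only [lie_add, map_add, hx, hy, Pi.add_apply]
    refine ⟨by ring, by ring, by ring, by ring, by simp, fun n i => by ring⟩
  · simp only [lie_smul, map_smul, hx, Pi.smul_apply, smul_eq_mul]
    refine ⟨by ring, by ring, by ring, by ring, by simp, fun n i => by ring⟩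
  · simp [κ.onH]
  · simp [hHD, κ.onH, κ.onD]
  · simp [hHC, κ.onD, κ.onC]
  · simp [hg.central, κ.onZ]
  · simp [hg.bHM, κ.onM]
  · simp only [hg.bHP n hn, map_smul, κ.onP, smul_zero, mul_zero, neg_zero, true_and,
      Pi.smul_apply, smul_eq_mul]
    intro m a
    rcases n with _ | n
    · simp
    · by_cases h : m = n
      · subst h
        simp [hn, (Nat.le_succ m).trans hn]
      · simp [h]

lemma lie_D (κ : CGACoords d N H D C M P Mc) (hg : IsCGAHat d N H D C M P Mc) (x : g) :
    κ.cH ⁅D, x⁆ = 2 * κ.cH x ∧ κ.cD ⁅D, x⁆ = 0 ∧ κ.cC ⁅D, x⁆ = -2 * κ.cC x ∧ κ.cZ ⁅D, x⁆ = 0 ∧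
    κ.so ⁅D, x⁆ = 0 ∧ ∀ n i, κ.rad ⁅D, x⁆ n i = (N - 2 * n : ℂ) * κ.rad x n i := by
  revert x
  refine hg.induct (fun x y hx hy => ?_) (fun t x hx => ?_) ?_ ?_ ?_ ?_ (fun i j => ?_)
    (fun n hn i => ?_)
  · simp only [lie_add, map_add, hx, hy, Pi.add_apply]
    refine ⟨by ring, by ring, by ring, by ring, by simp, fun n i => by ring⟩
  · simp only [lie_smul, map_smul, hx, Pi.smul_apply, smul_eq_mul]
    refine ⟨by ring, by ring, by ring, by ring, by simp, fun n i => by ring⟩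
  · simp [hg.bDH, κ.onH]
  · simp [κ.onD]
  · simp [hg.bDC, κ.onC]
  · simp [hg.central, κ.onZ]
  · simp [hg.bDM, κ.onM]
  · simp only [hg.bDP n hn, map_smul, κ.onP, smul_zero, mul_zero, true_and,
      Pi.smul_apply, smul_eq_mul]
    intro m a
    by_cases h : m = n
    · subst h; rfl
    · simp [h]

lemma lie_C (κ : CGACoords d N H D C M P Mc) (hg : IsCGAHat d N H D C M P Mc) (x : g) :
    κ.cH ⁅C, x⁆ = 0 ∧ κ.cD ⁅C, x⁆ = κ.cH x ∧ κ.cC ⁅C, x⁆ = 2 * κ.cD x ∧ κ.cZ ⁅C, x⁆ = 0 ∧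
    κ.so ⁅C, x⁆ = 0 ∧ ∀ n i, κ.rad ⁅C, x⁆ n i =
      if 1 ≤ n ∧ n ≤ N then (N - n + 1 : ℂ) * κ.rad x (n - 1) i else 0 := by
  have hCD : ⁅C, D⁆ = (2 : ℂ) • C := by rw [← lie_skew, hg.bDC, neg_smul, neg_neg]
  revert x
  refine hg.induct (fun x y hx hy => ?_) (fun t x hx => ?_) ?_ ?_ ?_ ?_ (fun i j => ?_)
    (fun n hn i => ?_)
  · simp only [lie_add, map_add, hx, hy, Pi.add_apply]
    refine ⟨by ring, trivial, by ring, by ring, by simp, fun n i => by split_ifs <;> ring⟩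
  · simp only [lie_smul, map_smul, hx, Pi.smul_apply, smul_eq_mul]
    refine ⟨by ring, trivial, by ring, by ring, by simp, fun n i => by split_ifs <;> ring⟩
  · simp [hg.bCH, κ.onH, κ.onD]
  · simp [hCD, κ.onC, κ.onD]
  · simp [κ.onC]
  · simp [hg.central, κ.onZ]
  · simp [hg.bCM, κ.onM]
  · simp only [hg.bCP n hn, map_smul, κ.onP, smul_zero, mul_zero, true_and,
      Pi.smul_apply, smul_eq_mul]
    intro m a
    rcases m with _ | m
    · simp
    · by_cases h : m = n
      · subst h
        by_cases h' : m + 1 ≤ N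
        · simp [h', (Nat.le_succ m).trans h']
          left; ring
        · simp [h']
      · simp [h]

lemma lie_M (κ : CGACoords d N H D C M P Mc) (hg : IsCGAHat d N H D C M P Mc) (i j : Fin d)
    (x : g) :
    κ.cH ⁅M i j, x⁆ = 0 ∧ κ.cD ⁅M i j, x⁆ = 0 ∧ κ.cC ⁅M i j, x⁆ = 0 ∧ κ.cZ ⁅M i j, x⁆ = 0 ∧
    (∀ a b, κ.so ⁅M i j, x⁆ a b = kron i a * κ.so x j b - kron j a * κ.so x i b
      - kron j b * κ.so x a i + kron i b * κ.so x a j) ∧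
    ∀ n a, κ.rad ⁅M i j, x⁆ n a = kron i a * κ.rad x n j - kron j a * κ.rad x n i := by
  have h1 : ⁅M i j, H⁆ = 0 := by rw [← lie_skew, hg.bHM, neg_zero]
  have h2 : ⁅M i j, D⁆ = 0 := by rw [← lie_skew, hg.bDM, neg_zero]
  have h3 : ⁅M i j, C⁆ = 0 := by rw [← lie_skew, hg.bCM, neg_zero]
  revert x
  refine hg.induct (fun x y hx hy => ?_) (fun t x hx => ?_) ?_ ?_ ?_ ?_ (fun k r => ?_)
    (fun n hn k => ?_)
  · simp only [lie_add, map_add, hx, hy, Pi.add_apply]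
    refine ⟨by ring, by ring, by ring, by ring, fun a b => by ring, fun n i => by ring⟩
  · simp only [lie_smul, map_smul, hx, Pi.smul_apply, smul_eq_mul]
    refine ⟨by ring, by ring, by ring, by ring, fun a b => by ring, fun n i => by ring⟩
  · simp [h1, κ.onH]
  · simp [h2, κ.onD]
  · simp [h3, κ.onC]
  · simp [hg.central, κ.onZ]
  · simp only [hg.bMM, map_add, map_sub, map_smul, κ.onM]
    simp only [Pi.add_apply, Pi.sub_apply, Pi.smul_apply, smul_eq_mul, smul_zero, add_zero,
      sub_zero, Pi.zero_apply, mul_zero, true_and, implies_true, and_true]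
    intro a b
    rw [kron_comm k j, kron_comm k i, kron_comm r j, kron_comm r i]
    ring
  · simp only [hg.bMP, map_add, map_smul, κ.onP]
    simp only [Pi.add_apply, Pi.smul_apply, smul_eq_mul, smul_zero, add_zero,
      sub_zero, Pi.zero_apply, mul_zero, true_and, implies_true]
    intro m a
    rw [kron_comm k j, kron_comm k i]
    split_ifs <;> ring

end CGACoords

end Coordinates


section Invariance

set_option linter.unusedSimpArgs false

open ComplexConjugate

variable {d N : ℕ} {g : Type*} [LieRing g] [LieAlgebra ℂ g]
  {H D C : g} {M : Fin d → Fin d → g} {P : ℕ → Fin d → g} {Mc : g}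

namespace CGACoords

/-- The coordinate functional belonging to an index of the standard basis. -/
def coordAt (κ : CGACoords d N H D C M P Mc) : CGAIndex d N → g →ₗ[ℂ] ℂ :=
  Sum.elim ![κ.cH, κ.cD, κ.cC, κ.cZ]
    (Sum.elim (fun p => LinearMap.proj p.1.2 ∘ₗ LinearMap.proj p.1.1 ∘ₗ κ.so)
      (fun q => LinearMap.proj q.2 ∘ₗ LinearMap.proj (q.1 : ℕ) ∘ₗ κ.rad))

lemma coordAt_family (κ : CGACoords d N H D C M P Mc) (hg : IsCGAHat d N H D C M P Mc)
    (i j : CGAIndex d N) : κ.coordAt i (hg.family j) = if j = i then 1 else 0 := by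
  rcases i with i | ⟨⟨a, b⟩, hab⟩ | ⟨n, a⟩ <;> rcases j with j | ⟨⟨a', b'⟩, hab'⟩ | ⟨n', a'⟩
  · fin_cases i <;> fin_cases j <;>
      simp [coordAt, IsCGAHat.family, κ.onH, κ.onD, κ.onC, κ.onZ]
  · fin_cases i <;> simp [coordAt, IsCGAHat.family, κ.onM]
  · fin_cases i <;> simp [coordAt, IsCGAHat.family, κ.onP]
  · fin_cases j <;> simp [coordAt, IsCGAHat.family, κ.onH, κ.onD, κ.onC, κ.onZ]
  · simp only [coordAt, IsCGAHat.family, Sum.elim_inr, Sum.elim_inl, LinearMap.comp_apply,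
      LinearMap.proj_apply, κ.onM, Sum.inr.injEq, Sum.inl.injEq, Subtype.mk.injEq, Prod.mk.injEq]
    simp only [kron]
    dsimp only at hab hab'
    by_cases h1 : a' = a <;> by_cases h2 : b' = b
    · subst h1 h2; simp [hab.ne']
    · subst h1; simp [h2, hab.ne, hab.ne']
    · subst h2; simp [h1, hab.ne, hab.ne']
    · have : ¬ (b' = a ∧ a' = b) := by
        rintro ⟨rfl, rfl⟩; exact absurd hab hab'.asymm
      simp only [h1, h2]
      by_cases h3 : b' = a
      · have h4 : a' ≠ b := fun h => this ⟨h3, h⟩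
        simp [h4]
      · simp [h3]
  · simp [coordAt, IsCGAHat.family, κ.onP]
  · fin_cases j <;> simp [coordAt, IsCGAHat.family, κ.onH, κ.onD, κ.onC, κ.onZ]
  · simp [coordAt, IsCGAHat.family, κ.onM]
  · have hn' : (n' : ℕ) ≤ N := by omega
    simp only [coordAt, IsCGAHat.family, Sum.elim_inr, LinearMap.comp_apply,
      LinearMap.proj_apply, κ.onP, Sum.inr.injEq, Prod.mk.injEq, hn', true_and, Fin.ext_iff, kron]
    rw [← ite_and]
    simp only [eq_comm]

lemma repr_basis (κ : CGACoords d N H D C M P Mc) (hg : IsCGAHat d N H D C M P Mc)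
    (x : g) (i : CGAIndex d N) : hg.basis.repr x i = κ.coordAt i x := by
  have : hg.basis.coord i = κ.coordAt i := by
    refine hg.basis.ext fun j => ?_
    rw [Module.Basis.coord_apply, Module.Basis.repr_self, hg.basis_apply, κ.coordAt_family hg,
      Finsupp.single_apply]
  rw [← this, Module.Basis.coord_apply]

/-- Square norms of the standard basis for which the semisimple part acts unitarily. -/
def sqNorm (d N : ℕ) : CGAIndex d N → ℝ :=
  Sum.elim ![1, 2, 1, 1] (Sum.elim (fun _ => 1) (fun q => ((N.choose q.1 : ℕ) : ℝ)⁻¹))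

lemma sqNorm_pos (i : CGAIndex d N) : 0 < sqNorm d N i := by
  rcases i with i | p | ⟨n, a⟩
  · fin_cases i <;> simp [sqNorm]
  · simp [sqNorm]
  · have := Nat.choose_pos (n := N) (k := n) (by omega)
    simp only [sqNorm, Sum.elim_inr]
    positivity

lemma conj_two : conj (2 : ℂ) = 2 := map_ofNat _ 2

lemma adjoint_D (κ : CGACoords d N H D C M P Mc) (hg : IsCGAHat d N H D C M P Mc)
    (i j : CGAIndex d N) :
    (sqNorm d N j : ℂ) * conj (hg.basis.repr ⁅D, hg.basis i⁆ j)
      = sqNorm d N i * hg.basis.repr ⁅D, hg.basis j⁆ i := by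
  simp only [κ.repr_basis hg, hg.basis_apply]
  rcases i with i | ⟨⟨a, b⟩, hab⟩ | ⟨n, a⟩ <;> rcases j with j | ⟨⟨a', b'⟩, hab'⟩ | ⟨n', a'⟩
  · fin_cases i <;> fin_cases j <;>
      simp [conj_two, coordAt, sqNorm, IsCGAHat.family, κ.lie_D hg, κ.onH, κ.onD, κ.onC, κ.onZ]
  · fin_cases i <;> simp [conj_two, coordAt, sqNorm, IsCGAHat.family, κ.lie_D hg, κ.onM]
  · fin_cases i <;> simp [conj_two, coordAt, sqNorm, IsCGAHat.family, κ.lie_D hg, κ.onP, κ.onH,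
      κ.onD, κ.onC, κ.onZ]
  · fin_cases j <;> simp [conj_two, coordAt, sqNorm, IsCGAHat.family, κ.lie_D hg, κ.onM]
  · simp [conj_two, coordAt, sqNorm, IsCGAHat.family, κ.lie_D hg]
  · simp [conj_two, coordAt, sqNorm, IsCGAHat.family, κ.lie_D hg, κ.onM]
  · fin_cases j <;> simp [conj_two, coordAt, sqNorm, IsCGAHat.family, κ.lie_D hg, κ.onP, κ.onH,
      κ.onD, κ.onC, κ.onZ]
  · simp [conj_two, coordAt, sqNorm, IsCGAHat.family, κ.lie_D hg, κ.onM]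
  · by_cases h : n = n'
    · subst h
      simp [conj_two, coordAt, sqNorm, IsCGAHat.family, κ.lie_D hg, κ.onP, apply_ite conj,
          conj_kron,
        kron_comm a a']
    · have h1 : (n : ℕ) ≠ n' := fun h' => h (Fin.ext h')
      simp [conj_two, coordAt, sqNorm, IsCGAHat.family, κ.lie_D hg, κ.onP, h1, h1.symm]

lemma adjoint_M (κ : CGACoords d N H D C M P Mc) (hg : IsCGAHat d N H D C M P Mc)
    (k r : Fin d) (i j : CGAIndex d N) :
    (sqNorm d N j : ℂ) * conj (hg.basis.repr ⁅M k r, hg.basis i⁆ j)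
      = sqNorm d N i * hg.basis.repr ⁅M r k, hg.basis j⁆ i := by
  simp only [κ.repr_basis hg, hg.basis_apply]
  rcases i with i | ⟨⟨a, b⟩, hab⟩ | ⟨n, a⟩ <;> rcases j with j | ⟨⟨a', b'⟩, hab'⟩ | ⟨n', a'⟩
  · fin_cases i <;> fin_cases j <;>
      simp [coordAt, sqNorm, IsCGAHat.family, κ.lie_M hg]
  · fin_cases i <;> simp [coordAt, sqNorm, IsCGAHat.family, κ.lie_M hg, κ.onH, κ.onD, κ.onC, κ.onZ]
  · fin_cases i <;> simp [coordAt, sqNorm, IsCGAHat.family, κ.lie_M hg, κ.onH, κ.onD, κ.onC, κ.onZ]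
  · fin_cases j <;> simp [coordAt, sqNorm, IsCGAHat.family, κ.lie_M hg, κ.onH, κ.onD, κ.onC, κ.onZ]
  · simp [coordAt, sqNorm, IsCGAHat.family, κ.lie_M hg, κ.onM, conj_kron]
    rw [kron_comm a' r, kron_comm a' k, kron_comm b' r, kron_comm b' k, kron_comm a' a,
      kron_comm b' b, kron_comm a' b, kron_comm b' a, kron_comm a r, kron_comm a k,
      kron_comm b r, kron_comm b k]
    ring
  · simp [coordAt, sqNorm, IsCGAHat.family, κ.lie_M hg, κ.onM, κ.onP]
  · fin_cases j <;> simp [coordAt, sqNorm, IsCGAHat.family, κ.lie_M hg, κ.onH, κ.onD, κ.onC, κ.onZ]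
  · simp [coordAt, sqNorm, IsCGAHat.family, κ.lie_M hg, κ.onM, κ.onP]
  · by_cases h : n = n'
    · subst h
      simp [coordAt, sqNorm, IsCGAHat.family, κ.lie_M hg, κ.onP, apply_ite conj, conj_kron,
        kron_comm a r, kron_comm a k, kron_comm a' r, kron_comm a' k]
      left
      split_ifs <;> ring
    · have h1 : (n : ℕ) ≠ n' := fun h' => h (Fin.ext h')
      simp [coordAt, sqNorm, IsCGAHat.family, κ.lie_M hg, κ.onP, h1, h1.symm]

lemma adjoint_H (κ : CGACoords d N H D C M P Mc) (hg : IsCGAHat d N H D C M P Mc)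
    (i j : CGAIndex d N) :
    (sqNorm d N j : ℂ) * conj (hg.basis.repr ⁅H, hg.basis i⁆ j)
      = sqNorm d N i * hg.basis.repr ⁅C, hg.basis j⁆ i * (-1) := by
  simp only [κ.repr_basis hg, hg.basis_apply]
  rcases i with i | ⟨⟨a, b⟩, hab⟩ | ⟨n, a⟩ <;> rcases j with j | ⟨⟨a', b'⟩, hab'⟩ | ⟨n', a'⟩
  · fin_cases i <;> fin_cases j <;>
      simp [conj_two, coordAt, sqNorm, IsCGAHat.family, κ.lie_H hg, κ.lie_C hg, κ.onH, κ.onD,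
          κ.onC, κ.onZ]
  · fin_cases i <;> simp [conj_two, coordAt, sqNorm, IsCGAHat.family, κ.lie_H hg, κ.lie_C hg, κ.onM]
  · fin_cases i <;> simp [conj_two, coordAt, sqNorm, IsCGAHat.family, κ.lie_H hg, κ.lie_C hg,
      κ.onP, κ.onH, κ.onD, κ.onC, κ.onZ]
  · fin_cases j <;> simp [conj_two, coordAt, sqNorm, IsCGAHat.family, κ.lie_H hg, κ.lie_C hg, κ.onM]
  · simp [conj_two, coordAt, sqNorm, IsCGAHat.family, κ.lie_H hg, κ.lie_C hg]
  · simp [conj_two, coordAt, sqNorm, IsCGAHat.family, κ.lie_H hg, κ.lie_C hg, κ.onM]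
  · fin_cases j <;> simp [conj_two, coordAt, sqNorm, IsCGAHat.family, κ.lie_H hg, κ.lie_C hg,
      κ.onP, κ.onH, κ.onD, κ.onC, κ.onZ]
  · simp [conj_two, coordAt, sqNorm, IsCGAHat.family, κ.lie_H hg, κ.lie_C hg, κ.onM]
  · obtain ⟨n, hn⟩ := n
    obtain ⟨n', hn'⟩ := n'
    by_cases h : n = n' + 1
    · subst h
      have hc := Nat.choose_succ_right_eq N n'
      have hc' : (N.choose (n' + 1) : ℂ) * (n' + 1) = N.choose n' * (N - n') := by
        have := congrArg (Nat.cast : ℕ → ℂ) hc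
        push_cast [Nat.cast_sub (show n' ≤ N by omega)] at this
        exact this
      have p1 : (N.choose (n' + 1) : ℂ) ≠ 0 := by
        exact_mod_cast (Nat.choose_pos (by omega)).ne'
      have p2 : (N.choose n' : ℂ) ≠ 0 := by
        exact_mod_cast (Nat.choose_pos (by omega)).ne'
      have q1 : n' + 1 ≤ N := by omega
      have q2 : n' ≤ N := by omega
      simp [conj_two, coordAt, sqNorm, IsCGAHat.family, κ.lie_H hg, κ.lie_C hg, κ.onP, conj_kron,
          q1, q2,
        kron_comm a' a]
      field_simp
      linear_combination (-kron a a') * hc'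
    · have h1 : ¬ (n' + 1 = n) := fun h' => h h'.symm
      have h2 : ¬ (1 ≤ n ∧ n - 1 = n') := by omega
      simp [conj_two, coordAt, sqNorm, IsCGAHat.family, κ.lie_H hg, κ.lie_C hg, κ.onP, h1]
      intro h3 _ _ h4
      exact absurd ⟨h3, h4⟩ h2

lemma adjoint_H' (κ : CGACoords d N H D C M P Mc) (hg : IsCGAHat d N H D C M P Mc)
    (i j : CGAIndex d N) :
    (sqNorm d N j : ℂ) * conj (hg.basis.repr ⁅H, hg.basis i⁆ j)
      = sqNorm d N i * hg.basis.repr ⁅-C, hg.basis j⁆ i := by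
  rw [κ.adjoint_H hg, neg_lie, map_neg, Finsupp.neg_apply]
  ring

lemma adjoint_C (κ : CGACoords d N H D C M P Mc) (hg : IsCGAHat d N H D C M P Mc)
    (i j : CGAIndex d N) :
    (sqNorm d N j : ℂ) * conj (hg.basis.repr ⁅C, hg.basis i⁆ j)
      = sqNorm d N i * hg.basis.repr ⁅-H, hg.basis j⁆ i := by
  have := congrArg conj (κ.adjoint_H hg j i)
  simp only [map_mul, Complex.conj_conj, Complex.conj_ofReal, map_neg, map_one] at this
  rw [neg_lie, map_neg, Finsupp.neg_apply, mul_neg, this]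
  ring

end CGACoords

/-- Every cocycle is cohomologous to one invariant under the semisimple part. -/
lemma IsCGAHat.exists_invariant (hg : IsCGAHat d N H D C M P Mc) {φ : g → g → g}
    (hφ : IsAdCocycle2 φ) : ∃ ω : g →ₗ[ℂ] g, ∀ a b,
      lieDer H (fun a b => φ a b - cob ω a b) a b = 0 ∧
      lieDer D (fun a b => φ a b - cob ω a b) a b = 0 ∧
      lieDer C (fun a b => φ a b - cob ω a b) a b = 0 ∧
      ∀ i j, lieDer (M i j) (fun a b => φ a b - cob ω a b) a b = 0 := by
  obtain ⟨κ⟩ := hg.nonempty_coords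
  obtain ⟨ω, h⟩ := hφ.exists_lieDer_sub_cob_eq_zero hg.basis _ (CGACoords.sqNorm_pos (d := d))
  exact ⟨ω, fun a b => ⟨h _ _ (κ.adjoint_H' hg) a b, h _ _ (κ.adjoint_D hg) a b,
    h _ _ (κ.adjoint_C hg) a b, fun i j => h _ _ (κ.adjoint_M hg i j) a b⟩⟩

end Invariance

section LeviPart

variable {d N : ℕ} {g : Type*} [LieRing g] [LieAlgebra ℂ g]
  {H D C : g} {M : Fin d → Fin d → g} {P : ℕ → Fin d → g} {Mc : g}

lemma exists_ne_ne (hd : 3 ≤ d) (i j : Fin d) : ∃ k, k ≠ i ∧ k ≠ j := by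
  by_contra! h
  have h1 : (Finset.univ : Finset (Fin d)) ⊆ {i, j} := fun k _ => by
    by_cases hk : k = i
    · simp [hk]
    · simp [h k hk]
  have h2 := (Finset.card_le_card h1).trans Finset.card_le_two
  simp at h2
  omega

/-- The Levi subalgebra `sl(2) ⊕ so(d)`. -/
def levi (H D C : g) (M : Fin d → Fin d → g) : Submodule ℂ g :=
  Submodule.span ℂ (({H, D, C} : Set g) ∪ {x | ∃ i j, x = M i j})

lemma H_mem_levi : H ∈ levi H D C M := Submodule.subset_span (by simp)

lemma D_mem_levi : D ∈ levi H D C M := Submodule.subset_span (by simp)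

lemma C_mem_levi : C ∈ levi H D C M := Submodule.subset_span (by simp)

lemma M_mem_levi (i j : Fin d) : M i j ∈ levi H D C M :=
  Submodule.subset_span (Or.inr ⟨i, j, rfl⟩)

lemma levi_induction {p : g → Prop} (h0 : p 0) (add : ∀ x y, p x → p y → p (x + y))
    (smul : ∀ (t : ℂ) x, p x → p (t • x)) (hH : p H) (hD : p D) (hC : p C)
    (hM : ∀ i j, p (M i j)) : ∀ x ∈ levi H D C M, p x := by
  intro x hx
  refine Submodule.span_induction ?_ h0 (fun x y _ _ => add x y) (fun t x _ => smul t x) hx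
  rintro x ((rfl | rfl | rfl) | ⟨i, j, rfl⟩)
  exacts [hH, hD, hC, hM i j]

namespace IsCGAHat

lemma lie_mem_levi (hg : IsCGAHat d N H D C M P Mc) :
    ∀ x ∈ levi H D C M, ∀ y ∈ levi H D C M, ⁅x, y⁆ ∈ levi H D C M := by
  have key : ∀ u : g, ⁅u, H⁆ ∈ levi H D C M → ⁅u, D⁆ ∈ levi H D C M → ⁅u, C⁆ ∈ levi H D C M →
      (∀ i j, ⁅u, M i j⁆ ∈ levi H D C M) → ∀ y ∈ levi H D C M, ⁅u, y⁆ ∈ levi H D C M := by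
    intro u h1 h2 h3 h4
    refine levi_induction (by simp) (fun x y hx hy => ?_) (fun t x hx => ?_) h1 h2 h3 h4
    · rw [lie_add]; exact add_mem hx hy
    · rw [lie_smul]; exact Submodule.smul_mem _ _ hx
  have mH : H ∈ levi H D C M := H_mem_levi
  have mD : D ∈ levi H D C M := D_mem_levi
  have mC : C ∈ levi H D C M := C_mem_levi
  refine levi_induction (by simp) (fun x y hx hy z hz => ?_) (fun t x hx z hz => ?_) ?_ ?_ ?_
    (fun i j => ?_)
  · rw [add_lie]; exact add_mem (hx z hz) (hy z hz)
  · rw [smul_lie]; exact Submodule.smul_mem _ _ (hx z hz)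
  · refine key H (by simp) ?_ ?_ (fun i j => by simp [hg.bHM])
    · rw [← lie_skew, hg.bDH]; exact neg_mem (Submodule.smul_mem _ _ mH)
    · rw [← lie_skew, hg.bCH]; exact neg_mem mD
  · refine key D ?_ (by simp) ?_ (fun i j => by simp [hg.bDM])
    · rw [hg.bDH]; exact Submodule.smul_mem _ _ mH
    · rw [hg.bDC]; exact Submodule.smul_mem _ _ mC
  · refine key C ?_ ?_ (by simp) (fun i j => by simp [hg.bCM])
    · rw [hg.bCH]; exact mD
    · rw [← lie_skew, hg.bDC]; exact neg_mem (Submodule.smul_mem _ _ mC)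
  · refine key (M i j) ?_ ?_ ?_ (fun k r => ?_)
    · rw [← lie_skew, hg.bHM]; simp
    · rw [← lie_skew, hg.bDM]; simp
    · rw [← lie_skew, hg.bCM]; simp
    · rw [hg.bMM]
      exact add_mem (add_mem (sub_mem (Submodule.smul_mem _ _ (M_mem_levi _ _))
        (Submodule.smul_mem _ _ (M_mem_levi _ _))) (Submodule.smul_mem _ _ (M_mem_levi _ _)))
        (Submodule.smul_mem _ _ (M_mem_levi _ _))

/-- The Levi subalgebra is perfect, as an induction principle. -/
lemma levi_bracket_induction (hg : IsCGAHat d N H D C M P Mc) (hd : 3 ≤ d) {p : g → Prop}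
    (add : ∀ x y, p x → p y → p (x + y)) (smul : ∀ (t : ℂ) x, p x → p (t • x))
    (lie : ∀ x ∈ levi H D C M, ∀ y ∈ levi H D C M, p ⁅x, y⁆) : ∀ x ∈ levi H D C M, p x := by
  have mH : H ∈ levi H D C M := H_mem_levi
  have mD : D ∈ levi H D C M := D_mem_levi
  have mC : C ∈ levi H D C M := C_mem_levi
  have p0 : p 0 := by simpa using lie H mH H mH
  refine levi_induction p0 add smul ?_ ?_ ?_ (fun i j => ?_)
  · have := smul (1 / 2) _ (lie D mD H mH)
    rw [hg.bDH, smul_smul] at this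
    norm_num at this
    exact this
  · have := lie C mC H mH
    rwa [hg.bCH] at this
  · have := smul (-1 / 2) _ (lie D mD C mC)
    rw [hg.bDC, smul_smul] at this
    norm_num at this
    exact this
  · by_cases hij : i = j
    · subst hij
      rw [hg.M_self]; exact p0
    · obtain ⟨k, hki, hkj⟩ := exists_ne_ne hd i j
      have := smul (-1) _ (lie _ (M_mem_levi i k) _ (M_mem_levi j k))
      rw [hg.bMM] at this
      simpa [kron_of_ne hij, kron_self, kron_of_ne hki.symm, kron_of_ne hkj] using this

lemma apply_lie_P_eq_zero (hg : IsCGAHat d N H D C M P Mc) {V : Type*} [AddCommGroup V] [Module ℂ V]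
    (F : g →ₗ[ℂ] V) (hF : ∀ n i, F (P n i) = 0) :
    ∀ x ∈ levi H D C M, ∀ n i, F ⁅x, P n i⁆ = 0 := by
  have hP : ∀ n i, N < n → P n i = 0 := fun n i h => hg.Pbound n h i
  refine levi_induction (by simp) (fun x y hx hy n i => ?_) (fun t x hx n i => ?_)
    (fun n i => ?_) (fun n i => ?_) (fun n i => ?_) (fun i j n k => ?_)
  · simp [hx, hy]
  · simp [hx]
  · rcases le_or_gt n N with h | h
    · simp [hg.bHP n h, hF]
    · simp [hP n i h]
  · rcases le_or_gt n N with h | h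
    · simp [hg.bDP n h, hF]
    · simp [hP n i h]
  · rcases le_or_gt n N with h | h
    · simp [hg.bCP n h, hF]
    · simp [hP n i h]
  · simp [hg.bMP, hF]

end IsCGAHat

namespace CGACoords

lemma cZ_lie_levi (κ : CGACoords d N H D C M P Mc) (hg : IsCGAHat d N H D C M P Mc) :
    ∀ x ∈ levi H D C M, ∀ v, κ.cZ ⁅x, v⁆ = 0 := by
  refine levi_induction (by simp) (fun x y hx hy v => ?_) (fun t x hx v => ?_)
    (fun v => ?_) (fun v => ?_) (fun v => ?_) (fun i j v => ?_)
  · simp [hx, hy]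
  · simp [hx]
  · exact (κ.lie_H hg v).2.2.2.1
  · exact (κ.lie_D hg v).2.2.2.1
  · exact (κ.lie_C hg v).2.2.2.1
  · exact (κ.lie_M hg i j v).2.2.2.1

lemma so_eq_zero_of_lie_M (κ : CGACoords d N H D C M P Mc) (hg : IsCGAHat d N H D C M P Mc)
    {i j c : Fin d} (hij : i ≠ j) (hci : c ≠ i) (hcj : c ≠ j) {x : g}
    (h : κ.so ⁅M i j, x⁆ = 0) : κ.so x i c = 0 := by
  have h1 := (κ.lie_M hg i j x).2.2.2.2.1 j c
  rw [h] at h1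
  simpa [kron_of_ne hij, kron_self, kron_of_ne hci.symm, kron_of_ne hcj.symm] using h1

/-- `Mc` spans the centre of the algebra. -/
lemma eq_zero_of_central (κ : CGACoords d N H D C M P Mc) (hg : IsCGAHat d N H D C M P Mc)
    (hd : 3 ≤ d) (hN : Odd N) {u : g} (hu : ∀ z : g, ⁅u, z⁆ = 0) (hz : κ.cZ u = 0) : u = 0 := by
  have hu' : ∀ z, ⁅z, u⁆ = 0 := fun z => by rw [← lie_skew, hu, neg_zero]
  have h1 := κ.lie_D hg u
  have h2 := κ.lie_H hg u
  rw [hu'] at h1 h2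
  simp only [map_zero, Pi.zero_apply] at h1 h2
  refine κ.ext_zero hg ?_ ?_ ?_ hz (fun i j => ?_) (fun n i => ?_)
  · linear_combination (-1 / 2) * h1.1
  · linear_combination (1 / 2) * h2.1
  · linear_combination h2.2.1
  · by_cases hij : i = j
    · subst hij
      have := κ.so_skew hg u i i
      linear_combination (1 / 2) * this
    · obtain ⟨k, hki, hkj⟩ := exists_ne_ne hd i j
      exact κ.so_eq_zero_of_lie_M hg hki.symm (Ne.symm hij) hkj.symm (by rw [hu', map_zero])
  · have h := h1.2.2.2.2.2 n i
    refine (mul_eq_zero.1 h.symm).resolve_left fun h' => ?_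
    have h3 : N = 2 * n := by
      have : (N : ℂ) = ((2 * n : ℕ) : ℂ) := by push_cast; linear_combination h'
      exact_mod_cast this
    exact (Nat.not_even_iff_odd.2 hN) ⟨n, by omega⟩

end CGACoords

namespace IsAdCocycle2

variable {φ : g → g → g}

lemma lieDer_levi (hφ : IsAdCocycle2 φ) (hH : ∀ a b, lieDer H φ a b = 0)
    (hD : ∀ a b, lieDer D φ a b = 0) (hC : ∀ a b, lieDer C φ a b = 0)
    (hM : ∀ i j a b, lieDer (M i j) φ a b = 0) :
    ∀ x ∈ levi H D C M, ∀ a b, lieDer x φ a b = 0 := by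
  have add' : ∀ a b c, φ a (b + c) = φ a b + φ a c := fun a b c => map_add (hφ.bilin a) b c
  have smul' : ∀ (t : ℂ) a b, φ a (t • b) = t • φ a b := fun t a b => map_smul (hφ.bilin a) t b
  refine levi_induction (fun a b => ?_) (fun x y hx hy a b => ?_) (fun t x hx a b => ?_)
    hH hD hC hM
  · have h1 : φ 0 b = 0 := LinearMap.map_zero₂ hφ.bilin b
    have h2 : φ a 0 = 0 := map_zero (hφ.bilin a)
    simp [lieDer, h1, h2]
  · have h1 := hx a b
    have h2 := hy a b
    simp only [lieDer, add_lie, hφ.addl, add'] at h1 h2 ⊢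
    rw [← add_zero (0 : g)]
    nth_rewrite 1 [← h1]
    rw [← h2]
    abel
  · have h1 := hx a b
    simp only [lieDer, smul_lie, hφ.smull, smul'] at h1 ⊢
    rw [← smul_sub, ← smul_sub, h1, smul_zero]

lemma apply_lie_of_lieDer (hφ : IsAdCocycle2 φ) {x y : g} (hx : ∀ a b, lieDer x φ a b = 0)
    (hy : ∀ a b, lieDer y φ a b = 0) (z : g) : φ ⁅x, y⁆ z = ⁅φ x y, z⁆ := by
  have h1 := hx y z
  have h2 := hy x z
  have h3 := hφ.cocycle x y z
  have h4 : φ ⁅y, x⁆ z = - φ ⁅x, y⁆ z := by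
    rw [← lie_skew y x]
    exact LinearMap.congr_fun (map_neg hφ.bilin _) z
  simp only [lieDer] at h1 h2
  rw [h4] at h2
  rw [hφ.skew y ⁅x, z⁆, hφ.skew x ⁅y, z⁆, ← lie_skew z (φ x y)] at h3
  rw [← sub_eq_zero]
  calc _ = (⁅x, φ y z⁆ - ⁅y, φ x z⁆ + -⁅φ x y, z⁆ - φ ⁅x, y⁆ z + -φ y ⁅x, z⁆ - -φ x ⁅y, z⁆)
        - (⁅x, φ y z⁆ - φ ⁅x, y⁆ z - φ y ⁅x, z⁆) + (⁅y, φ x z⁆ - -φ ⁅x, y⁆ z - φ x ⁅y, z⁆) := by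
        abel
    _ = 0 := by rw [h1, h2, h3]; simp

end IsAdCocycle2

/-- An invariant cocycle agrees with a coboundary when one argument lies in the Levi
subalgebra. -/
lemma IsCGAHat.exists_cob_eq_on_levi (hg : IsCGAHat d N H D C M P Mc) (hd : 3 ≤ d) (hN : Odd N)
    {φ : g → g → g} (hφ : IsAdCocycle2 φ)
    (hinv : ∀ x ∈ levi H D C M, ∀ a b, lieDer x φ a b = 0) :
    ∃ ω : g →ₗ[ℂ] g, ∀ x ∈ levi H D C M, ∀ z, φ x z = cob ω x z := by
  obtain ⟨κ⟩ := hg.nonempty_coords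
  have key : ∀ x ∈ levi H D C M, ∀ y ∈ levi H D C M, ∀ z, φ ⁅x, y⁆ z = ⁅φ x y, z⁆ :=
    fun x hx y hy => hφ.apply_lie_of_lieDer (hinv x hx) (hinv y hy)
  have hcZ : ∀ x ∈ levi H D C M, ∀ y ∈ levi H D C M, κ.cZ (φ x y) = 0 := by
    refine hg.levi_bracket_induction hd (fun x y hx hy z hz => ?_) (fun t x hx z hz => ?_)
      (fun x hx y hy z hz => ?_)
    · rw [hφ.addl, map_add, hx z hz, hy z hz, add_zero]
    · rw [hφ.smull, map_smul, hx z hz, smul_zero]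
    · rw [key x hx y hy, ← lie_skew, map_neg, κ.cZ_lie_levi hg z hz, neg_zero]
  have huniq : ∀ u v : g, κ.cZ u = 0 → κ.cZ v = 0 → (∀ z : g, ⁅u, z⁆ = ⁅v, z⁆) → u = v := by
    intro u v hu hv h
    rw [← sub_eq_zero]
    exact κ.eq_zero_of_central hg hd hN (fun z => by rw [sub_lie, h, sub_self]) (by simp [hu, hv])
  have hex : ∀ x ∈ levi H D C M, ∃ w, κ.cZ w = 0 ∧ ∀ z, ⁅w, z⁆ = φ x z := by
    refine hg.levi_bracket_induction hd ?_ ?_ (fun x hx y hy =>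
      ⟨φ x y, hcZ x hx y hy, fun z => (key x hx y hy z).symm⟩)
    · rintro x y ⟨u, hu, hu'⟩ ⟨v, hv, hv'⟩
      exact ⟨u + v, by simp [hu, hv], fun z => by rw [add_lie, hu', hv', hφ.addl]⟩
    · rintro t x ⟨u, hu, hu'⟩
      exact ⟨t • u, by simp [hu], fun z => by rw [smul_lie, hu', hφ.smull]⟩
  choose w hw hw' using hex
  have hwM : ∀ i j, w (M j i) (M_mem_levi j i) = - w (M i j) (M_mem_levi i j) := fun i j => by
    refine huniq _ _ (hw _ _) (by simp [hw]) fun z => ?_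
    rw [neg_lie, hw', hw', hg.skewM i j]
    exact LinearMap.congr_fun (map_neg hφ.bilin _) z
  obtain ⟨ω, eH, eD, eC, eZ, eM, eP⟩ := hg.exists_linearMap (w H H_mem_levi) (w D D_mem_levi)
    (w C C_mem_levi) 0 (fun i j => w (M i j) (M_mem_levi i j)) 0 hwM (by simp)
  simp only [Pi.zero_apply] at eP
  have hω : ∀ x ∈ levi H D C M, κ.cZ (ω x) = 0 ∧ ∀ z, ⁅ω x, z⁆ = φ x z := by
    refine levi_induction ?_ ?_ ?_ ?_ ?_ ?_ (fun i j => ?_)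
    · exact ⟨by simp, fun z => by
        rw [map_zero, zero_lie]; exact (LinearMap.map_zero₂ hφ.bilin z).symm⟩
    · rintro x y ⟨h1, h2⟩ ⟨h3, h4⟩
      exact ⟨by simp [h1, h3], fun z => by rw [map_add, add_lie, h2, h4, hφ.addl]⟩
    · rintro t x ⟨h1, h2⟩
      exact ⟨by simp [h1], fun z => by rw [map_smul, smul_lie, h2, hφ.smull]⟩
    · rw [eH]; exact ⟨hw _ _, hw' _ _⟩
    · rw [eD]; exact ⟨hw _ _, hw' _ _⟩
    · rw [eC]; exact ⟨hw _ _, hw' _ _⟩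
    · rw [eM]; exact ⟨hw _ _, hw' _ _⟩
  have hlie : ∀ x ∈ levi H D C M, ∀ y ∈ levi H D C M, ⁅x, ω y⁆ = ω ⁅x, y⁆ := by
    intro x hx y hy
    have h1 : ω ⁅x, y⁆ = φ x y := huniq _ _ (hω _ (hg.lie_mem_levi x hx y hy)).1 (hcZ x hx y hy)
      fun z => by rw [(hω _ (hg.lie_mem_levi x hx y hy)).2, key x hx y hy]
    rw [h1, ← lie_skew, (hω y hy).2, hφ.skew x y, neg_neg]
  refine ⟨ω, fun x hx z => ?_⟩
  have heq : ∀ z, ⁅x, ω z⁆ = ω ⁅x, z⁆ := by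
    refine hg.induct (fun a b ha hb => ?_) (fun t a ha => ?_) (hlie x hx _ H_mem_levi)
      (hlie x hx _ D_mem_levi) (hlie x hx _ C_mem_levi) ?_
      (fun i j => hlie x hx _ (M_mem_levi i j)) (fun n _ i => ?_)
    · rw [map_add, lie_add, lie_add, map_add, ha, hb]
    · rw [map_smul, lie_smul, lie_smul, map_smul, ha]
    · rw [eZ, hg.central]; simp
    · rw [eP, hg.apply_lie_P_eq_zero ω eP x hx]; simp
  rw [cob, heq z, ← lie_skew z (ω x), (hω x hx).2]
  abel

end LeviPart

section RadicalPart

variable {d N : ℕ} {g : Type*} [LieRing g] [LieAlgebra ℂ g]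
  {H D C : g} {M : Fin d → Fin d → g} {P : ℕ → Fin d → g} {Mc : g}

lemma bcoef_ne_zero (N m : ℕ) : bcoef N m ≠ 0 := by
  simp [bcoef, Nat.factorial_ne_zero]

lemma bcoef_succ {N m : ℕ} (h : m < N) :
    (m + 1 : ℂ) * bcoef N m + (N - m : ℂ) * bcoef N (m + 1) = 0 := by
  obtain ⟨k, rfl⟩ := Nat.exists_eq_add_of_lt h
  have h1 : m + k + 1 - m = k + 1 := by omega
  have h2 : m + k + 1 - (m + 1) = k := by omega
  simp only [bcoef, h1, h2, Nat.factorial_succ]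
  push_cast
  ring

lemma bcoef_self {N : ℕ} (hN : Odd N) : bcoef N N = - bcoef N 0 := by
  simp [bcoef, pow_add, hN.neg_one_pow]

/-- Invariance of a bilinear map under the Levi subalgebra. -/
def IsLeviInvariant (H D C : g) (M : Fin d → Fin d → g) (B : g →ₗ[ℂ] g →ₗ[ℂ] g) : Prop :=
  ∀ x ∈ levi H D C M, ∀ a b, ⁅x, B a b⁆ = B ⁅x, a⁆ b + B a ⁅x, b⁆

namespace IsLeviInvariant

variable {B : g →ₗ[ℂ] g →ₗ[ℂ] g}

lemma lie_H (hB : IsLeviInvariant H D C M B) (hg : IsCGAHat d N H D C M P Mc) {m n : ℕ}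
    (hm : m ≤ N) (hn : n ≤ N) (i j : Fin d) : ⁅H, B (P m i) (P n j)⁆ =
      (-(m : ℂ)) • B (P (m - 1) i) (P n j) + (-(n : ℂ)) • B (P m i) (P (n - 1) j) := by
  rw [hB _ H_mem_levi, hg.bHP m hm, hg.bHP n hn, map_smul, map_smul, LinearMap.smul_apply]

lemma lie_D (hB : IsLeviInvariant H D C M B) (hg : IsCGAHat d N H D C M P Mc) {m n : ℕ}
    (hm : m ≤ N) (hn : n ≤ N) (i j : Fin d) : ⁅D, B (P m i) (P n j)⁆ =
      (2 * N - 2 * m - 2 * n : ℂ) • B (P m i) (P n j) := by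
  rw [hB _ D_mem_levi, hg.bDP m hm, hg.bDP n hn, map_smul, map_smul, LinearMap.smul_apply,
    ← add_smul]
  congr 1; ring

lemma lie_C (hB : IsLeviInvariant H D C M B) (hg : IsCGAHat d N H D C M P Mc) {m n : ℕ}
    (hm : m ≤ N) (hn : n ≤ N) (i j : Fin d) : ⁅C, B (P m i) (P n j)⁆ =
      (N - m : ℂ) • B (P (m + 1) i) (P n j) + (N - n : ℂ) • B (P m i) (P (n + 1) j) := by
  rw [hB _ C_mem_levi, hg.bCP m hm, hg.bCP n hn, map_smul, map_smul, LinearMap.smul_apply]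

lemma lie_M (hB : IsLeviInvariant H D C M B) (hg : IsCGAHat d N H D C M P Mc) (a b : Fin d)
    (m n : ℕ) (i j : Fin d) : ⁅M a b, B (P m i) (P n j)⁆ =
      (-(kron a i)) • B (P m b) (P n j) + kron b i • B (P m a) (P n j)
      + ((-(kron a j)) • B (P m i) (P n b) + kron b j • B (P m i) (P n a)) := by
  rw [hB _ (M_mem_levi a b), hg.bMP, hg.bMP]
  simp only [map_add, map_smul, LinearMap.add_apply, LinearMap.smul_apply]

lemma eq_zero_of_add_ne (hB : IsLeviInvariant H D C M B) (hg : IsCGAHat d N H D C M P Mc)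
    {F : g →ₗ[ℂ] ℂ} (hD : ∀ x, F ⁅D, x⁆ = 0) {m n : ℕ} (hm : m ≤ N) (hn : n ≤ N)
    (hmn : m + n ≠ N) (i j : Fin d) : F (B (P m i) (P n j)) = 0 := by
  have h := hD (B (P m i) (P n j))
  rw [hB.lie_D hg hm hn, map_smul, smul_eq_mul, mul_eq_zero] at h
  refine h.resolve_left fun h' => hmn ?_
  have : ((m + n : ℕ) : ℂ) = N := by push_cast; linear_combination (-1 / 2) * h'
  exact_mod_cast this

/-- Up to scale there is only one invariant pairing of the `sl(2)`-module of spin `N / 2`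
with itself. -/
lemma bcoef_mul (hB : IsLeviInvariant H D C M B) (hg : IsCGAHat d N H D C M P Mc)
    {F : g →ₗ[ℂ] ℂ} (hH : ∀ x, F ⁅H, x⁆ = 0) {m : ℕ} (hm : m ≤ N) (i j : Fin d) :
    bcoef N 0 * F (B (P m i) (P (N - m) j)) = bcoef N m * F (B (P 0 i) (P N j)) := by
  induction m with
  | zero => simp
  | succ m ih =>
    have h := hH (B (P (m + 1) i) (P (N - m) j))
    rw [hB.lie_H hg hm (by omega)] at h
    have e1 : m + 1 - 1 = m := by omega
    have e2 : N - m - 1 = N - (m + 1) := by omega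
    rw [e1, e2, map_add, map_smul, map_smul, smul_eq_mul, smul_eq_mul,
      Nat.cast_sub (by omega)] at h
    push_cast at h
    have hne : (N - m : ℂ) ≠ 0 := by
      rw [sub_ne_zero]; exact_mod_cast (show N ≠ m by omega)
    refine mul_left_cancel₀ hne ?_
    linear_combination (-(bcoef N 0)) * h - (m + 1 : ℂ) * ih (by omega)
      - F (B (P 0 i) (P N j)) * bcoef_succ (show m < N by omega)

lemma eq_zero_of_ne (hB : IsLeviInvariant H D C M B) (hg : IsCGAHat d N H D C M P Mc)
    (hd : 3 ≤ d) {F : g →ₗ[ℂ] ℂ} (hM : ∀ a b x, F ⁅M a b, x⁆ = 0) (m n : ℕ) {i j : Fin d}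
    (hij : i ≠ j) : F (B (P m i) (P n j)) = 0 := by
  obtain ⟨k, hki, hkj⟩ := exists_ne_ne hd i j
  have h := hM i k (B (P m k) (P n j))
  rw [hB.lie_M hg] at h
  simpa [kron_of_ne hij, kron_self, kron_of_ne hki.symm, kron_of_ne hkj] using h

lemma apply_eq_apply (hB : IsLeviInvariant H D C M B) (hg : IsCGAHat d N H D C M P Mc)
    {F : g →ₗ[ℂ] ℂ} (hM : ∀ a b x, F ⁅M a b, x⁆ = 0) (m n : ℕ) (i j : Fin d) :
    F (B (P m i) (P n i)) = F (B (P m j) (P n j)) := by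
  by_cases hij : i = j
  · rw [hij]
  have h := hM i j (B (P m j) (P n i))
  rw [hB.lie_M hg] at h
  simp only [kron_of_ne hij, kron_self, kron_of_ne (Ne.symm hij), map_add, map_smul, smul_eq_mul]
    at h
  linear_combination h

lemma rad_eq_zero (hB : IsLeviInvariant H D C M B) (hg : IsCGAHat d N H D C M P Mc)
    (κ : CGACoords d N H D C M P Mc) (hN : Odd N) {m n : ℕ} (hm : m ≤ N) (hn : n ≤ N)
    (i j : Fin d) (k : ℕ) (a : Fin d) : κ.rad (B (P m i) (P n j)) k a = 0 := by
  have h := (κ.lie_D hg (B (P m i) (P n j))).2.2.2.2.2 k a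
  rw [hB.lie_D hg hm hn, map_smul, Pi.smul_apply, Pi.smul_apply, smul_eq_mul] at h
  by_contra hne
  have h1 := mul_right_cancel₀ hne h
  have h2 : ((N + 2 * k : ℕ) : ℂ) = ((2 * m + 2 * n : ℕ) : ℂ) := by
    push_cast; linear_combination h1
  have h3 : N + 2 * k = 2 * m + 2 * n := by exact_mod_cast h2
  obtain ⟨p, rfl⟩ := hN
  omega

lemma cH_eq_zero (hB : IsLeviInvariant H D C M B) (hg : IsCGAHat d N H D C M P Mc)
    (κ : CGACoords d N H D C M P Mc) (hd : 3 ≤ d) (hN : Odd N) (hs : ∀ a b, B b a = - B a b)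
    {m n : ℕ} (hm : m ≤ N) (hn : n ≤ N) (i j : Fin d) : κ.cH (B (P m i) (P n j)) = 0 := by
  by_cases hij : i = j
  swap
  · exact hB.eq_zero_of_ne hg hd (fun a b x => (κ.lie_M hg a b x).1) m n hij
  subst hij
  by_cases hmn : m + n + 1 = N
  swap
  · have h := (κ.lie_D hg (B (P m i) (P n i))).1
    rw [hB.lie_D hg hm hn, map_smul, smul_eq_mul] at h
    by_contra hne
    have h1 := mul_right_cancel₀ hne h
    apply hmn
    have : ((m + n + 1 : ℕ) : ℂ) = N := by push_cast; linear_combination (-1 / 2) * h1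
    exact_mod_cast this
  obtain ⟨p, rfl⟩ := hN
  have hskew : ∀ m n, κ.cH (B (P m i) (P n i)) = - κ.cH (B (P n i) (P m i)) := fun m n => by
    rw [hs, map_neg]
  have key : ∀ k ≤ p, κ.cH (B (P (p + k) i) (P (p - k) i)) = 0 := by
    intro k hk
    induction k with
    | zero => linear_combination (1 / 2) * hskew p p
    | succ k ih =>
      have h := (κ.lie_C hg (B (P (p + k) i) (P (p - (k + 1)) i))).1
      have e : p - (k + 1) + 1 = p - k := by omega
      rw [hB.lie_C hg (by omega) (by omega), e, map_add, map_smul, map_smul, ih (by omega),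
        smul_zero, add_zero, smul_eq_mul, mul_eq_zero] at h
      refine h.resolve_left fun h' => ?_
      have : ((2 * p + 1 : ℕ) : ℂ) = ((p + k : ℕ) : ℂ) := by linear_combination h'
      have : 2 * p + 1 = p + k := by exact_mod_cast this
      omega
  rcases le_total n m with h | h
  · have := key (m - p) (by omega)
    rwa [show p + (m - p) = m by omega, show p - (m - p) = n by omega] at this
  · have := key (n - p) (by omega)
    rw [show p + (n - p) = n by omega, show p - (n - p) = m by omega] at this
    rw [hskew, this, neg_zero]

lemma cD_eq_zero (hB : IsLeviInvariant H D C M B) (hg : IsCGAHat d N H D C M P Mc)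
    (κ : CGACoords d N H D C M P Mc) (hd : 3 ≤ d) (hN : Odd N) (hs : ∀ a b, B b a = - B a b)
    {m n : ℕ} (hm : m ≤ N) (hn : n ≤ N) (i j : Fin d) : κ.cD (B (P m i) (P n j)) = 0 := by
  have h := (κ.lie_H hg (B (P m i) (P n j))).1
  rw [hB.lie_H hg hm hn, map_add, map_smul, map_smul,
    hB.cH_eq_zero hg κ hd hN hs (by omega) hn, hB.cH_eq_zero hg κ hd hN hs hm (by omega)] at h
  simpa using h

lemma cC_eq_zero (hB : IsLeviInvariant H D C M B) (hg : IsCGAHat d N H D C M P Mc)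
    (κ : CGACoords d N H D C M P Mc) (hd : 3 ≤ d) (hN : Odd N) (hs : ∀ a b, B b a = - B a b)
    {m n : ℕ} (hm : m ≤ N) (hn : n ≤ N) (i j : Fin d) : κ.cC (B (P m i) (P n j)) = 0 := by
  have h := (κ.lie_H hg (B (P m i) (P n j))).2.1
  rw [hB.lie_H hg hm hn, map_add, map_smul, map_smul,
    hB.cD_eq_zero hg κ hd hN hs (by omega) hn, hB.cD_eq_zero hg κ hd hN hs hm (by omega)] at h
  simpa using h

end IsLeviInvariant

/-- There is no nonzero `so(d)`-equivariant symmetric bilinear map from the defining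
representation to the adjoint one. -/
lemma equivariant_symm_eq_zero (hd : 3 ≤ d) (S : Fin d → Fin d → Fin d → Fin d → ℂ)
    (symm : ∀ i j u v, S i j u v = S j i u v) (skew : ∀ i j u v, S i j v u = - S i j u v)
    (equiv : ∀ a b i j u v,
      kron a u * S i j b v - kron b u * S i j a v - kron b v * S i j u a + kron a v * S i j u b
      = -(kron a i) * S b j u v + kron b i * S a j u v
        + (-(kron a j) * S i b u v + kron b j * S i a u v)) (i j u v : Fin d) :
    S i j u v = 0 := by
  have hdiag : ∀ i j u, S i j u u = 0 := fun i j u => by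
    linear_combination (1 / 2) * skew i j u u
  have h1 : ∀ i a, a ≠ i → S i i a i = 0 := fun i a hai => by
    obtain ⟨b, hba, hbi⟩ := exists_ne_ne hd a i
    have := equiv a b i i b i
    simpa [kron_of_ne hai, kron_of_ne hbi, kron_of_ne hba.symm, kron_self] using this
  have h2 : ∀ i j c, j ≠ i → c ≠ i → c ≠ j → S i i j c = 0 := fun i j c hji hci hcj => by
    have e1 := equiv i j i i i c
    have e2 := equiv i j j j i c
    simp only [kron_self, kron_of_ne hji, kron_of_ne hji.symm, kron_of_ne hci.symm,
      kron_of_ne hcj.symm] at e1 e2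
    linear_combination e1 + e2 - skew j j c j + h1 j c hcj
  have h3 : ∀ i u v, S i i u v = 0 := fun i u v => by
    by_cases huv : u = v
    · rw [huv, hdiag]
    by_cases hv : v = i
    · rw [hv] at huv ⊢; exact h1 i u huv
    by_cases hu : u = i
    · rw [skew, hu, h1 i v hv, neg_zero]
    exact h2 i u v hu hv (Ne.symm huv)
  by_cases hij : i = j
  · rw [hij, h3]
  · have e := equiv i j i i u v
    simp only [kron_self, kron_of_ne (Ne.symm hij), h3] at e
    linear_combination (1 / 2) * e + (1 / 2) * symm i j u v

namespace IsLeviInvariant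

variable {B : g →ₗ[ℂ] g →ₗ[ℂ] g}

lemma so_eq_zero (hB : IsLeviInvariant H D C M B) (hg : IsCGAHat d N H D C M P Mc)
    (κ : CGACoords d N H D C M P Mc) (hd : 3 ≤ d) (hN : Odd N) (hs : ∀ a b, B b a = - B a b)
    {m n : ℕ} (hm : m ≤ N) (hn : n ≤ N) (i j u v : Fin d) :
    κ.so (B (P m i) (P n j)) u v = 0 := by
  let F : Fin d → Fin d → g →ₗ[ℂ] ℂ := fun u v => LinearMap.proj v ∘ₗ LinearMap.proj u ∘ₗ κ.so
  have hF : ∀ u v x, F u v x = κ.so x u v := fun _ _ _ => rfl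
  have hH : ∀ u v x, F u v ⁅H, x⁆ = 0 := fun u v x => by
    rw [hF, (κ.lie_H hg x).2.2.2.2.1]; rfl
  have hD : ∀ u v x, F u v ⁅D, x⁆ = 0 := fun u v x => by
    rw [hF, (κ.lie_D hg x).2.2.2.2.1]; rfl
  have h0 := equivariant_symm_eq_zero hd (fun i j u v => κ.so (B (P 0 i) (P N j)) u v)
    (fun i j u v => by
      have h := hB.bcoef_mul hg (hH u v) le_rfl j i
      rw [Nat.sub_self, bcoef_self hN, hs (P 0 i), map_neg, hF, hF] at h
      refine mul_left_cancel₀ (bcoef_ne_zero N 0) ?_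
      linear_combination -h)
    (fun i j u v => κ.so_skew hg _ u v)
    (fun a b i j u v => by
      have h := (κ.lie_M hg a b (B (P 0 i) (P N j))).2.2.2.2.1 u v
      rw [← h, hB.lie_M hg]
      simp only [map_add, map_smul, Pi.add_apply, Pi.smul_apply, smul_eq_mul])
  rw [← hF]
  by_cases hmn : m + n = N
  · obtain rfl : n = N - m := by omega
    have h := hB.bcoef_mul hg (hH u v) hm i j
    rw [hF u v (B (P 0 i) (P N j)), h0, mul_zero] at h
    exact (mul_eq_zero.1 h).resolve_left (bcoef_ne_zero N 0)
  · exact hB.eq_zero_of_add_ne hg (hD u v) hm hn hmn i j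

/-- On the radical an invariant alternating bilinear map is a multiple of the bracket. -/
lemma exists_smul_lie (hB : IsLeviInvariant H D C M B) (hg : IsCGAHat d N H D C M P Mc)
    (hd : 3 ≤ d) (hN : Odd N) (hs : ∀ a b, B b a = - B a b) :
    ∃ α : ℂ, ∀ m n i j, B (P m i) (P n j) = α • ⁅P m i, P n j⁆ := by
  obtain ⟨κ⟩ := hg.nonempty_coords
  let k : Fin d := ⟨0, by omega⟩
  refine ⟨κ.cZ (B (P 0 k) (P N k)) / bcoef N 0, fun m n i j => ?_⟩
  rcases lt_or_ge N m with hm | hm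
  · simp [hg.Pbound m hm i]
  rcases lt_or_ge N n with hn | hn
  · simp [hg.Pbound n hn j]
  rw [hg.bPP, smul_smul]
  rw [← sub_eq_zero]
  have hM : ∀ a b x, κ.cZ ⁅M a b, x⁆ = 0 := fun a b x => (κ.lie_M hg a b x).2.2.2.1
  have hb := bcoef_ne_zero N 0
  refine κ.ext_zero hg ?_ ?_ ?_ ?_ (fun u v => ?_) (fun l a => ?_)
  · simp [-mul_ite, -ite_smul, hB.cH_eq_zero hg κ hd hN hs hm hn, κ.onZ]
  · simp [-mul_ite, -ite_smul, hB.cD_eq_zero hg κ hd hN hs hm hn, κ.onZ]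
  · simp [-mul_ite, -ite_smul, hB.cC_eq_zero hg κ hd hN hs hm hn, κ.onZ]
  · rw [map_sub, map_smul, κ.onZ.2.2.2.1, smul_eq_mul, mul_one]
    by_cases hmn : m + n = N
    swap
    · simp [hB.eq_zero_of_add_ne hg (fun x => (κ.lie_D hg x).2.2.2.1) hm hn hmn, hmn]
    by_cases hij : i = j
    swap
    · simp [hB.eq_zero_of_ne hg hd hM m n hij, kron_of_ne hij]
    subst hij
    obtain rfl : n = N - m := by omega
    have h := hB.bcoef_mul hg (fun x => (κ.lie_H hg x).2.2.2.1) hm i i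
    rw [hB.apply_eq_apply hg hM 0 N i k] at h
    rw [if_pos hmn, kron_self, one_mul, sub_eq_zero, div_mul_eq_mul_div, eq_div_iff hb]
    linear_combination h
  · simp [-mul_ite, -ite_smul, hB.so_eq_zero hg κ hd hN hs hm hn, κ.onZ]
  · simp [-mul_ite, -ite_smul, hB.rad_eq_zero hg κ hN hm hn, κ.onZ]

end IsLeviInvariant

/-- A cocycle vanishing on the Levi subalgebra is a coboundary. -/
lemma IsCGAHat.exists_eq_cob (hg : IsCGAHat d N H D C M P Mc) (hd : 3 ≤ d) (hN : Odd N)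
    {φ : g → g → g} (hφ : IsAdCocycle2 φ) (hl : ∀ x ∈ levi H D C M, ∀ z, φ x z = 0) :
    ∃ ω : g →ₗ[ℂ] g, ∀ a b, φ a b = cob ω a b := by
  obtain ⟨κ⟩ := hg.nonempty_coords
  have hB : IsLeviInvariant H D C M hφ.bilin := fun x hx a b => by
    have h := hφ.lieDer_eq_cob x a b
    have h0 : hφ.bilin x = 0 := LinearMap.ext (hl x hx)
    rw [h0] at h
    simp only [cob, lieDer, LinearMap.zero_apply, lie_zero, sub_zero] at h
    simp only [IsAdCocycle2.bilin_apply]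
    rw [sub_sub, sub_eq_zero] at h
    exact h
  obtain ⟨α, hα⟩ := hB.exists_smul_lie hg hd hN fun a b => hφ.skew a b
  simp only [IsAdCocycle2.bilin_apply] at hα
  have hcZ : ∀ m n i j, ⁅P m i, P n j⁆ = κ.cZ ⁅P m i, P n j⁆ • Mc := fun m n i j => by
    rw [hg.bPP, map_smul, κ.onZ.2.2.2.1, smul_eq_mul, mul_one]
  have hcen : ∀ (m n : ℕ) (i j : Fin d) (x : g), ⁅x, φ (P m i) (P n j)⁆ = 0 := fun m n i j x => by
    rw [hα, hcZ, lie_smul, lie_smul, hg.central, smul_zero, smul_zero]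
  have hMcP : ∀ n j, φ Mc (P n j) = 0 := fun n j => by
    obtain ⟨i, hij, -⟩ := exists_ne_ne hd j j
    have h := hφ.cocycle (P 0 i) (P N i) (P n j)
    have e1 : ⁅P 0 i, P N i⁆ = bcoef N 0 • Mc := by simp [hg.bPP, kron_self]
    have e2 : ∀ m, ⁅P m i, P n j⁆ = 0 := fun m => by simp [hg.bPP, kron_of_ne hij]
    have e3 : ∀ x, φ 0 x = 0 := fun x => LinearMap.map_zero₂ hφ.bilin x
    rw [hcen, hcen, hcen, e1, e2, e2, e3, e3, hφ.smull] at h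
    simpa [bcoef_ne_zero] using h
  have hP : ∀ x, ∀ n j, φ x (P n j) = (α * κ.cZ ⁅x, P n j⁆) • Mc := by
    have hlev : ∀ x ∈ levi H D C M, ∀ n j, φ x (P n j) = (α * κ.cZ ⁅x, P n j⁆) • Mc :=
      fun x hx n j => by rw [hl x hx, κ.cZ_lie_levi hg x hx, mul_zero, zero_smul]
    refine hg.induct (fun x y hx hy n j => ?_) (fun t x hx n j => ?_) (hlev _ H_mem_levi)
      (hlev _ D_mem_levi) (hlev _ C_mem_levi) (fun n j => ?_)
      (fun i j => hlev _ (M_mem_levi i j)) (fun m _ i n j => ?_)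
    · rw [hφ.addl, hx, hy, add_lie, map_add, mul_add, add_smul]
    · rw [hφ.smull, hx, smul_lie, map_smul, smul_smul, smul_eq_mul, mul_left_comm]
    · rw [hMcP, ← lie_skew, hg.central]; simp
    · rw [hα, hcZ, smul_smul, ← hcZ]
  have hall : ∀ b a, φ a b = (α * κ.cZ ⁅a, b⁆) • Mc := by
    have hlev : ∀ x ∈ levi H D C M, ∀ a, φ a x = (α * κ.cZ ⁅a, x⁆) • Mc := fun x hx a => by
      rw [hφ.skew x a, hl x hx, ← lie_skew, map_neg, κ.cZ_lie_levi hg x hx]; simp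
    refine hg.induct (fun x y hx hy a => ?_) (fun t x hx a => ?_) (hlev _ H_mem_levi)
      (hlev _ D_mem_levi) (hlev _ C_mem_levi) ?_
      (fun i j => hlev _ (M_mem_levi i j)) (fun n _ j a => hP a n j)
    · rw [hφ.skew, hφ.addl, neg_add, ← hφ.skew, ← hφ.skew, hx, hy, lie_add, map_add, mul_add,
        add_smul]
    · rw [hφ.skew, hφ.smull, ← smul_neg, ← hφ.skew, hx, lie_smul, map_smul, smul_smul,
        smul_eq_mul, mul_left_comm]
    · intro a
      rw [hg.central, map_zero, mul_zero, zero_smul]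
      have hlev' : ∀ x ∈ levi H D C M, φ x Mc = 0 := fun x hx => hl x hx Mc
      revert a
      refine hg.induct (fun x y hx hy => ?_) (fun t x hx => ?_) (hlev' _ H_mem_levi)
        (hlev' _ D_mem_levi) (hlev' _ C_mem_levi) (hφ.self_eq_zero Mc)
        (fun i j => hlev' _ (M_mem_levi i j)) (fun n _ j => ?_)
      · rw [hφ.addl, hx, hy, add_zero]
      · rw [hφ.smull, hx, smul_zero]
      · rw [hφ.skew Mc, hMcP, neg_zero]
  refine ⟨(-α) • κ.cZ.smulRight Mc, fun a b => ?_⟩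
  rw [hall]
  simp [cob, hg.central, smul_smul]

end RadicalPart

/-- For the mass central extension `g = ĉga_ℓ(d,ℂ)` with `d ≥ 3` and
`ℓ ∈ 1/2 + ℕ₀` (`N = 2ℓ` odd): `H²(g,g) = 0`. -/
theorem stmt16 (d N : ℕ) (hd : 3 ≤ d) (hN : Odd N)
    {g : Type*} [LieRing g] [LieAlgebra ℂ g]
    (H D C : g) (M : Fin d → Fin d → g) (P : ℕ → Fin d → g) (Mc : g)
    (hg : IsCGAHat d N H D C M P Mc) :
    H2IsTrivial g := by
  intro φ hφ
  obtain ⟨ω₁, h₁⟩ := hg.exists_invariant hφ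
  have hφ₁ := hφ.sub (IsAdCocycle2.cob_isAdCocycle2 ω₁)
  obtain ⟨ω₂, h₂⟩ := hg.exists_cob_eq_on_levi hd hN hφ₁
    (hφ₁.lieDer_levi (fun a b => (h₁ a b).1) (fun a b => (h₁ a b).2.1)
      (fun a b => (h₁ a b).2.2.1) (fun i j a b => (h₁ a b).2.2.2 i j))
  obtain ⟨ω₃, h₃⟩ := hg.exists_eq_cob hd hN (hφ₁.sub (IsAdCocycle2.cob_isAdCocycle2 ω₂))
    fun x hx z => sub_eq_zero.2 (h₂ x hx z)
  refine ⟨ω₁ + ω₂ + ω₃, fun a b => ?_⟩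
  have h := h₃ a b
  rw [sub_eq_iff_eq_add, sub_eq_iff_eq_add] at h
  rw [h]
  simp only [cob, LinearMap.add_apply, lie_add]
  abel
end
end
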